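/- There exist a universal constant C > 0, a universal ε₀ > 0, and for each M ≥ 1 a constant c(M) > 0 with the following property. Let 0 < ε ≤ ε₀, let 0 < T ≤ c(M)·ε^{-3}, and let u be a KdV solution on [0,T] whose initial data satisfies ‖u(0,·)‖_{Ḃ^{-1/2}_{2,∞}} + ‖x·u(0,·)‖_{Ḣ^{1/2}} ≤ ε, and which satisfies the bootstrap bounds with constants M, ε for every t ∈ (0,T]. If z : [0,T] × ℝ → ℝ is smooth, z(t,·) is Schwartz for each t, and z solves the linearized KdV equation ∂ₜz + ∂ₓ³z = 6∂ₓ(u·z), then for every t ∈ [0,T]: C^{-1}‖z(0,·)‖_{Ḣ^{-1/2}} ≤ ‖z(t,·)‖_{Ḣ^{-1/2}} ≤ C‖z(0,·)‖_{Ḣ^{-1/2}}. -/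

import Mathlib

open MeasureTheory Real SchwartzMap Set
open scoped FourierTransform

noncomputable section

/-- Fourier transform of a real-valued function on `ℝ`. -/
def FT (u : ℝ → ℝ) : ℝ → ℂ := 𝓕 (fun x => (u x : ℂ))

/-- Homogeneous Sobolev norm `‖u‖_{Ḣˢ}`. -/
def HsNorm (s : ℝ) (u : ℝ → ℝ) : ℝ :=
  (∫ ξ : ℝ, |ξ| ^ (2 * s) * ‖FT u ξ‖ ^ 2) ^ (1/2 : ℝ)

/-- Homogeneous Besov norm `‖u‖_{Ḃ^{-1/2}_{2,∞}}`. -/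
def BesovNorm (u : ℝ → ℝ) : ℝ :=
  ⨆ j : ℤ, (2:ℝ) ^ (-(j:ℝ)/2) *
    (∫ ξ in {ξ : ℝ | (2:ℝ)^j ≤ |ξ| ∧ |ξ| < (2:ℝ)^(j+1)}, ‖FT u ξ‖^2) ^ (1/2:ℝ)

/-- `L²` norm. -/
def L2Norm (u : ℝ → ℝ) : ℝ := (∫ x : ℝ, u x ^ 2) ^ (1/2:ℝ)

/-- `L²` norm restricted to a set. -/
def L2NormOn (A : Set ℝ) (u : ℝ → ℝ) : ℝ := (∫ x in A, u x ^ 2) ^ (1/2:ℝ)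

/-- The time-dependent japanese bracket `⟨x⟩ = (x² + t^{2/3})^{1/2}`. -/
def jb (t x : ℝ) : ℝ := (x^2 + t ^ ((2:ℝ)/3)) ^ (1/2:ℝ)

/-- `u` is a KdV solution on the time interval `I`: it is smooth on `I × ℝ`,
Schwartz in `x` for each `t ∈ I`, and satisfies `∂ₜu + ∂ₓ³u - 6u∂ₓu = 0` on `I × ℝ`. -/
def IsKdVOn (I : Set ℝ) (u : ℝ → ℝ → ℝ) : Prop :=
  ContDiffOn ℝ (⊤ : ℕ∞) (fun p : ℝ × ℝ => u p.1 p.2) (I ×ˢ (Set.univ : Set ℝ)) ∧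
  (∀ t ∈ I, ∃ f : 𝓢(ℝ, ℝ), ∀ x, u t x = f x) ∧
  (∀ t ∈ I, ∀ x : ℝ,
    deriv (fun s => u s x) t + iteratedDeriv 3 (u t) x - 6 * u t x * deriv (u t) x = 0)

/-- The bootstrap bounds with constants `M`, `ε` at time `t`. -/
def Bootstrap (M ε t : ℝ) (u : ℝ → ℝ) : Prop :=
  ∀ x : ℝ, |u x| ≤ M * ε * t ^ (-(1:ℝ)/4) * jb t x ^ (-(1:ℝ)/4) ∧
    |deriv u x| ≤ M * ε * t ^ (-(3:ℝ)/4) * jb t x ^ ((1:ℝ)/4)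

namespace LinKdV

/-- Complex Schwartz functions on the line. -/
abbrev Sch := 𝓢(ℝ, ℂ)

/-- The Fourier multiplier with symbol `m`. -/
def mult (m : ℝ → ℂ) : Sch →L[ℂ] Sch := fourierMultiplierCLM ℂ m

/-- The `L²` norm of a Schwartz function. -/
def L2 (f : Sch) : ℝ := ‖f.toLp 2‖

/-- The real part of the `L²` inner product. -/
def ip (f g : Sch) : ℝ := (inner ℂ (f.toLp 2) (g.toLp 2)).re

lemma fourier_mult {m : ℝ → ℂ} (hm : m.HasTemperateGrowth) (f : Sch) (ξ : ℝ) :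
    𝓕 (mult m f) ξ = m ξ * 𝓕 f ξ := by
  have h : 𝓕 (mult m f) = smulLeftCLM ℂ m (𝓕 f) :=
    FourierTransform.fourier_fourierInv_eq (smulLeftCLM ℂ m (𝓕 f))
  rw [h,
    smulLeftCLM_apply_apply hm, smul_eq_mul]

lemma mult_mult {m₁ m₂ : ℝ → ℂ} (h₁ : m₁.HasTemperateGrowth) (h₂ : m₂.HasTemperateGrowth)
    (f : Sch) : mult m₁ (mult m₂ f) = mult (fun ξ => m₁ ξ * m₂ ξ) f :=
  fourierMultiplierCLM_fourierMultiplierCLM_apply h₁ h₂ f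

lemma mult_comm {m₁ m₂ : ℝ → ℂ} (h₁ : m₁.HasTemperateGrowth) (h₂ : m₂.HasTemperateGrowth)
    (f : Sch) : mult m₁ (mult m₂ f) = mult m₂ (mult m₁ f) := by
  rw [mult_mult h₁ h₂, mult_mult h₂ h₁]
  simp_rw [mul_comm]

lemma mult_one (f : Sch) : mult (fun _ => 1) f = f := by
  simp [mult]

lemma ext_fourier {f g : Sch} (h : ∀ ξ, 𝓕 f ξ = 𝓕 g ξ) : f = g := by
  have h1 : (𝓕 f : Sch) = (𝓕 g : Sch) := SchwartzMap.ext h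
  have h2 := congrArg (fun k : Sch => (𝓕⁻ k : Sch)) h1
  simpa using h2

lemma fourier_add' (f g : Sch) (ξ : ℝ) : 𝓕 (f + g) ξ = 𝓕 f ξ + 𝓕 g ξ := by
  rw [FourierTransform.fourier_add]; rfl

lemma fourier_smul' (c : ℂ) (f : Sch) (ξ : ℝ) : 𝓕 (c • f) ξ = c * 𝓕 f ξ := by
  rw [FourierTransform.fourier_smul]; rfl

lemma L2_nonneg (f : Sch) : 0 ≤ L2 f := norm_nonneg _

lemma ip_eq_integral (f g : Sch) : ip f g = (∫ x, (starRingEnd ℂ) (f x) * g x).re := by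
  simp [ip, mul_comm]

lemma ip_self (f : Sch) : ip f f = L2 f ^ 2 := by
  simp only [ip, L2]
  exact inner_self_eq_norm_sq (𝕜 := ℂ) _

lemma toLp_add (f g : Sch) :
    (f + g).toLp 2 (volume : Measure ℝ) = f.toLp 2 (volume : Measure ℝ) + g.toLp 2 (volume : Measure ℝ) :=
  map_add (toLpCLM ℂ ℂ 2 (volume : Measure ℝ)) f g

lemma toLp_smul (c : ℂ) (f : Sch) : (c • f).toLp 2 = c • f.toLp 2 :=
  map_smul (toLpCLM ℂ ℂ 2 (volume : Measure ℝ)) c f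

lemma toLp_neg (f : Sch) : (-f).toLp 2 = -f.toLp 2 :=
  map_neg (toLpCLM ℂ ℂ 2 (volume : Measure ℝ)) f

lemma toLp_sub (f g : Sch) :
    (f - g).toLp 2 (volume : Measure ℝ) = f.toLp 2 (volume : Measure ℝ) - g.toLp 2 (volume : Measure ℝ) :=
  map_sub (toLpCLM ℂ ℂ 2 (volume : Measure ℝ)) f g

lemma L2_add_le (f g : Sch) : L2 (f + g) ≤ L2 f + L2 g := by
  simp only [L2, toLp_add]; exact norm_add_le _ _

lemma L2_neg (f : Sch) : L2 (-f) = L2 f := by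
  simp only [L2, toLp_neg, norm_neg]

lemma L2_sub_le (f g : Sch) : L2 (f - g) ≤ L2 f + L2 g := by
  simp only [L2, toLp_sub]; exact norm_sub_le _ _

lemma ip_add_left (f g h : Sch) : ip (f + g) h = ip f h + ip g h := by
  simp only [ip, toLp_add, inner_add_left, Complex.add_re]

lemma ip_add_right (f g h : Sch) : ip f (g + h) = ip f g + ip f h := by
  simp only [ip, toLp_add, inner_add_right, Complex.add_re]

lemma ip_neg_left (f h : Sch) : ip (-f) h = -ip f h := by
  simp only [ip, toLp_neg, inner_neg_left, Complex.neg_re]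

lemma ip_neg_right (f h : Sch) : ip f (-h) = -ip f h := by
  simp only [ip, toLp_neg, inner_neg_right, Complex.neg_re]

lemma ip_sub_left (f g h : Sch) : ip (f - g) h = ip f h - ip g h := by
  simp only [ip, toLp_sub, inner_sub_left, Complex.sub_re]

lemma ip_sub_right (f g h : Sch) : ip f (g - h) = ip f g - ip f h := by
  simp only [ip, toLp_sub, inner_sub_right, Complex.sub_re]

lemma ip_smul_left (c : ℝ) (f g : Sch) : ip ((c : ℂ) • f) g = c * ip f g := by
  simp only [ip, toLp_smul, inner_smul_left, Complex.conj_ofReal, Complex.re_ofReal_mul]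

lemma ip_smul_right (c : ℝ) (f g : Sch) : ip f ((c : ℂ) • g) = c * ip f g := by
  simp only [ip, toLp_smul, inner_smul_right, Complex.re_ofReal_mul]

lemma ip_comm (f g : Sch) : ip f g = ip g f := by
  simp only [ip]; exact inner_re_symm (𝕜 := ℂ) _ _

lemma ip_zero_left (g : Sch) : ip 0 g = 0 := by
  simpa using ip_smul_left 0 0 g

lemma ip_sum_left {ι : Type*} (s : Finset ι) (f : ι → Sch) (g : Sch) :
    ip (∑ i ∈ s, f i) g = ∑ i ∈ s, ip (f i) g := by
  classical
  induction s using Finset.induction_on with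
  | empty => simp [ip_zero_left]
  | insert a s ha ih => rw [Finset.sum_insert ha, Finset.sum_insert ha, ip_add_left, ih]

lemma ip_sum_right {ι : Type*} (s : Finset ι) (f : ι → Sch) (g : Sch) :
    ip g (∑ i ∈ s, f i) = ∑ i ∈ s, ip g (f i) := by
  rw [ip_comm, ip_sum_left]; simp_rw [ip_comm]

lemma abs_ip_le (f g : Sch) : |ip f g| ≤ L2 f * L2 g :=
  (Complex.abs_re_le_norm _).trans (norm_inner_le_norm _ _)

lemma ip_fourier (f g : Sch) : ip (𝓕 f) (𝓕 g) = ip f g := by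
  simp only [ip, inner_fourier_toL2_eq]

lemma L2_sq_eq (f : Sch) : L2 f ^ 2 = ∫ x, ‖f x‖ ^ 2 := by
  rw [← ip_self, ip_eq_integral, ← RCLike.re_eq_complex_re, ← integral_re]
  · congr 1; ext x
    rw [mul_comm, RCLike.re_eq_complex_re, Complex.mul_conj, Complex.ofReal_re,
      Complex.normSq_eq_norm_sq]
  · have := (pairing (ContinuousLinearMap.mul ℂ ℂ)
      (postcompCLM (𝕜 := ℝ) (Complex.conjCLE : ℂ →L[ℝ] ℂ) f) f).integrable (μ := volume)
    refine this.congr (Filter.Eventually.of_forall fun x => ?_)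
    simp [pairing_apply_apply]

lemma L2_fourier (f : Sch) : L2 (𝓕 f) = L2 f := by
  simp only [L2, norm_fourier_toL2_eq]

lemma L2_sq_fourier (f : Sch) : L2 f ^ 2 = ∫ ξ, ‖𝓕 f ξ‖ ^ 2 := by
  rw [← L2_fourier, L2_sq_eq]

lemma integrable_norm_sq (f : Sch) : Integrable (fun x => ‖f x‖ ^ 2) := by
  have := (f.memLp 2 (volume : Measure ℝ)).integrable_norm_pow (p := 2) (by norm_num)
  simpa using this

lemma L2_mult_sq {m : ℝ → ℂ} (hm : m.HasTemperateGrowth) (f : Sch) :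
    L2 (mult m f) ^ 2 = ∫ ξ, ‖m ξ‖ ^ 2 * ‖𝓕 f ξ‖ ^ 2 := by
  rw [L2_sq_fourier]
  simp_rw [fourier_mult hm, norm_mul, mul_pow]

lemma integrable_mult {m : ℝ → ℂ} (hm : m.HasTemperateGrowth) (f : Sch) :
    Integrable (fun ξ => ‖m ξ‖ ^ 2 * ‖𝓕 f ξ‖ ^ 2) := by
  have := integrable_norm_sq (𝓕 (mult m f))
  simp_rw [fourier_mult hm, norm_mul, mul_pow] at this
  exact this

lemma sum_L2_mult_sq_le {ι κ : Type*} (s : Finset ι) (t : Finset κ) (c : ι → ℝ) (d : κ → ℝ)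
    (m : ι → ℝ → ℂ) (n : κ → ℝ → ℂ)
    (hm : ∀ i, (m i).HasTemperateGrowth) (hn : ∀ i, (n i).HasTemperateGrowth)
    (h : ∀ ξ, ∑ i ∈ s, c i * ‖m i ξ‖ ^ 2 ≤ ∑ j ∈ t, d j * ‖n j ξ‖ ^ 2) (f : Sch) :
    ∑ i ∈ s, c i * L2 (mult (m i) f) ^ 2 ≤ ∑ j ∈ t, d j * L2 (mult (n j) f) ^ 2 := by
  have h1 : ∀ i, c i * L2 (mult (m i) f) ^ 2 = ∫ ξ, c i * (‖m i ξ‖ ^ 2 * ‖𝓕 f ξ‖ ^ 2) := fun i => by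
    rw [L2_mult_sq (hm i), integral_const_mul]
  have h2 : ∀ i, d i * L2 (mult (n i) f) ^ 2 = ∫ ξ, d i * (‖n i ξ‖ ^ 2 * ‖𝓕 f ξ‖ ^ 2) := fun i => by
    rw [L2_mult_sq (hn i), integral_const_mul]
  simp_rw [h1, h2]
  rw [← integral_finsetSum _ (fun i _ => (integrable_mult (hm i) f).const_mul _),
    ← integral_finsetSum _ (fun i _ => (integrable_mult (hn i) f).const_mul _)]
  refine integral_mono (integrable_finsetSum _ fun i _ => (integrable_mult (hm i) f).const_mul _)
    (integrable_finsetSum _ fun i _ => (integrable_mult (hn i) f).const_mul _) fun ξ => ?_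
  simp only
  calc _ = (∑ i ∈ s, c i * ‖m i ξ‖ ^ 2) * ‖𝓕 f ξ‖ ^ 2 := by
        rw [Finset.sum_mul]; simp_rw [mul_assoc]
    _ ≤ (∑ j ∈ t, d j * ‖n j ξ‖ ^ 2) * ‖𝓕 f ξ‖ ^ 2 := by gcongr; exact h ξ
    _ = _ := by rw [Finset.sum_mul]; simp_rw [mul_assoc]

lemma sum_L2_mult_sq_le_single {ι : Type*} (s : Finset ι) (c : ι → ℝ) (d : ℝ)
    (m : ι → ℝ → ℂ) (n : ℝ → ℂ)
    (hm : ∀ i, (m i).HasTemperateGrowth) (hn : n.HasTemperateGrowth)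
    (h : ∀ ξ, ∑ i ∈ s, c i * ‖m i ξ‖ ^ 2 ≤ d * ‖n ξ‖ ^ 2) (f : Sch) :
    ∑ i ∈ s, c i * L2 (mult (m i) f) ^ 2 ≤ d * L2 (mult n f) ^ 2 := by
  simpa using sum_L2_mult_sq_le s ({()} : Finset Unit) c (fun _ => d) m (fun _ => n) hm
    (fun _ => hn) (by simpa using h) f

lemma L2_mult_le {m n : ℝ → ℂ} (hm : m.HasTemperateGrowth) (hn : n.HasTemperateGrowth)
    {C : ℝ} (hC : 0 ≤ C) (h : ∀ ξ, ‖m ξ‖ ≤ C * ‖n ξ‖) (f : Sch) :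
    L2 (mult m f) ≤ C * L2 (mult n f) := by
  refine (sq_le_sq₀ (L2_nonneg _) (mul_nonneg hC (L2_nonneg _))).1 ?_
  have := sum_L2_mult_sq_le_single ({()} : Finset Unit) (fun _ => 1) (C ^ 2) (fun _ => m) n
    (fun _ => hm) hn (fun ξ => by
      simp only [Finset.sum_singleton, one_mul, ← mul_pow]
      gcongr; exact h ξ) f
  simpa [mul_pow] using this

lemma L2_mult_le_L2 {m : ℝ → ℂ} (hm : m.HasTemperateGrowth)
    {C : ℝ} (hC : 0 ≤ C) (h : ∀ ξ, ‖m ξ‖ ≤ C) (f : Sch) :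
    L2 (mult m f) ≤ C * L2 f := by
  have := L2_mult_le hm (n := fun _ => 1) (by fun_prop) hC (by simpa using h) f
  rwa [mult_one] at this

lemma HasTemperateGrowth_conj {m : ℝ → ℂ} (hm : m.HasTemperateGrowth) :
    (fun ξ => (starRingEnd ℂ) (m ξ)).HasTemperateGrowth :=
  ((Complex.conjCLE : ℂ →L[ℝ] ℂ).hasTemperateGrowth).comp hm

lemma ip_mult_left {m : ℝ → ℂ} (hm : m.HasTemperateGrowth) (f g : Sch) :
    ip (mult m f) g = ip f (mult (fun ξ => (starRingEnd ℂ) (m ξ)) g) := by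
  rw [← ip_fourier, ← ip_fourier f, ip_eq_integral, ip_eq_integral]
  congr 2; ext ξ
  rw [fourier_mult hm, fourier_mult (HasTemperateGrowth_conj hm), map_mul]
  ring

lemma ip_mult_left_real {m : ℝ → ℝ} (hm : (fun ξ => (m ξ : ℂ)).HasTemperateGrowth) (f g : Sch) :
    ip (mult (fun ξ => (m ξ : ℂ)) f) g = ip f (mult (fun ξ => (m ξ : ℂ)) g) := by
  rw [ip_mult_left hm]; simp

/-- Pointwise multiplication of Schwartz functions. -/
def mulS (v : Sch) : Sch →L[ℂ] Sch := smulLeftCLM ℂ (v : ℝ → ℂ)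

lemma mulS_apply (v f : Sch) (x : ℝ) : mulS v f x = v x * f x := by
  rw [mulS, smulLeftCLM_apply_apply v.hasTemperateGrowth, smul_eq_mul]

lemma mulS_comm (v f : Sch) : mulS v f = mulS f v := by
  ext x; rw [mulS_apply, mulS_apply, mul_comm]

/-- A Schwartz function taking only real values. -/
def IsRealV (v : Sch) : Prop := ∀ x, (starRingEnd ℂ) (v x) = v x

lemma ip_mulS {v : Sch} (hv : IsRealV v) (f g : Sch) : ip (mulS v f) g = ip f (mulS v g) := by
  rw [ip_eq_integral, ip_eq_integral]
  congr 2; ext x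
  rw [mulS_apply, mulS_apply, map_mul, hv x]; ring

lemma L2_mulS_le {v : Sch} {U : ℝ} (hU : ∀ x, ‖v x‖ ≤ U) (f : Sch) :
    L2 (mulS v f) ≤ U * L2 f := by
  have h0 : 0 ≤ U := (norm_nonneg _).trans (hU 0)
  refine (sq_le_sq₀ (L2_nonneg _) (mul_nonneg h0 (L2_nonneg _))).1 ?_
  rw [mul_pow, L2_sq_eq, L2_sq_eq, ← integral_const_mul]
  refine integral_mono (integrable_norm_sq _) ((integrable_norm_sq _).const_mul _) fun x => ?_
  simp only [mulS_apply, norm_mul, mul_pow]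
  gcongr
  exact hU x

/-- The symbol of the derivative. -/
def dsym (ξ : ℝ) : ℂ := ((2 * π * ξ : ℝ) : ℂ) * Complex.I

lemma dsym_temperate : dsym.HasTemperateGrowth := by
  unfold dsym; fun_prop

/-- The derivative on Schwartz functions. -/
def D : Sch →L[ℂ] Sch := mult dsym

lemma D_apply (f : Sch) (x : ℝ) : D f x = deriv f x := by
  have h : derivCLM ℂ ℂ f = D f := by
    apply ext_fourier
    intro ξ
    rw [D, fourier_mult dsym_temperate]
    have h1 : (𝓕 (derivCLM ℂ ℂ f : Sch)) ξ = 𝓕 (deriv f) ξ := rfl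
    rw [h1, Real.fourier_deriv f.integrable f.differentiable (derivCLM ℂ ℂ f).integrable]
    simp only [dsym, smul_eq_mul, fourier_coe]; push_cast; ring
  rw [← h, derivCLM_apply]

lemma D_hasDerivAt (f : Sch) (x : ℝ) : HasDerivAt f (D f x) x := by
  rw [D_apply]; exact f.hasDerivAt x

lemma ip_D_left (f g : Sch) : ip (D f) g = -ip f (D g) := by
  rw [D, ip_mult_left dsym_temperate, ← ip_neg_right]
  congr 1
  apply ext_fourier; intro ξ
  rw [fourier_mult (HasTemperateGrowth_conj dsym_temperate), ← neg_one_smul ℂ, fourier_smul',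
    fourier_mult dsym_temperate]
  simp only [dsym, map_mul, Complex.conj_ofReal, Complex.conj_I]; ring

lemma D_mulS (v f : Sch) : D (mulS v f) = mulS (D v) f + mulS v (D f) := by
  ext x
  rw [D_apply]
  have h := (D_hasDerivAt v x).mul (D_hasDerivAt f x)
  have e : (mulS v f : ℝ → ℂ) = v * f := by
    ext y; simp [mulS_apply]
  rw [e, h.deriv, add_apply, mulS_apply, mulS_apply]

lemma D_mult {m : ℝ → ℂ} (hm : m.HasTemperateGrowth) (f : Sch) : D (mult m f) = mult m (D f) :=
  mult_comm dsym_temperate hm f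

lemma IsRealV.mulS {v w : Sch} (hv : IsRealV v) (hw : IsRealV w) : IsRealV (mulS v w) := by
  intro x; rw [mulS_apply, map_mul, hv, hw]

end LinKdV

namespace LinKdV

/-- The real symbol `(c² + (2 π ξ)²)^r`. -/
def jsym (c r ξ : ℝ) : ℝ := (c ^ 2 + (2 * π * ξ) ^ 2) ^ r

/-- The symbol `(c² + (2 π ξ)²)^r`, as a complex-valued function. -/
def js (c r : ℝ) (ξ : ℝ) : ℂ := (jsym c r ξ : ℂ)

lemma temperate_mul {m₁ m₂ : ℝ → ℂ} (h₁ : m₁.HasTemperateGrowth) (h₂ : m₂.HasTemperateGrowth) :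
    (fun ξ => m₁ ξ * m₂ ξ).HasTemperateGrowth := h₁.mul h₂

lemma jbase_pos {c : ℝ} (hc : 0 < c) (ξ : ℝ) : 0 < c ^ 2 + (2 * π * ξ) ^ 2 := by positivity

lemma jsym_pos {c : ℝ} (hc : 0 < c) (r ξ : ℝ) : 0 < jsym c r ξ :=
  rpow_pos_of_pos (jbase_pos hc ξ) r

lemma norm_js {c : ℝ} (hc : 0 < c) (r ξ : ℝ) : ‖js c r ξ‖ = jsym c r ξ := by
  rw [js, Complex.norm_real, Real.norm_of_nonneg (jsym_pos hc r ξ).le]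

lemma jsym_mul {c : ℝ} (hc : 0 < c) (r s ξ : ℝ) :
    jsym c r ξ * jsym c s ξ = jsym c (r + s) ξ := (rpow_add (jbase_pos hc ξ) r s).symm

lemma js_mul {c : ℝ} (hc : 0 < c) (r s ξ : ℝ) : js c r ξ * js c s ξ = js c (r + s) ξ := by
  simp only [js]; rw [← Complex.ofReal_mul, jsym_mul hc]

lemma jsym_zero (c ξ : ℝ) : jsym c 0 ξ = 1 := rpow_zero _

lemma jsym_one (c ξ : ℝ) : jsym c 1 ξ = c ^ 2 + (2 * π * ξ) ^ 2 := rpow_one _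

lemma jsym_neg_one (c ξ : ℝ) : jsym c (-1) ξ = (c ^ 2 + (2 * π * ξ) ^ 2)⁻¹ := rpow_neg_one _

lemma jsym_sq {c : ℝ} (hc : 0 < c) (r ξ : ℝ) : jsym c r ξ ^ 2 = jsym c (2 * r) ξ := by
  rw [sq, jsym_mul hc]; ring_nf

lemma jsym_half (c ξ : ℝ) : jsym c (1 / 2) ξ = √(c ^ 2 + (2 * π * ξ) ^ 2) :=
  (sqrt_eq_rpow _).symm

lemma jsym_neg_half {c : ℝ} (hc : 0 < c) (ξ : ℝ) :
    jsym c (-(1 / 2)) ξ = (√(c ^ 2 + (2 * π * ξ) ^ 2))⁻¹ := by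
  rw [← jsym_half, jsym, jsym, rpow_neg (jbase_pos hc ξ).le]

lemma jsym_temperate {c : ℝ} (hc : 0 < c) (r : ℝ) : (jsym c r).HasTemperateGrowth := by
  have e : jsym c r = fun ξ => c ^ (2 * r) * (fun x : ℝ => (1 + ‖x‖ ^ 2) ^ r) (2 * π / c * ξ) := by
    ext ξ
    simp only [Real.norm_eq_abs, sq_abs]
    rw [rpow_mul hc.le, rpow_two, ← mul_rpow (by positivity) (by positivity), jsym]
    congr 1
    field_simp
  rw [e]
  have h := (Function.hasTemperateGrowth_one_add_norm_sq_rpow ℝ r).comp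
    (f := fun ξ : ℝ => 2 * π / c * ξ) (by fun_prop)
  exact (Function.HasTemperateGrowth.const _).mul h

lemma js_temperate {c : ℝ} (hc : 0 < c) (r : ℝ) : (js c r).HasTemperateGrowth := by
  have := Function.Complex.hasTemperateGrowth_ofReal.comp (jsym_temperate hc r)
  exact this

/-- The `L²` norm weighted by `(c² + (2 π ξ)²)^r` on the Fourier side. -/
def nm (c r : ℝ) (f : Sch) : ℝ := L2 (mult (js c r) f)

lemma nm_nonneg (c r : ℝ) (f : Sch) : 0 ≤ nm c r f := L2_nonneg _

lemma nm_sq {c : ℝ} (hc : 0 < c) (r : ℝ) (f : Sch) :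
    nm c r f ^ 2 = ∫ ξ, jsym c (2 * r) ξ * ‖𝓕 f ξ‖ ^ 2 := by
  rw [nm, L2_mult_sq (js_temperate hc r)]
  simp_rw [norm_js hc, jsym_sq hc]

lemma nm_add_le (c r : ℝ) (f g : Sch) : nm c r (f + g) ≤ nm c r f + nm c r g := by
  simp only [nm, map_add]; exact L2_add_le _ _

lemma nm_sub_le (c r : ℝ) (f g : Sch) : nm c r (f - g) ≤ nm c r f + nm c r g := by
  simp only [nm, map_sub]; exact L2_sub_le _ _

lemma nm_zero {c : ℝ} (f : Sch) : nm c 0 f = L2 f := by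
  rw [nm]
  have : js c 0 = fun _ => 1 := by ext ξ; simp [js, jsym_zero]
  rw [this, mult_one]

lemma nm_mult_le {c d r s : ℝ} (hc : 0 < c) (hd : 0 < d) {m : ℝ → ℂ} (hm : m.HasTemperateGrowth)
    {C : ℝ} (hC : 0 ≤ C) (h : ∀ ξ, ‖m ξ‖ * jsym c r ξ ≤ C * jsym d s ξ) (f : Sch) :
    nm c r (mult m f) ≤ C * nm d s f := by
  rw [nm, mult_mult (js_temperate hc r) hm]
  refine L2_mult_le (temperate_mul (js_temperate hc r) hm) (js_temperate hd s) hC (fun ξ => ?_) f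
  rw [norm_mul, norm_js hc, norm_js hd, mul_comm]
  exact h ξ

lemma nm_le {c d r s : ℝ} (hc : 0 < c) (hd : 0 < d)
    {C : ℝ} (hC : 0 ≤ C) (h : ∀ ξ, jsym c r ξ ≤ C * jsym d s ξ) (f : Sch) :
    nm c r f ≤ C * nm d s f := by
  have := nm_mult_le hc hd (m := fun _ => 1) (by fun_prop) hC (by simpa using h) f
  rwa [mult_one] at this

lemma jsym_anti {b a r : ℝ} (hb : 0 < b) (hab : b ≤ a) (hr : r ≤ 0) (ξ : ℝ) :
    jsym a r ξ ≤ jsym b r ξ := by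
  apply rpow_le_rpow_of_nonpos (jbase_pos hb ξ) _ hr
  gcongr

lemma nm_anti {b a r : ℝ} (hb : 0 < b) (hab : b ≤ a) (hr : r ≤ 0) (f : Sch) :
    nm a r f ≤ nm b r f := by
  simpa using nm_le (hb.trans_le hab) hb zero_le_one
    (fun ξ => by simpa using jsym_anti hb hab hr ξ) f

/-- The Cauchy–Schwarz inequality for dual weights. -/
lemma abs_ip_le_nm {c : ℝ} (hc : 0 < c) (r : ℝ) (f g : Sch) :
    |ip f g| ≤ nm c r f * nm c (-r) g := by
  have h : ip (mult (js c r) f) (mult (js c (-r)) g) = ip f g := by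
    rw [show mult (js c r) f = mult (fun ξ => (jsym c r ξ : ℂ)) f from rfl,
      ip_mult_left_real (js_temperate hc r)]
    congr 1
    rw [show (fun ξ => (jsym c r ξ : ℂ)) = js c r from rfl,
      mult_mult (js_temperate hc r) (js_temperate hc (-r))]
    simp_rw [js_mul hc, add_neg_cancel]
    simp [js, jsym_zero, mult_one]
  rw [← h]; exact abs_ip_le _ _

/-- The symbol of `(a + ∂)⁻¹`. -/
def om (a ξ : ℝ) : ℂ := js a (-1) ξ * ((a : ℂ) - dsym ξ)

lemma om_temperate {a : ℝ} (ha : 0 < a) : (om a).HasTemperateGrowth :=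
  (js_temperate ha _).mul ((Function.HasTemperateGrowth.const _).sub dsym_temperate)

lemma norm_dsym (ξ : ℝ) : ‖dsym ξ‖ = |2 * π * ξ| := by
  simp [dsym]

lemma norm_sub_dsym (a ξ : ℝ) : ‖(a : ℂ) - dsym ξ‖ = √(a ^ 2 + (2 * π * ξ) ^ 2) := by
  rw [Complex.norm_def, Complex.normSq_apply]
  simp [dsym, sq]

lemma norm_om {a : ℝ} (ha : 0 < a) (ξ : ℝ) : ‖om a ξ‖ = jsym a (-(1 / 2)) ξ := by
  rw [om, norm_mul, norm_sub_dsym, norm_js ha, ← jsym_half, jsym_mul ha]; norm_num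

/-- The operator `(a + ∂)⁻¹`. -/
def Om (a : ℝ) : Sch →L[ℂ] Sch := mult (om a)

lemma om_mul {a : ℝ} (ha : 0 < a) (ξ : ℝ) : ((a : ℂ) + dsym ξ) * om a ξ = 1 := by
  have h : ((a : ℂ) + dsym ξ) * ((a : ℂ) - dsym ξ) = (jsym a 1 ξ : ℂ) := by
    rw [jsym_one]; simp only [dsym]; push_cast; ring_nf; rw [Complex.I_sq]; ring
  rw [om, mul_left_comm, h, js, ← Complex.ofReal_mul, jsym_mul ha]
  simp [jsym_zero]

lemma Om_spec {a : ℝ} (ha : 0 < a) (f : Sch) : D (Om a f) + (a : ℂ) • Om a f = f := by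
  apply ext_fourier; intro ξ
  rw [fourier_add', fourier_smul', D, Om, fourier_mult dsym_temperate, fourier_mult (om_temperate ha)]
  linear_combination (𝓕 f ξ) * om_mul ha ξ

lemma D_Om {a : ℝ} (ha : 0 < a) (f : Sch) : D (Om a f) = Om a (D f) := D_mult (om_temperate ha) f

lemma nm_Om_pos {a : ℝ} (ha : 0 < a) (f : Sch) :
    nm a (1 / 4) (Om a f) ≤ nm a (-(1 / 4)) f := by
  have := nm_mult_le ha ha (om_temperate ha) (r := 1 / 4) (s := -(1 / 4)) zero_le_one
    (fun ξ => by rw [norm_om ha, jsym_mul ha]; norm_num) f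
  rwa [one_mul] at this

lemma jsym_le_rpow {a r : ℝ} (ha : 0 < a) (hr : r ≤ 0) (ξ : ℝ) : jsym a r ξ ≤ a ^ (2 * r) := by
  rw [rpow_mul ha.le, rpow_two]
  apply rpow_le_rpow_of_nonpos (by positivity) _ hr
  nlinarith [sq_nonneg (2 * π * ξ)]

lemma L2_Om {a : ℝ} (ha : 0 < a) (f : Sch) :
    L2 (Om a f) ≤ (√a)⁻¹ * nm a (-(1 / 4)) f := by
  rw [← nm_zero (c := a)]
  refine nm_mult_le ha ha (om_temperate ha) (by positivity) (fun ξ => ?_) f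
  rw [norm_om ha, jsym_zero, mul_one, sqrt_eq_rpow, ← rpow_neg ha.le]
  calc jsym a (-(1 / 2)) ξ = jsym a (-(1/4)) ξ * jsym a (-(1 / 4)) ξ := by
        rw [jsym_mul ha]; norm_num
    _ ≤ a ^ (-(1 / 2) : ℝ) * _ := by
        gcongr
        · exact (jsym_pos ha _ _).le
        · have := jsym_le_rpow ha (r := -(1 / 4)) (by norm_num) ξ
          rwa [show (2 : ℝ) * -(1 / 4) = -(1 / 2) by norm_num] at this

lemma nm_Om_le {a b r : ℝ} (ha : 0 < a) (hb : 0 < b) (f : Sch) :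
    nm b r (Om a f) ≤ a⁻¹ * nm b r f := by
  refine nm_mult_le hb hb (om_temperate ha) (by positivity) (fun ξ => ?_) f
  gcongr
  · exact (jsym_pos hb _ _).le
  rw [norm_om ha, ← rpow_neg_one]
  have := jsym_le_rpow ha (r := -(1 / 2)) (by norm_num) ξ
  rwa [show (2 : ℝ) * -(1 / 2) = -1 by norm_num] at this

lemma abs_le_jsym_half (b ξ : ℝ) : |2 * π * ξ| ≤ jsym b (1 / 2) ξ := by
  rw [jsym_half]
  apply abs_le_sqrt
  nlinarith [sq_nonneg b]

lemma nm_Om_D {a b : ℝ} (hb : 0 < b) (hab : b ≤ a) (f : Sch) :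
    nm b (-(1 / 4)) (Om a (D f)) ≤ nm a (-(1 / 4)) f := by
  have ha := hb.trans_le hab
  rw [Om, D, mult_mult (om_temperate ha) dsym_temperate]
  have := nm_mult_le hb ha (temperate_mul (om_temperate ha) dsym_temperate) (r := -(1 / 4))
    (s := -(1 / 4)) zero_le_one (fun ξ => by
      rw [one_mul, norm_mul, norm_om ha, norm_dsym]
      have h1 : |2 * π * ξ| ≤ jsym b (1 / 4) ξ * jsym a (1 / 4) ξ := by
        calc |2 * π * ξ| ≤ jsym b (1 / 2) ξ := abs_le_jsym_half b ξ
          _ = jsym b (1 / 4) ξ * jsym b (1 / 4) ξ := by rw [jsym_mul hb]; norm_num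
          _ ≤ _ := by
            gcongr
            · exact (jsym_pos hb _ _).le
            · apply rpow_le_rpow (jbase_pos hb ξ).le _ (by norm_num)
              gcongr
      have h2 := jsym_pos ha (-(1 / 2)) ξ
      have h3 := jsym_pos hb (-(1 / 4)) ξ
      calc _ ≤ jsym a (-(1 / 2)) ξ * (jsym b (1 / 4) ξ * jsym a (1 / 4) ξ) * jsym b (-(1 / 4)) ξ := by
            gcongr
        _ = (jsym a (-(1 / 2)) ξ * jsym a (1 / 4) ξ) * (jsym b (1 / 4) ξ * jsym b (-(1 / 4)) ξ) := by
            ring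
        _ = jsym a (-(1 / 4)) ξ := by
            rw [jsym_mul ha, jsym_mul hb]; norm_num [jsym_zero]
        _ ≤ _ := le_rfl) f
  rwa [one_mul] at this

/-- The resolvent `(r² - ∂²)⁻¹`. -/
def Rs (r : ℝ) : Sch →L[ℂ] Sch := mult (js r (-1))

lemma Rs_spec {r : ℝ} (hr : 0 < r) (f : Sch) :
    ((r ^ 2 : ℝ) : ℂ) • Rs r f - D (D (Rs r f)) = f := by
  apply ext_fourier; intro ξ
  have h : (((r ^ 2 : ℝ) : ℂ) - dsym ξ * dsym ξ) * js r (-1) ξ = 1 := by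
    have h2 : (((r ^ 2 : ℝ) : ℂ) - dsym ξ * dsym ξ) = (jsym r 1 ξ : ℂ) := by
      rw [jsym_one]; simp only [dsym]; push_cast; ring_nf; rw [Complex.I_sq]; ring
    rw [h2, js, ← Complex.ofReal_mul, jsym_mul hr]; simp [jsym_zero]
  rw [sub_eq_add_neg, ← neg_one_smul ℂ, fourier_add', fourier_smul', fourier_smul', D, Rs,
    fourier_mult dsym_temperate, fourier_mult dsym_temperate, fourier_mult (js_temperate hr _)]
  linear_combination (𝓕 f ξ) * h

lemma D_Rs {r : ℝ} (hr : 0 < r) (f : Sch) : D (Rs r f) = Rs r (D f) := D_mult (js_temperate hr _) f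

lemma ip_Rs {r : ℝ} (hr : 0 < r) (f g : Sch) : ip (Rs r f) g = ip f (Rs r g) :=
  ip_mult_left_real (js_temperate hr (-1)) f g

lemma energy_eq {r : ℝ} (hr : 0 < r) (f : Sch) :
    r ^ 2 * L2 (Rs r f) ^ 2 + L2 (D (Rs r f)) ^ 2 = nm r (-(1 / 2)) f ^ 2 := by
  rw [D, Rs, mult_mult dsym_temperate (js_temperate hr _), nm, L2_mult_sq (js_temperate hr _),
    L2_mult_sq (js_temperate hr _), L2_mult_sq (temperate_mul dsym_temperate (js_temperate hr _)),
    ← integral_const_mul, ← integral_add ((integrable_mult (js_temperate hr _) f).const_mul _)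
      (integrable_mult (temperate_mul dsym_temperate (js_temperate hr _)) f)]
  congr 1; ext ξ
  simp only [norm_mul, norm_js hr, norm_dsym]
  have h : (r ^ 2 + (2 * π * ξ) ^ 2) * jsym r (-1) ξ ^ 2 = jsym r (-(1 / 2)) ξ ^ 2 := by
    rw [← jsym_one, jsym_sq hr, jsym_sq hr, jsym_mul hr]; norm_num
  rw [← h, mul_pow, sq_abs]; ring

lemma ip_Rs_self {r : ℝ} (hr : 0 < r) (f : Sch) : ip f (Rs r f) = nm r (-(1 / 2)) f ^ 2 := by
  rw [← energy_eq hr]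
  conv_lhs => rw [← Rs_spec hr f]
  have e : Rs r (((r ^ 2 : ℝ) : ℂ) • Rs r f - D (D (Rs r f))) = Rs r f := by rw [Rs_spec hr]
  rw [e, ip_sub_left, ip_smul_left, ip_self, ip_D_left, ip_self]; ring

/-- The dyadic scales. -/
def sc (b : ℝ) (k : ℕ) : ℝ := b * 2 ^ k

lemma sc_pos {b : ℝ} (hb : 0 < b) (k : ℕ) : 0 < sc b k := by unfold sc; positivity

lemma le_sc {b : ℝ} (hb : 0 < b) (k : ℕ) : b ≤ sc b k := by
  unfold sc; exact le_mul_of_one_le_right hb.le (one_le_pow₀ (by norm_num))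

lemma sum_sc_le {b s : ℝ} (hb : 0 < b) (hs : 0 ≤ s) (n : ℕ) :
    ∑ k ∈ Finset.range n, sc b k / (sc b k ^ 2 + s ^ 2) ≤
      7 / 2 * (1 / (b + s) - 1 / (sc b n + s)) := by
  induction n with
  | zero => simp [sc]
  | succ n ih =>
    rw [Finset.sum_range_succ]
    have hr := sc_pos hb n
    have e : sc b (n + 1) = 2 * sc b n := by unfold sc; ring
    have h : sc b n / (sc b n ^ 2 + s ^ 2) ≤
        7 / 2 * (1 / (sc b n + s) - 1 / (2 * sc b n + s)) := by
      generalize sc b n = r at *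
      rw [div_sub_div _ _ (by positivity) (by positivity), mul_div_assoc', div_le_div_iff₀ (by positivity) (by positivity)]
      have : (2 * r + s) * (r + s) ≤ 7 / 2 * (r ^ 2 + s ^ 2) := by
        nlinarith [sq_nonneg (r - s)]
      nlinarith [mul_le_mul_of_nonneg_left this hr.le]
    rw [e]; linarith

lemma sum_sc_le' {b : ℝ} (hb : 0 < b) (s : ℝ) (n : ℕ) :
    ∑ k ∈ Finset.range n, sc b k / (sc b k ^ 2 + s ^ 2) ≤ 7 / 2 * (1 / (b + |s|)) := by
  have := sum_sc_le hb (abs_nonneg s) n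
  simp only [sq_abs] at this
  have h2 : 0 < 1 / (sc b n + |s|) := by have := sc_pos hb n; positivity
  linarith

lemma sum_energy_le {b : ℝ} (hb : 0 < b) (n : ℕ) (f : Sch) :
    ∑ k ∈ Finset.range n, sc b k * nm (sc b k) (-(1 / 2)) f ^ 2 ≤
      7 / 2 * nm b (-(1 / 4)) f ^ 2 := by
  refine sum_L2_mult_sq_le_single _ _ _ _ _ (fun k => js_temperate (sc_pos hb k) _)
    (js_temperate hb _) (fun ξ => ?_) f
  simp_rw [fun k => norm_js (sc_pos hb k) (-(1 / 2)) ξ, fun k => jsym_sq (sc_pos hb k) (-(1 / 2)) ξ,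
    norm_js hb, jsym_sq hb]
  have e1 : (2 : ℝ) * -(1 / 2) = -1 := by norm_num
  have e2 : (2 : ℝ) * -(1 / 4) = -(1 / 2) := by norm_num
  simp_rw [e1, e2, jsym_neg_one, ← div_eq_mul_inv, jsym_neg_half hb]
  refine (sum_sc_le' hb _ n).trans ?_
  rw [one_div]
  gcongr
  rw [sqrt_le_left (by positivity)]
  have := abs_nonneg (2 * π * ξ)
  rw [← sq_abs (2 * π * ξ)]
  nlinarith

lemma exists_scale {b s : ℝ} {n : ℕ} (hbs : b ≤ s) (hs : s < sc b n) :
    ∃ k < n, sc b k ≤ s ∧ s < 2 * sc b k := by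
  induction n with
  | zero => simp [sc] at hs; linarith
  | succ n ih =>
    by_cases h : s < sc b n
    · obtain ⟨k, hk, h⟩ := ih h
      exact ⟨k, by omega, h⟩
    · refine ⟨n, by omega, not_lt.1 h, ?_⟩
      have e : sc b (n + 1) = 2 * sc b n := by unfold sc; ring
      linarith

lemma le_sum_sc {b s : ℝ} (hb : 0 < b) (hs : 0 ≤ s) (n : ℕ) :
    (√(b ^ 2 + s ^ 2))⁻¹ ≤ 5 * ∑ k ∈ Finset.range n, sc b k / (sc b k ^ 2 + s ^ 2) + (sc b n)⁻¹ := by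
  have hpos : ∀ k ∈ Finset.range n, 0 ≤ sc b k / (sc b k ^ 2 + s ^ 2) := fun k _ => by
    have := sc_pos hb k; positivity
  have hn := sc_pos hb n
  have hJ : 0 < √(b ^ 2 + s ^ 2) := by positivity
  have hJb : b ≤ √(b ^ 2 + s ^ 2) := le_sqrt_of_sq_le (by nlinarith)
  have hJs : s ≤ √(b ^ 2 + s ^ 2) := le_sqrt_of_sq_le (by nlinarith)
  by_cases h : sc b n ≤ max s b
  · have hle : sc b n ≤ √(b ^ 2 + s ^ 2) := h.trans (max_le hJs hJb)
    have := Finset.sum_nonneg hpos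
    have := inv_anti₀ hn hle
    linarith
  · push Not at h
    obtain ⟨k, hk, h1, h2⟩ := exists_scale (le_max_right s b) h
    have hr := sc_pos hb k
    have hsum := Finset.single_le_sum hpos (Finset.mem_range.2 hk)
    have hk2 : (√(b ^ 2 + s ^ 2))⁻¹ ≤ 5 * (sc b k / (sc b k ^ 2 + s ^ 2)) := by
      have hle : sc b k ≤ √(b ^ 2 + s ^ 2) := h1.trans (max_le hJs hJb)
      refine (inv_anti₀ hr hle).trans ?_
      rw [inv_eq_one_div, mul_div_assoc', div_le_div_iff₀ hr (by positivity)]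
      have : s < 2 * sc b k := (le_max_left s b).trans_lt h2
      nlinarith
    have : 0 < (sc b n)⁻¹ := by positivity
    linarith

lemma le_sum_energy {b : ℝ} (hb : 0 < b) (n : ℕ) (f : Sch) :
    nm b (-(1 / 4)) f ^ 2 ≤
      5 * ∑ k ∈ Finset.range n, sc b k * nm (sc b k) (-(1 / 2)) f ^ 2 + (sc b n)⁻¹ * L2 f ^ 2 := by
  have key := sum_L2_mult_sq_le ({()} : Finset Unit) (Finset.range (n + 1)) (fun _ => 1)
    (fun k => if k < n then 5 * sc b k else (sc b n)⁻¹) (fun _ => js b (-(1 / 4)))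
    (fun k => if k < n then js (sc b k) (-(1 / 2)) else fun _ => 1)
    (fun _ => js_temperate hb _)
    (fun k => by
      split_ifs
      · exact js_temperate (sc_pos hb k) _
      · fun_prop)
    (fun ξ => by
      rw [Finset.sum_range_succ, Finset.sum_congr rfl (g := fun k =>
        5 * (sc b k / (sc b k ^ 2 + (2 * π * ξ) ^ 2)))]
      · simp only [Finset.sum_singleton, one_mul, lt_irrefl, if_false, norm_one, one_pow, mul_one,
          norm_js hb, jsym_sq hb]
        have e2 : (2 : ℝ) * -(1 / 4) = -(1 / 2) := by norm_num
        rw [e2, jsym_neg_half hb, ← Finset.mul_sum]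
        have := le_sum_sc hb (abs_nonneg (2 * π * ξ)) n
        simpa only [sq_abs] using this
      · intro k hk
        rw [if_pos (Finset.mem_range.1 hk), if_pos (Finset.mem_range.1 hk),
          norm_js (sc_pos hb k), jsym_sq (sc_pos hb k)]
        have e1 : (2 : ℝ) * -(1 / 2) = -1 := by norm_num
        rw [e1, jsym_neg_one]; ring) f
  rw [Finset.sum_range_succ, Finset.sum_congr rfl (g := fun k =>
        5 * (sc b k * nm (sc b k) (-(1 / 2)) f ^ 2))] at key
  · simp only [Finset.sum_singleton, one_mul, lt_irrefl, if_false, ← Finset.mul_sum, mult_one] at key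
    exact key
  · intro k hk
    rw [if_pos (Finset.mem_range.1 hk), if_pos (Finset.mem_range.1 hk), nm]; ring

/-- The symbol of `∑ₖ rₖ ∂ (rₖ² - ∂²)⁻¹`. -/
def asym (b : ℝ) (n : ℕ) (ξ : ℝ) : ℂ :=
  ∑ k ∈ Finset.range n, (sc b k : ℂ) * (dsym ξ * js (sc b k) (-1) ξ)

lemma asym_temperate {b : ℝ} (hb : 0 < b) (n : ℕ) : (asym b n).HasTemperateGrowth := by
  have := Function.HasTemperateGrowth.sum (s := Finset.range n)
    (f := fun k ξ => (sc b k : ℂ) * (dsym ξ * js (sc b k) (-1) ξ))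
    (fun k _ => (Function.HasTemperateGrowth.const _).mul
      (dsym_temperate.mul (js_temperate (sc_pos hb k) _)))
  exact this

/-- The operator `∑ₖ rₖ ∂ (rₖ² - ∂²)⁻¹`. -/
def As (b : ℝ) (n : ℕ) : Sch →L[ℂ] Sch := mult (asym b n)

lemma As_eq {b : ℝ} (hb : 0 < b) (n : ℕ) (f : Sch) :
    As b n f = ∑ k ∈ Finset.range n, (sc b k : ℂ) • D (Rs (sc b k) f) := by
  apply ext_fourier; intro ξ
  rw [As, fourier_mult (asym_temperate hb n)]
  have e : ∀ (s : Finset ℕ) (F : ℕ → Sch), 𝓕 (∑ k ∈ s, F k) ξ = ∑ k ∈ s, 𝓕 (F k) ξ := by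
    intro s F
    induction s using Finset.induction_on with
    | empty => simp
    | insert a s ha ih => rw [Finset.sum_insert ha, Finset.sum_insert ha, fourier_add', ih]
  rw [e, asym, Finset.sum_mul]
  refine Finset.sum_congr rfl fun k _ => ?_
  rw [fourier_smul', D, Rs, fourier_mult dsym_temperate, fourier_mult (js_temperate (sc_pos hb k) _)]
  ring

lemma norm_asym_le {b : ℝ} (hb : 0 < b) (n : ℕ) (ξ : ℝ) : ‖asym b n ξ‖ ≤ 7 / 2 := by
  have h1 : ‖asym b n ξ‖ ≤ |2 * π * ξ| *
      ∑ k ∈ Finset.range n, sc b k / (sc b k ^ 2 + (2 * π * ξ) ^ 2) := by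
    refine (norm_sum_le _ _).trans ?_
    rw [Finset.mul_sum]
    refine Finset.sum_le_sum fun k _ => ?_
    rw [norm_mul, norm_mul, norm_dsym, norm_js (sc_pos hb k), jsym_neg_one, Complex.norm_real,
      Real.norm_of_nonneg (sc_pos hb k).le]
    apply le_of_eq; ring
  refine h1.trans ((mul_le_mul_of_nonneg_left (sum_sc_le' hb _ n) (abs_nonneg _)).trans ?_)
  have := abs_nonneg (2 * π * ξ)
  have h2 : |2 * π * ξ| * (1 / (b + |2 * π * ξ|)) ≤ 1 := by
    rw [mul_one_div, div_le_one (by positivity)]; linarith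
  linarith

lemma nm_As_le {a b : ℝ} (ha : 0 < a) (hb : 0 < b) (r : ℝ) (n : ℕ) (f : Sch) :
    nm a r (As b n f) ≤ 7 / 2 * nm a r f := by
  refine nm_mult_le ha ha (asym_temperate hb n) (by norm_num) (fun ξ => ?_) f
  gcongr
  · exact (jsym_pos ha _ _).le
  · exact norm_asym_le hb n ξ

lemma L2_As_le {b : ℝ} (hb : 0 < b) (n : ℕ) (f : Sch) : L2 (As b n f) ≤ 7 / 2 * L2 f :=
  L2_mult_le_L2 (asym_temperate hb n) (by norm_num) (norm_asym_le hb n) f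

end LinKdV

namespace LinKdV

/-- The localized trilinear form entering the modified energy. -/
def Bk (r : ℝ) (u f g : Sch) : ℝ :=
  1 / 2 * (r ^ 2 * ip (mulS u (Rs r f)) (Rs r g) - ip (mulS u (D (Rs r f))) (D (Rs r g)))

lemma ip_mulS_D (v f g : Sch) :
    ip (mulS (D v) f) g = -ip (mulS v (D f)) g - ip (mulS v f) (D g) := by
  have h := D_mulS v f
  rw [← sub_eq_iff_eq_add] at h
  rw [← h, ip_sub_left, ip_D_left]; ring

lemma ip_mulS_comm {v : Sch} (hv : IsRealV v) (f g : Sch) :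
    ip (mulS v f) g = ip (mulS v g) f := by
  rw [ip_mulS hv, ip_comm]

lemma mulS_add_left (v w f : Sch) : mulS (v + w) f = mulS v f + mulS w f := by
  ext x; simp [mulS_apply, add_mul]

lemma mulS_smul_left (c : ℂ) (v f : Sch) : mulS (c • v) f = c • mulS v f := by
  ext x; simp [mulS_apply, mul_assoc]

lemma mulS_neg_left (v f : Sch) : mulS (-v) f = -mulS v f := by
  ext x; simp [mulS_apply]

lemma mulS_sub_left (v w f : Sch) : mulS (v - w) f = mulS v f - mulS w f := by
  ext x; simp [mulS_apply, sub_mul]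

lemma Bk_add_left (r : ℝ) (u f g h : Sch) : Bk r u (f + g) h = Bk r u f h + Bk r u g h := by
  simp only [Bk, map_add, ip_add_left]; ring

lemma Bk_add_right (r : ℝ) (u f g h : Sch) : Bk r u f (g + h) = Bk r u f g + Bk r u f h := by
  simp only [Bk, map_add, ip_add_right]; ring

lemma Bk_neg_right (r : ℝ) (u f g : Sch) : Bk r u f (-g) = -Bk r u f g := by
  simp only [Bk, map_neg, ip_neg_right]; ring

lemma Bk_smul_right (r : ℝ) (u f : Sch) (c : ℝ) (g : Sch) :
    Bk r u f ((c : ℂ) • g) = c * Bk r u f g := by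
  simp only [Bk, map_smul, ip_smul_right]; ring

lemma Bk_add_pot (r : ℝ) (u v f g : Sch) : Bk r (u + v) f g = Bk r u f g + Bk r v f g := by
  simp only [Bk, mulS_add_left, ip_add_left]; ring

lemma Bk_comm {u : Sch} (hu : IsRealV u) (r : ℝ) (f g : Sch) : Bk r u f g = Bk r u g f := by
  simp only [Bk]; rw [ip_mulS_comm hu, ip_mulS_comm hu (D _)]

/-- The algebraic cancellation behind the modified energy, for a single resolvent. -/
lemma energy_identity {r a : ℝ} (hr : 0 < r) (ha : 0 < a) {u : Sch} (hu : IsRealV u) (z : Sch) :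
    2 * ip (-D (D (D z)) + (6 : ℝ) • D (mulS u z)) (Rs r z)
      + 4 * (Bk r (-D (D (D u)) + (6 : ℝ) • mulS u (D u)) (Om a z) (Om a z)
        + 2 * Bk r u (Om a z) (Om a (-D (D (D z)) + (6 : ℝ) • D (mulS u z)))) =
    -12 * a * (ip (mulS u (Om a z)) (D (Rs r z)) + ip (mulS u z) (D (Rs r (Om a z))))
      + 12 * a ^ 2 * ip (mulS u (Om a z)) (D (Rs r (Om a z)))
      - 12 * ip (mulS (mulS u u) (Om a z)) (D (Rs r (Om a z)))
      + 48 * Bk r u (Om a z) (Om a (D (mulS u z))) := by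
  have e6 : ∀ f : Sch, (6 : ℝ) • f = ((6 : ℝ) : ℂ) • f := fun f => by ext x; simp
  simp only [e6]
  set w := Om a z with hw
  have hz : z = D w + (a : ℂ) • w := (Om_spec ha z).symm
  have hD : Om a (D (D (D z))) = D (D (D w)) := by rw [hw, D_Om ha, D_Om ha, D_Om ha]
  rw [map_add, map_neg, map_smul, hD, Bk_add_right, Bk_neg_right, Bk_smul_right]
  set N := Om a (D (mulS u z))
  have hz3 : ip (D (D (D z))) (Rs r z) = 0 := by
    have h1 : ip (D (D (D z))) (Rs r z) = -ip z (Rs r (D (D (D z)))) := by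
      rw [ip_D_left, ip_D_left, ip_D_left, D_Rs hr, D_Rs hr, D_Rs hr]; ring
    have h2 : ip z (Rs r (D (D (D z)))) = ip (D (D (D z))) (Rs r z) := by
      rw [← ip_Rs hr, ip_comm]
    linarith
  rw [ip_add_left, ip_neg_left, hz3, ip_smul_left, ip_D_left]
  set v2 := mulS u u with hv2
  have hv2r : IsRealV v2 := hu.mulS hu
  have hv2D : D v2 = ((2 : ℝ) : ℂ) • mulS u (D u) := by
    rw [hv2, D_mulS, mulS_comm (D u)]; ext x; simp; ring
  have hq : ∀ f g, ip (mulS (mulS u (D u)) f) g =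
      -(1 / 2) * (ip (mulS v2 (D f)) g + ip (mulS v2 f) (D g)) := fun f g => by
    have := ip_mulS_D v2 f g
    rw [hv2D, mulS_smul_left, ip_smul_left] at this
    linarith
  have hW : w = ((r ^ 2 : ℝ) : ℂ) • Rs r w - D (D (Rs r w)) := (Rs_spec hr w).symm
  have hRz : Rs r z = D (Rs r w) + (a : ℂ) • Rs r w := by
    rw [hz, map_add, map_smul, D_Rs hr]
  have hBkN := Bk r u w N
  have hRD : Rs r (D (D (D w))) = D (D (D (Rs r w))) := by rw [D_Rs hr, D_Rs hr, D_Rs hr]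
  rw [hRz]
  simp only [Bk, hRD]
  generalize hWd : Rs r w = W at *
  clear_value w v2 N
  subst hz
  subst hW
  simp only [map_add, map_sub, map_smul, mulS_add_left, mulS_neg_left, mulS_smul_left,
    ip_add_left, ip_sub_left, ip_smul_left, ip_add_right, ip_smul_right, ip_neg_left, hq, ip_mulS_D]
  have c1 := ip_mulS_comm hu
  have c2 := ip_mulS_comm hv2r
  have k3 := c1 (D (D W)) (D W)
  have k4 := c1 (D (D (D W))) W
  have k5 := c1 (D (D (D W))) (D W)
  have k6 := c1 (D (D (D W))) (D (D W))
  have k7 := c1 (D (D (D (D W)))) (D W)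
  have l1 := c2 (D W) W
  have l2 := c2 (D (D W)) (D W)
  simp only [k3, k4, k5, k6, k7, l1, l2]
  ring

/-- The truncated energy form. -/
def Eb (b : ℝ) (n : ℕ) (f g : Sch) : ℝ :=
  ∑ k ∈ Finset.range n, sc b k * ip f (Rs (sc b k) g)

/-- The truncated correction form. -/
def Bb (b : ℝ) (n : ℕ) (u f g : Sch) : ℝ :=
  ∑ k ∈ Finset.range n, sc b k * Bk (sc b k) u f g

lemma ip_As {b : ℝ} (hb : 0 < b) (n : ℕ) (f g : Sch) :
    ip f (As b n g) = ∑ k ∈ Finset.range n, sc b k * ip f (D (Rs (sc b k) g)) := by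
  rw [As_eq hb, ip_sum_right]; simp_rw [ip_smul_right]

/-- The time derivative of the modified energy. -/
lemma modified_energy_identity {a b : ℝ} (ha : 0 < a) (hb : 0 < b) (n : ℕ) {u : Sch}
    (hu : IsRealV u) (z : Sch) :
    2 * Eb b n (-D (D (D z)) + (6 : ℝ) • D (mulS u z)) z
      + 4 * Bb b n (-D (D (D u)) + (6 : ℝ) • mulS u (D u)) (Om a z) (Om a z)
      + 8 * Bb b n u (Om a z) (Om a (-D (D (D z)) + (6 : ℝ) • D (mulS u z))) =
    -12 * a * (ip (mulS u (Om a z)) (As b n z) + ip (mulS u z) (As b n (Om a z)))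
      + 12 * a ^ 2 * ip (mulS u (Om a z)) (As b n (Om a z))
      - 12 * ip (mulS (mulS u u) (Om a z)) (As b n (Om a z))
      + 48 * Bb b n u (Om a z) (Om a (D (mulS u z))) := by
  simp only [Eb, Bb, ip_As hb, Finset.mul_sum, ← Finset.sum_add_distrib, ← Finset.sum_sub_distrib]
  refine Finset.sum_congr rfl fun k _ => ?_
  linear_combination sc b k * energy_identity (sc_pos hb k) ha hu z

lemma abs_Bk_le {r U : ℝ} (hr : 0 < r) {u : Sch} (hU : ∀ x, ‖u x‖ ≤ U) (f g : Sch) :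
    |Bk r u f g| ≤ 1 / 2 * U * (nm r (-(1 / 2)) f * nm r (-(1 / 2)) g) := by
  have h0 : 0 ≤ U := (norm_nonneg _).trans (hU 0)
  have h1 := (abs_ip_le (mulS u (Rs r f)) (Rs r g)).trans
    (mul_le_mul_of_nonneg_right (L2_mulS_le hU _) (L2_nonneg _))
  have h2 := (abs_ip_le (mulS u (D (Rs r f))) (D (Rs r g))).trans
    (mul_le_mul_of_nonneg_right (L2_mulS_le hU _) (L2_nonneg _))
  have hf := energy_eq hr f
  have hg := energy_eq hr g
  have cs : r ^ 2 * (L2 (Rs r f) * L2 (Rs r g)) + L2 (D (Rs r f)) * L2 (D (Rs r g)) ≤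
      nm r (-(1 / 2)) f * nm r (-(1 / 2)) g := by
    apply le_of_sq_le_sq _ (mul_nonneg (nm_nonneg _ _ _) (nm_nonneg _ _ _))
    rw [mul_pow, ← hf, ← hg]
    nlinarith [sq_nonneg (r * (L2 (Rs r f) * L2 (D (Rs r g)) - L2 (D (Rs r f)) * L2 (Rs r g)))]
  have h3 : |r ^ 2 * ip (mulS u (Rs r f)) (Rs r g) - ip (mulS u (D (Rs r f))) (D (Rs r g))| ≤
      r ^ 2 * (U * L2 (Rs r f) * L2 (Rs r g)) + U * L2 (D (Rs r f)) * L2 (D (Rs r g)) := by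
    refine (abs_sub _ _).trans (add_le_add ?_ h2)
    rw [abs_mul, abs_of_nonneg (sq_nonneg r)]
    gcongr
  rw [Bk, abs_mul, abs_of_pos (by norm_num : (0 : ℝ) < 1 / 2), mul_assoc]
  gcongr
  calc _ ≤ _ := h3
    _ = U * (r ^ 2 * (L2 (Rs r f) * L2 (Rs r g)) + L2 (D (Rs r f)) * L2 (D (Rs r g))) := by ring
    _ ≤ _ := by gcongr

lemma abs_Bb_le {b U : ℝ} (hb : 0 < b) (n : ℕ) {u : Sch} (hU : ∀ x, ‖u x‖ ≤ U) (f g : Sch) :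
    |Bb b n u f g| ≤ 7 / 4 * U * (nm b (-(1 / 4)) f * nm b (-(1 / 4)) g) := by
  have h0 : 0 ≤ U := (norm_nonneg _).trans (hU 0)
  have h1 : |Bb b n u f g| ≤ 1 / 2 * U * ∑ k ∈ Finset.range n,
      (√(sc b k) * nm (sc b k) (-(1 / 2)) f) * (√(sc b k) * nm (sc b k) (-(1 / 2)) g) := by
    rw [Bb, Finset.mul_sum]
    refine (Finset.abs_sum_le_sum_abs _ _).trans (Finset.sum_le_sum fun k _ => ?_)
    have hk := sc_pos hb k
    rw [abs_mul, abs_of_pos hk]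
    have hm := mul_le_mul_of_nonneg_left (abs_Bk_le hk hU f g) hk.le
    have hs : √(sc b k) * √(sc b k) = sc b k := mul_self_sqrt hk.le
    linear_combination hm - 1 / 2 * U * (nm (sc b k) (-(1 / 2)) f * nm (sc b k) (-(1 / 2)) g) * hs
  refine h1.trans ?_
  have cs := Finset.sum_mul_sq_le_sq_mul_sq (Finset.range n)
    (fun k => √(sc b k) * nm (sc b k) (-(1 / 2)) f) (fun k => √(sc b k) * nm (sc b k) (-(1 / 2)) g)
  have e : ∀ h : Sch, ∑ k ∈ Finset.range n, (√(sc b k) * nm (sc b k) (-(1 / 2)) h) ^ 2 ≤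
      7 / 2 * nm b (-(1 / 4)) h ^ 2 := fun h => by
    simp_rw [mul_pow, fun k => sq_sqrt (sc_pos hb k).le]
    exact sum_energy_le hb n h
  have h2 : ∑ k ∈ Finset.range n,
      (√(sc b k) * nm (sc b k) (-(1 / 2)) f) * (√(sc b k) * nm (sc b k) (-(1 / 2)) g) ≤
      7 / 2 * (nm b (-(1 / 4)) f * nm b (-(1 / 4)) g) := by
    apply le_of_sq_le_sq _ (mul_nonneg (by norm_num) (mul_nonneg (nm_nonneg _ _ _) (nm_nonneg _ _ _)))
    refine cs.trans ((mul_le_mul (e f) (e g) (Finset.sum_nonneg fun k _ => sq_nonneg _)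
      (by positivity)).trans (le_of_eq (by ring)))
  linear_combination 1 / 2 * U * h2

/-- Bound for the derivative of the modified energy. -/
lemma abs_modified_energy_deriv_le {a b U K : ℝ} (hb : 0 < b) (hab : b ≤ a) (n : ℕ) {u : Sch}
    (hu : IsRealV u) (hU : ∀ x, ‖u x‖ ≤ U) (hK0 : 0 ≤ K)
    (hK : ∀ f, nm a (1 / 4) (mulS u f) ≤ K * nm a (1 / 4) f)
    (hK' : ∀ f, nm a (-(1 / 4)) (mulS u f) ≤ K * nm a (-(1 / 4)) f) (z : Sch) :
    |2 * Eb b n (-D (D (D z)) + (6 : ℝ) • D (mulS u z)) z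
      + 4 * Bb b n (-D (D (D u)) + (6 : ℝ) • mulS u (D u)) (Om a z) (Om a z)
      + 8 * Bb b n u (Om a z) (Om a (-D (D (D z)) + (6 : ℝ) • D (mulS u z)))| ≤
    (84 * a * K + 42 * a * U + 42 * U ^ 2 / a + 84 * U * K / a) * nm b (-(1 / 4)) z ^ 2 := by
  have ha := hb.trans_le hab
  have hU0 : 0 ≤ U := (norm_nonneg _).trans (hU 0)
  rw [modified_energy_identity ha hb n hu]
  set P := nm b (-(1 / 4)) z with hP
  have hP0 : 0 ≤ P := nm_nonneg _ _ _
  have hPa : nm a (-(1 / 4)) z ≤ P := nm_anti hb hab (by norm_num) z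
  have h4 : nm a (1 / 4) (Om a z) ≤ P := (nm_Om_pos ha z).trans hPa
  have hL : L2 (Om a z) ≤ (√a)⁻¹ * P :=
    (L2_Om ha z).trans (mul_le_mul_of_nonneg_left hPa (by positivity))
  have hn : ∀ c r f, 0 ≤ nm c r f := nm_nonneg
  have t1 : |ip (mulS u (Om a z)) (As b n z)| ≤ 7 / 2 * K * P ^ 2 := by
    refine (abs_ip_le_nm ha (1 / 4) _ _).trans ?_
    calc _ ≤ (K * P) * (7 / 2 * P) := by
          gcongr
          · exact hn _ _ _
          · exact (hK _).trans (by gcongr)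
          · exact (nm_As_le ha hb _ n z).trans (by gcongr)
      _ = _ := by ring
  have t2 : |ip (mulS u z) (As b n (Om a z))| ≤ 7 / 2 * K * P ^ 2 := by
    rw [ip_comm]
    refine (abs_ip_le_nm ha (1 / 4) _ _).trans ?_
    calc _ ≤ (7 / 2 * P) * (K * P) := by
          gcongr
          · exact hn _ _ _
          · exact (nm_As_le ha hb _ n _).trans (by gcongr)
          · exact (hK' _).trans (by gcongr)
      _ = _ := by ring
  have hs : (√a)⁻¹ * (√a)⁻¹ = a⁻¹ := by rw [← mul_inv, mul_self_sqrt ha.le]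
  have t34 : ∀ (v : Sch) (V : ℝ), (∀ x, ‖v x‖ ≤ V) →
      |ip (mulS v (Om a z)) (As b n (Om a z))| ≤ 7 / 2 * V * a⁻¹ * P ^ 2 := fun v V hV => by
    have hV0 : 0 ≤ V := (norm_nonneg _).trans (hV 0)
    refine (abs_ip_le _ _).trans ?_
    calc _ ≤ (V * ((√a)⁻¹ * P)) * (7 / 2 * ((√a)⁻¹ * P)) := by
          gcongr
          · exact L2_nonneg _
          · exact (L2_mulS_le hV _).trans (by gcongr)
          · exact (L2_As_le hb n _).trans (by gcongr)
      _ = 7 / 2 * V * ((√a)⁻¹ * (√a)⁻¹) * P ^ 2 := by ring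
      _ = _ := by rw [hs]
  have t3 := t34 u U hU
  have t4 := t34 (mulS u u) (U ^ 2) (fun x => by
    rw [mulS_apply, norm_mul, sq]
    exact mul_le_mul (hU x) (hU x) (norm_nonneg _) hU0)
  have t5 : |Bb b n u (Om a z) (Om a (D (mulS u z)))| ≤ 7 / 4 * U * (a⁻¹ * P * (K * P)) := by
    refine (abs_Bb_le hb n hU _ _).trans ?_
    gcongr
    · exact hn _ _ _
    · exact nm_Om_le ha hb z
    · exact (nm_Om_D hb hab _).trans ((hK' _).trans (by gcongr))
  have e : (84 * a * K + 42 * a * U + 42 * U ^ 2 / a + 84 * U * K / a) * P ^ 2 =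
      12 * a * (7 / 2 * K * P ^ 2 + 7 / 2 * K * P ^ 2) + 12 * a ^ 2 * (7 / 2 * U * a⁻¹ * P ^ 2) +
      12 * (7 / 2 * U ^ 2 * a⁻¹ * P ^ 2) + 48 * (7 / 4 * U * (a⁻¹ * P * (K * P))) := by
    field_simp; ring
  rw [e]
  have s1 : |-12 * a * (ip (mulS u (Om a z)) (As b n z) + ip (mulS u z) (As b n (Om a z)))| ≤
      12 * a * (7 / 2 * K * P ^ 2 + 7 / 2 * K * P ^ 2) := by
    rw [abs_mul, abs_mul, abs_neg, abs_of_pos ha, abs_of_pos (by norm_num : (0 : ℝ) < 12)]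
    exact mul_le_mul_of_nonneg_left ((abs_add_le _ _).trans (add_le_add t1 t2)) (by positivity)
  have s2 : |12 * a ^ 2 * ip (mulS u (Om a z)) (As b n (Om a z))| ≤
      12 * a ^ 2 * (7 / 2 * U * a⁻¹ * P ^ 2) := by
    rw [abs_mul, abs_of_nonneg (by positivity : 0 ≤ 12 * a ^ 2)]
    exact mul_le_mul_of_nonneg_left t3 (by positivity)
  have s3 : |12 * ip (mulS (mulS u u) (Om a z)) (As b n (Om a z))| ≤
      12 * (7 / 2 * U ^ 2 * a⁻¹ * P ^ 2) := by
    rw [abs_mul, abs_of_pos (by norm_num : (0 : ℝ) < 12)]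
    exact mul_le_mul_of_nonneg_left t4 (by norm_num)
  have s4 : |48 * Bb b n u (Om a z) (Om a (D (mulS u z)))| ≤
      48 * (7 / 4 * U * (a⁻¹ * P * (K * P))) := by
    rw [abs_mul, abs_of_pos (by norm_num : (0 : ℝ) < 48)]
    exact mul_le_mul_of_nonneg_left t5 (by norm_num)
  refine (abs_add_le _ _).trans (add_le_add ((abs_sub _ _).trans (add_le_add
    ((abs_add_le _ _).trans (add_le_add s1 s2)) s3)) s4)

/-- Boundedness on a space of positive order implies boundedness on the dual space. -/
lemma nm_mulS_neg_le {a r K : ℝ} (ha : 0 < a) (hK0 : 0 ≤ K) {u : Sch} (hu : IsRealV u)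
    (hK : ∀ f, nm a r (mulS u f) ≤ K * nm a r f) (f : Sch) :
    nm a (-r) (mulS u f) ≤ K * nm a (-r) f := by
  set y := mulS u f
  set g := mult (js a (-r)) y with hg
  have h1 : nm a (-r) y ^ 2 = ip f (mulS u (mult (js a (-r)) g)) := by
    rw [nm, ← hg, ← ip_self, ← ip_mulS hu]
    exact ip_mult_left_real (js_temperate ha (-r)) y g
  have h2 : nm a r (mult (js a (-r)) g) = nm a (-r) y := by
    rw [nm, mult_mult (js_temperate ha _) (js_temperate ha _), nm, ← hg]
    simp_rw [js_mul ha, add_neg_cancel]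
    simp [js, jsym_zero, mult_one]
  have h3 := abs_ip_le_nm ha (-r) f (mulS u (mult (js a (-r)) g))
  rw [neg_neg] at h3
  have h4 := hK (mult (js a (-r)) g)
  rw [h2] at h4
  have h5 : nm a (-r) y ^ 2 ≤ nm a (-r) f * (K * nm a (-r) y) := by
    rw [h1]
    exact (le_abs_self _).trans (h3.trans (mul_le_mul_of_nonneg_left h4 (nm_nonneg _ _ _)))
  by_cases h : nm a (-r) y = 0
  · rw [h]; exact mul_nonneg hK0 (nm_nonneg _ _ _)
  · have hpos : 0 < nm a (-r) y := lt_of_le_of_ne (nm_nonneg _ _ _) (Ne.symm h)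
    nlinarith

end LinKdV

namespace LinKdV

/-- The kernel of the difference-quotient seminorm. -/
def gk (h : ℝ) : ℝ := 4 * sin (π * h) ^ 2 / h ^ 2

lemma gk_nonneg (h : ℝ) : 0 ≤ gk h := by unfold gk; positivity

lemma gk_le (h : ℝ) : gk h ≤ (4 * π ^ 2 + 4) * (1 + h ^ 2)⁻¹ := by
  rcases eq_or_ne h 0 with rfl | hh
  · simp [gk]; positivity
  have h2 : 0 < h ^ 2 := by positivity
  rw [gk, ← div_eq_mul_inv, div_le_div_iff₀ h2 (by positivity)]
  have h3 : sin (π * h) ^ 2 ≤ (π * h) ^ 2 := sq_le_sq.2 abs_sin_le_abs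
  have h4 := sin_sq_le_one (π * h)
  nlinarith

lemma measurable_gk : Measurable gk := by unfold gk; fun_prop

lemma integrable_gk : Integrable gk := by
  refine Integrable.mono' (integrable_inv_one_add_sq.const_mul (4 * π ^ 2 + 4))
    measurable_gk.aestronglyMeasurable (ae_of_all _ fun h => ?_)
  rw [Real.norm_of_nonneg (gk_nonneg h)]
  exact gk_le h

lemma integral_gk_pos : 0 < ∫ h, gk h := by
  rw [integral_pos_iff_support_of_nonneg gk_nonneg integrable_gk]
  refine lt_of_lt_of_le (by simp : 0 < volume (Ioo (0 : ℝ) 1)) (measure_mono fun h hh => ?_)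
  have h1 : 0 < sin (π * h) := sin_pos_of_pos_of_lt_pi (by have := hh.1; positivity)
    (by nlinarith [pi_pos, hh.2])
  have h2 := hh.1
  have : 0 < gk h := by unfold gk; positivity
  exact this.ne'

lemma lintegral_gk (ξ : ℝ) :
    ∫⁻ h, ENNReal.ofReal (4 * sin (π * (h * ξ)) ^ 2 / h ^ 2) = ENNReal.ofReal ((∫ h, gk h) * |ξ|) := by
  rcases eq_or_ne ξ 0 with rfl | hξ
  · simp
  have e : ∀ h, 4 * sin (π * (h * ξ)) ^ 2 / h ^ 2 = ξ ^ 2 * gk (ξ * h) := fun h => by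
    rw [gk, mul_comm h ξ]
    rcases eq_or_ne h 0 with rfl | hh
    · simp
    field_simp
  simp_rw [e]
  rw [← ofReal_integral_eq_lintegral_ofReal, integral_const_mul, Measure.integral_comp_mul_left]
  · congr 1
    rw [smul_eq_mul, abs_inv, ← sq_abs]
    have := abs_pos.2 hξ
    field_simp
  · exact (integrable_gk.comp_mul_left' hξ).const_mul _
  · exact ae_of_all _ fun h => mul_nonneg (sq_nonneg _) (gk_nonneg _)

/-- The translate `x ↦ g (x + h)`. -/
def tr (h : ℝ) (g : Sch) : Sch := g.compSubConstCLM ℂ (-h)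

lemma tr_apply (h : ℝ) (g : Sch) (x : ℝ) : tr h g x = g (x + h) := by
  rw [tr, compSubConstCLM_apply, sub_neg_eq_add]

lemma fourier_tr (h : ℝ) (g : Sch) (ξ : ℝ) : 𝓕 (tr h g) ξ = 𝐞 (h * ξ) * 𝓕 g ξ := by
  have h1 := congrFun (VectorFourier.fourierIntegral_comp_add_right 𝐞 volume (innerₗ ℝ) (g : ℝ → ℂ) h) ξ
  have e : (g : ℝ → ℂ) ∘ (fun v => v + h) = tr h g := by ext x; simp [tr_apply]
  rw [e] at h1
  rw [fourier_coe, fourier_coe]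
  have e2 : (innerₗ ℝ) h ξ = h * ξ := by simp [mul_comm]
  rw [e2] at h1
  exact h1

lemma norm_fourierChar_sub_one_sq (y : ℝ) : ‖(𝐞 y : ℂ) - 1‖ ^ 2 = 4 * sin (π * y) ^ 2 := by
  rw [Real.fourierChar_apply, ← Complex.normSq_eq_norm_sq, Complex.normSq_apply]
  simp only [Complex.sub_re, Complex.sub_im, Complex.one_re, Complex.one_im,
    Complex.exp_ofReal_mul_I_re, Complex.exp_ofReal_mul_I_im]
  rw [show 2 * π * y = 2 * (π * y) by ring, cos_two_mul, sin_two_mul, cos_sq']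
  have := sin_sq_add_cos_sq (π * y)
  have h2 : cos (π * y) ^ 2 = 1 - sin (π * y) ^ 2 := by linarith
  ring_nf
  rw [h2]; ring

lemma L2_tr_sub_sq (h : ℝ) (g : Sch) :
    ∫ x, ‖g (x + h) - g x‖ ^ 2 = ∫ ξ, 4 * sin (π * (h * ξ)) ^ 2 * ‖𝓕 g ξ‖ ^ 2 := by
  have h1 := L2_sq_eq (tr h g - g)
  rw [L2_sq_fourier] at h1
  simp only [sub_apply, tr_apply] at h1
  rw [← h1]
  congr 1; ext ξ
  rw [sub_eq_add_neg, ← neg_one_smul ℂ, fourier_add', fourier_smul', fourier_tr,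
    ← norm_fourierChar_sub_one_sq, ← mul_pow, ← norm_mul]
  ring_nf

/-- The difference-quotient seminorm of order one half. -/
lemma lintegral_diff_quotient (g : Sch) :
    ∫⁻ h, ∫⁻ x, ENNReal.ofReal (‖g (x + h) - g x‖ ^ 2 / h ^ 2) =
      ∫⁻ ξ, ENNReal.ofReal ((∫ h, gk h) * |ξ| * ‖𝓕 g ξ‖ ^ 2) := by
  have h1 : ∀ h : ℝ, ∫⁻ x, ENNReal.ofReal (‖g (x + h) - g x‖ ^ 2 / h ^ 2) =
      ∫⁻ ξ, ENNReal.ofReal (4 * sin (π * (h * ξ)) ^ 2 / h ^ 2) * ENNReal.ofReal (‖𝓕 g ξ‖ ^ 2) := by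
    intro h
    have i1 : Integrable (fun x => ‖g (x + h) - g x‖ ^ 2 / h ^ 2) := by
      have := (integrable_norm_sq (tr h g - g)).div_const (h ^ 2)
      simpa only [sub_apply, tr_apply] using this
    have i2 : Integrable (fun ξ => 4 * sin (π * (h * ξ)) ^ 2 / h ^ 2 * ‖𝓕 g ξ‖ ^ 2) := by
      refine (integrable_norm_sq (𝓕 g)).bdd_mul (c := 4 / h ^ 2) (by fun_prop) (ae_of_all _ fun ξ => ?_)
      rw [Real.norm_of_nonneg (by positivity)]
      gcongr
      nlinarith [sin_sq_le_one (π * (h * ξ))]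
    simp_rw [← ENNReal.ofReal_mul (show 0 ≤ 4 * sin (π * (h * _)) ^ 2 / h ^ 2 by positivity)]
    rw [← ofReal_integral_eq_lintegral_ofReal i1 (ae_of_all _ fun x => by positivity),
      ← ofReal_integral_eq_lintegral_ofReal i2 (ae_of_all _ fun x => by positivity),
      integral_div, L2_tr_sub_sq, ← integral_div]
    congr 2; ext ξ; ring
  simp_rw [h1]
  have hc : Continuous (fun ξ => ‖𝓕 g ξ‖ ^ 2) := by fun_prop
  rw [lintegral_lintegral_swap]
  · congr 1; ext ξ
    rw [lintegral_mul_const'' _ (by fun_prop), lintegral_gk, ← ENNReal.ofReal_mul (by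
      have := integral_gk_pos; positivity)]
  · unfold Function.uncurry
    fun_prop

lemma integrable_abs_fourier (g : Sch) : Integrable (fun ξ => |ξ| * ‖𝓕 g ξ‖ ^ 2) := by
  have h1 := integrable_norm_sq (𝓕 g)
  have h2 := integrable_mult dsym_temperate g
  refine Integrable.mono' (h1.add h2) (by fun_prop) (ae_of_all _ fun ξ => ?_)
  rw [Real.norm_of_nonneg (by positivity), Pi.add_apply, norm_dsym, sq_abs]
  have : |ξ| ≤ 1 + (2 * π * ξ) ^ 2 := by
    rw [mul_pow, ← sq_abs ξ]
    nlinarith [pi_gt_three, abs_nonneg ξ, sq_nonneg (|ξ| - 1), mul_nonneg (sq_nonneg |ξ|) (by nlinarith [pi_gt_three] : 0 ≤ (2 * π) ^ 2 - 1)]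
  nlinarith [sq_nonneg ‖𝓕 g ξ‖]

lemma measurable_diff_quotient {g : ℝ → ℂ} (hg : Measurable g) :
    Measurable (fun p : ℝ × ℝ => ENNReal.ofReal (‖g (p.2 + p.1) - g p.2‖ ^ 2 / p.1 ^ 2)) := by
  fun_prop

lemma measurable_diff_quotient_left {g : ℝ → ℂ} (hg : Measurable g) (h : ℝ) :
    Measurable (fun x : ℝ => ENNReal.ofReal (‖g (x + h) - g x‖ ^ 2 / h ^ 2)) := by
  fun_prop

lemma measurable_diff_quotient_right {g : ℝ → ℂ} (hg : Measurable g) (x : ℝ) :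
    Measurable (fun h : ℝ => ENNReal.ofReal (‖g (x + h) - g x‖ ^ 2 / h ^ 2)) := by
  fun_prop

lemma measurable_lintegral_diff_quotient {g : ℝ → ℂ} (hg : Measurable g) :
    Measurable (fun h : ℝ => ∫⁻ x, ENNReal.ofReal (‖g (x + h) - g x‖ ^ 2 / h ^ 2)) :=
  Measurable.lintegral_prod_right
    (f := fun h x : ℝ => ENNReal.ofReal (‖g (x + h) - g x‖ ^ 2 / h ^ 2)) (measurable_diff_quotient hg)

lemma diff_quotient_mul_le {u f : Sch} {U S : ℝ} (hU : ∀ x, ‖u x‖ ≤ U)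
    (hSu : ∀ x, ∫⁻ h, ENNReal.ofReal (‖u (x + h) - u x‖ ^ 2 / h ^ 2) ≤ ENNReal.ofReal S) :
    ∫⁻ h, ∫⁻ x, ENNReal.ofReal (‖mulS u f (x + h) - mulS u f x‖ ^ 2 / h ^ 2) ≤
      ENNReal.ofReal (2 * U ^ 2) * (∫⁻ h, ∫⁻ x, ENNReal.ofReal (‖f (x + h) - f x‖ ^ 2 / h ^ 2)) +
        ENNReal.ofReal (2 * S * L2 f ^ 2) := by
  have hU0 : 0 ≤ U := (norm_nonneg _).trans (hU 0)
  have hpt : ∀ h x : ℝ, ENNReal.ofReal (‖mulS u f (x + h) - mulS u f x‖ ^ 2 / h ^ 2) ≤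
      ENNReal.ofReal (2 * U ^ 2) * ENNReal.ofReal (‖f (x + h) - f x‖ ^ 2 / h ^ 2) +
      ENNReal.ofReal (2 * ‖f x‖ ^ 2) * ENNReal.ofReal (‖u (x + h) - u x‖ ^ 2 / h ^ 2) := by
    intro h x
    rw [← ENNReal.ofReal_mul (by positivity), ← ENNReal.ofReal_mul (by positivity),
      ← ENNReal.ofReal_add (by positivity) (by positivity)]
    apply ENNReal.ofReal_le_ofReal
    rw [mulS_apply, mulS_apply]
    have h1 : ‖u (x + h) * f (x + h) - u x * f x‖ ≤
        U * ‖f (x + h) - f x‖ + ‖f x‖ * ‖u (x + h) - u x‖ := by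
      have : u (x + h) * f (x + h) - u x * f x =
        u (x + h) * (f (x + h) - f x) + f x * (u (x + h) - u x) := by ring
      rw [this]
      refine (norm_add_le _ _).trans ?_
      rw [norm_mul, norm_mul]
      gcongr
      exact hU _
    have h2 : ‖u (x + h) * f (x + h) - u x * f x‖ ^ 2 ≤
        2 * U ^ 2 * ‖f (x + h) - f x‖ ^ 2 + 2 * ‖f x‖ ^ 2 * ‖u (x + h) - u x‖ ^ 2 := by
      refine (pow_le_pow_left₀ (norm_nonneg _) h1 2).trans ?_
      nlinarith [sq_nonneg (U * ‖f (x + h) - f x‖ - ‖f x‖ * ‖u (x + h) - u x‖)]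
    rw [← mul_div_assoc, ← mul_div_assoc, ← add_div]
    gcongr
  have hm := fun g : Sch => measurable_diff_quotient g.continuous.measurable
  have hm1 := fun (g : Sch) (h : ℝ) => measurable_diff_quotient_left g.continuous.measurable h
  have hm2 := fun (g : Sch) (x : ℝ) => measurable_diff_quotient_right g.continuous.measurable x
  have mI := measurable_lintegral_diff_quotient f.continuous.measurable
  have hmf : Measurable (fun x => ENNReal.ofReal (2 * ‖f x‖ ^ 2)) := by
    have := f.continuous.measurable
    fun_prop
  have hm3 : Measurable (fun p : ℝ × ℝ => ENNReal.ofReal (2 * ‖f p.2‖ ^ 2) *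
      ENNReal.ofReal (‖u (p.2 + p.1) - u p.2‖ ^ 2 / p.1 ^ 2)) :=
    (hmf.comp measurable_snd).mul (hm u)
  have q1 : ∀ h : ℝ, ∫⁻ x, ENNReal.ofReal (‖mulS u f (x + h) - mulS u f x‖ ^ 2 / h ^ 2) ≤
      ENNReal.ofReal (2 * U ^ 2) * (∫⁻ x, ENNReal.ofReal (‖f (x + h) - f x‖ ^ 2 / h ^ 2)) +
        ∫⁻ x, ENNReal.ofReal (2 * ‖f x‖ ^ 2) * ENNReal.ofReal (‖u (x + h) - u x‖ ^ 2 / h ^ 2) := by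
    intro h
    rw [← lintegral_const_mul _ (hm1 f h), ← lintegral_add_left ((hm1 f h).const_mul _)]
    exact lintegral_mono fun x => hpt h x
  have q2 : ∫⁻ h, ∫⁻ x, ENNReal.ofReal (2 * ‖f x‖ ^ 2) *
      ENNReal.ofReal (‖u (x + h) - u x‖ ^ 2 / h ^ 2) ≤ ENNReal.ofReal (2 * S * L2 f ^ 2) := by
    rw [lintegral_lintegral_swap (f := fun h x : ℝ => ENNReal.ofReal (2 * ‖f x‖ ^ 2) *
      ENNReal.ofReal (‖u (x + h) - u x‖ ^ 2 / h ^ 2)) hm3.aemeasurable]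
    have q3 : ∀ x : ℝ, ∫⁻ h, ENNReal.ofReal (2 * ‖f x‖ ^ 2) *
        ENNReal.ofReal (‖u (x + h) - u x‖ ^ 2 / h ^ 2) ≤
        ENNReal.ofReal (2 * ‖f x‖ ^ 2) * ENNReal.ofReal S := fun x => by
      rw [lintegral_const_mul _ (hm2 u x)]
      gcongr
      exact hSu x
    refine (lintegral_mono q3).trans ?_
    rw [lintegral_mul_const _ hmf, ← ofReal_integral_eq_lintegral_ofReal
      ((integrable_norm_sq f).const_mul 2) (ae_of_all _ fun x => by positivity),
      ← ENNReal.ofReal_mul (integral_nonneg fun x => by positivity), integral_const_mul, ← L2_sq_eq]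
    apply le_of_eq
    congr 1; ring
  refine (lintegral_mono q1).trans ?_
  rw [lintegral_add_left (mI.const_mul _), lintegral_const_mul _ mI]
  gcongr

/-- A pointwise multiplier bound on the inhomogeneous space of order one half. -/
lemma exists_multiplier_const : ∃ κ : ℝ, 0 < κ ∧ ∀ (u f : Sch) (a U S : ℝ), 0 < a → 0 ≤ S →
    (∀ x, ‖u x‖ ≤ U) →
    (∀ x, ∫⁻ h, ENNReal.ofReal (‖u (x + h) - u x‖ ^ 2 / h ^ 2) ≤ ENNReal.ofReal S) →
    nm a (1 / 4) (mulS u f) ^ 2 ≤ (3 * U ^ 2 + κ * S / a) * nm a (1 / 4) f ^ 2 := by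
  set κ := ∫ h, gk h with hκ
  have hκ0 : 0 < κ := integral_gk_pos
  refine ⟨4 * π / κ, by positivity, fun u f a U S ha hS hU hSu => ?_⟩
  have hU0 : 0 ≤ U := (norm_nonneg _).trans (hU 0)
  set I : Sch → ℝ := fun g => ∫ ξ, |ξ| * ‖𝓕 g ξ‖ ^ 2 with hI
  have hI0 : ∀ g, 0 ≤ I g := fun g => integral_nonneg fun ξ => by positivity
  have hG : ∀ g : Sch, ∫⁻ h, ∫⁻ x, ENNReal.ofReal (‖g (x + h) - g x‖ ^ 2 / h ^ 2) =
      ENNReal.ofReal (κ * I g) := fun g => by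
    rw [lintegral_diff_quotient, hI, ← integral_const_mul, ofReal_integral_eq_lintegral_ofReal
      ((integrable_abs_fourier g).const_mul κ) (ae_of_all _ fun x => by positivity)]
    simp_rw [mul_assoc]; rfl
  have key : κ * I (mulS u f) ≤ 2 * U ^ 2 * (κ * I f) + 2 * S * L2 f ^ 2 := by
    rw [← ENNReal.ofReal_le_ofReal_iff (by have := hI0 f; positivity),
      ENNReal.ofReal_add (by have := hI0 f; positivity) (by positivity),
      ENNReal.ofReal_mul (by positivity : 0 ≤ 2 * U ^ 2), ← hG, ← hG]
    exact diff_quotient_mul_le hU hSu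
  have e2 : ∀ g : Sch, nm a (1 / 4) g ^ 2 = ∫ ξ, √(a ^ 2 + (2 * π * ξ) ^ 2) * ‖𝓕 g ξ‖ ^ 2 := fun g => by
    rw [nm_sq ha]
    simp_rw [show (2 : ℝ) * (1 / 4) = 1 / 2 by norm_num, jsym_half]
  have iJ : ∀ g : Sch, Integrable (fun ξ => √(a ^ 2 + (2 * π * ξ) ^ 2) * ‖𝓕 g ξ‖ ^ 2) := fun g => by
    have := integrable_mult (js_temperate ha (1 / 4)) g
    simp_rw [norm_js ha, jsym_sq ha, show (2 : ℝ) * (1 / 4) = 1 / 2 by norm_num, jsym_half] at this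
    exact this
  have up : nm a (1 / 4) (mulS u f) ^ 2 ≤ a * L2 (mulS u f) ^ 2 + 2 * π * I (mulS u f) := by
    rw [e2, L2_sq_fourier, hI, ← integral_const_mul, ← integral_const_mul, ← integral_add
      ((integrable_norm_sq _).const_mul _) ((integrable_abs_fourier _).const_mul _)]
    refine integral_mono (iJ _) (((integrable_norm_sq _).const_mul _).add
      ((integrable_abs_fourier _).const_mul _)) fun ξ => ?_
    have : √(a ^ 2 + (2 * π * ξ) ^ 2) ≤ a + 2 * π * |ξ| := by
      rw [sqrt_le_left (by positivity), mul_pow, ← sq_abs ξ]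
      have : 0 ≤ a * (2 * π * |ξ|) := by positivity
      nlinarith
    have := mul_le_mul_of_nonneg_right this (sq_nonneg ‖𝓕 (mulS u f) ξ‖)
    simp only
    linarith
  have lo1 : a * L2 f ^ 2 ≤ nm a (1 / 4) f ^ 2 := by
    rw [e2, L2_sq_fourier, ← integral_const_mul]
    refine integral_mono ((integrable_norm_sq _).const_mul _) (iJ _) fun ξ => ?_
    simp only
    gcongr
    exact le_sqrt_of_sq_le (by nlinarith [sq_nonneg (2 * π * ξ)])
  have lo2 : 2 * π * I f ≤ nm a (1 / 4) f ^ 2 := by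
    rw [e2, hI, ← integral_const_mul]
    refine integral_mono ((integrable_abs_fourier _).const_mul _) (iJ _) fun ξ => ?_
    simp only
    rw [← mul_assoc]
    gcongr
    refine le_sqrt_of_sq_le ?_
    rw [mul_pow, mul_pow, sq_abs]
    nlinarith [sq_nonneg a]
  have hL := pow_le_pow_left₀ (L2_nonneg _) (L2_mulS_le hU f) 2
  have key2 : 2 * π * I (mulS u f) ≤ 2 * U ^ 2 * (2 * π * I f) + 4 * π / κ * S * L2 f ^ 2 := by
    have := mul_le_mul_of_nonneg_left key (by positivity : 0 ≤ 2 * π / κ)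
    calc _ = 2 * π / κ * (κ * I (mulS u f)) := by field_simp
      _ ≤ _ := this
      _ = _ := by field_simp; ring
  have h3 : 4 * π / κ * S * L2 f ^ 2 ≤ 4 * π / κ * S / a * nm a (1 / 4) f ^ 2 := by
    calc _ = 4 * π / κ * S / a * (a * L2 f ^ 2) := by field_simp
      _ ≤ _ := by gcongr
  nlinarith [mul_le_mul_of_nonneg_left lo1 (sq_nonneg U), mul_le_mul_of_nonneg_left lo2 (sq_nonneg U)]

end LinKdV

namespace LinKdV

lemma integral_poisson {r : ℝ} (hr : 0 < r) :
    Integrable (fun h : ℝ => r / (r ^ 2 + h ^ 2)) ∧ ∫ h : ℝ, r / (r ^ 2 + h ^ 2) = π := by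
  have e : (fun h : ℝ => r / (r ^ 2 + h ^ 2)) = fun h => r⁻¹ * (1 + (r⁻¹ * h) ^ 2)⁻¹ := by
    ext h; field_simp
  rw [e]
  refine ⟨(integrable_inv_one_add_sq.comp_mul_left' (inv_ne_zero hr.ne')).const_mul _, ?_⟩
  rw [integral_const_mul, Measure.integral_comp_mul_left (fun x : ℝ => (1 + x ^ 2)⁻¹),
    integral_univ_inv_one_add_sq, inv_inv, abs_of_pos hr, smul_eq_mul]
  field_simp

lemma lintegral_poisson {r : ℝ} (hr : 0 < r) :
    ∫⁻ h : ℝ, ENNReal.ofReal (r / (r ^ 2 + h ^ 2)) = ENNReal.ofReal π := by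
  rw [← ofReal_integral_eq_lintegral_ofReal (integral_poisson hr).1
    (ae_of_all _ fun x => by positivity), (integral_poisson hr).2]

lemma sqrt_sq_add_lipschitz (θ x y : ℝ) :
    √(y ^ 2 + θ ^ 2) ≤ √(x ^ 2 + θ ^ 2) + |y - x| := by
  have h0 := sqrt_nonneg (x ^ 2 + θ ^ 2)
  rw [sqrt_le_left (by positivity)]
  have h1 := sq_sqrt (by positivity : 0 ≤ x ^ 2 + θ ^ 2)
  have h2 : |x| ≤ √(x ^ 2 + θ ^ 2) := abs_le_sqrt (by nlinarith [sq_nonneg θ])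
  have h3 : x * (y - x) ≤ √(x ^ 2 + θ ^ 2) * |y - x| := by
    refine (le_abs_self _).trans ?_
    rw [abs_mul]
    gcongr
  nlinarith [sq_abs (y - x)]

/-- Square-function bound for a function obeying dispersive decay estimates. -/
lemma lintegral_diff_le_of_decay {v : ℝ → ℝ} (hv : Differentiable ℝ v) {m σ θ : ℝ} (hσ : 0 < σ)
    (hθ : 0 < θ) (hσθ : σ ^ 2 = θ ^ 3)
    (h1 : ∀ y, v y ^ 2 * (σ * √√(y ^ 2 + θ ^ 2)) ≤ m ^ 2)
    (h2 : ∀ y, deriv v y ^ 2 * σ ^ 3 ≤ m ^ 2 * √√(y ^ 2 + θ ^ 2)) (x : ℝ) :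
    ∫⁻ h, ENNReal.ofReal ((v (x + h) - v x) ^ 2 / h ^ 2) ≤ ENNReal.ofReal (32 * π * m ^ 2 / σ ^ 2) := by
  set J := √(x ^ 2 + θ ^ 2) with hJ
  have hJθ : θ ≤ J := le_sqrt_of_sq_le (by nlinarith [sq_nonneg x])
  have hJ0 : 0 < J := hθ.trans_le hJθ
  set q := √J with hq
  have hq0 : 0 < q := sqrt_pos.2 hJ0
  have hq2 : q ^ 2 = J := sq_sqrt hJ0.le
  set r := σ / q with hr
  have hr0 : 0 < r := by positivity
  -- pointwise majorant
  have near : ∀ h : ℝ, |h| ≤ J / 2 → (v (x + h) - v x) ^ 2 / h ^ 2 ≤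
      16 * m ^ 2 / σ ^ 2 * (r / (r ^ 2 + h ^ 2)) := by
    intro h hh
    rcases eq_or_ne h 0 with rfl | hne
    · simp; positivity
    have hh2 : 0 < h ^ 2 := by positivity
    have hlow : ∀ y, |y - x| ≤ |h| → q / 2 ≤ √√(y ^ 2 + θ ^ 2) ∧ √√(y ^ 2 + θ ^ 2) ≤ 2 * q := by
      intro y hy
      have l1 := sqrt_sq_add_lipschitz θ x y
      have l2 := sqrt_sq_add_lipschitz θ y x
      rw [abs_sub_comm] at l2
      constructor
      · refine le_sqrt_of_sq_le ?_
        rw [div_pow, hq2]; linarith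
      · rw [sqrt_le_left (by positivity), mul_pow, hq2]; linarith
    have hd : ∀ y ∈ Metric.closedBall x |h|, ‖deriv v y‖ ≤ √(2 * m ^ 2 * q / σ ^ 3) := by
      intro y hy
      refine abs_le_sqrt ?_
      rw [le_div_iff₀ (by positivity)]
      have := (hlow y (by simpa [Real.dist_eq] using hy)).2
      have h3 := h2 y
      nlinarith [sq_nonneg m]
    have hmv := (convex_closedBall x |h|).norm_image_sub_le_of_norm_deriv_le
      (fun y _ => hv.differentiableAt) hd (Metric.mem_closedBall_self (abs_nonneg h))
      (show x + h ∈ Metric.closedBall x |h| by simp)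
    have b1 : (v (x + h) - v x) ^ 2 ≤ 2 * m ^ 2 * q / σ ^ 3 * h ^ 2 := by
      have := pow_le_pow_left₀ (norm_nonneg _) hmv 2
      rw [mul_pow, sq_sqrt (by positivity), add_sub_cancel_left, Real.norm_eq_abs, Real.norm_eq_abs,
        sq_abs, sq_abs] at this
      exact this
    have b2 : (v (x + h) - v x) ^ 2 ≤ 8 * m ^ 2 / (σ * q) := by
      have s1 : ∀ y, |y - x| ≤ |h| → v y ^ 2 ≤ 2 * m ^ 2 / (σ * q) := by
        intro y hy
        rw [le_div_iff₀ (by positivity)]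
        have := (hlow y hy).1
        have h3 := h1 y
        have h4 : v y ^ 2 * (σ * (q / 2)) ≤ v y ^ 2 * (σ * √√(y ^ 2 + θ ^ 2)) := by gcongr
        linarith
      have t1 := s1 (x + h) (by simp)
      have t2 := s1 x (by simp)
      have e : 8 * m ^ 2 / (σ * q) = 4 * (2 * m ^ 2 / (σ * q)) := by ring
      rw [e]
      nlinarith [sq_nonneg (v (x + h) + v x)]
    rw [div_le_iff₀ hh2]
    have e : 16 * m ^ 2 / σ ^ 2 * (r / (r ^ 2 + h ^ 2)) * h ^ 2 =
        16 * m ^ 2 * h ^ 2 * q / (σ * (σ ^ 2 + h ^ 2 * q ^ 2)) := by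
      rw [hr]; field_simp
    rw [e, le_div_iff₀ (by positivity)]
    have c1 : (v (x + h) - v x) ^ 2 * σ ^ 3 ≤ 2 * m ^ 2 * q * h ^ 2 := by
      have := mul_le_mul_of_nonneg_right b1 (by positivity : 0 ≤ σ ^ 3)
      calc _ ≤ _ := this
        _ = _ := by field_simp
    have c2 : (v (x + h) - v x) ^ 2 * (σ * (h ^ 2 * q ^ 2)) ≤ 8 * m ^ 2 * h ^ 2 * q := by
      have := mul_le_mul_of_nonneg_right b2 (by positivity : 0 ≤ σ * (h ^ 2 * q ^ 2))
      calc _ ≤ _ := this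
        _ = _ := by field_simp
    have c3 : 0 ≤ m ^ 2 * q * h ^ 2 := by positivity
    linarith
  have far : ∀ h : ℝ, J / 2 < |h| → (v (x + h) - v x) ^ 2 / h ^ 2 ≤
      16 * m ^ 2 / σ ^ 2 * (J / 2 / ((J / 2) ^ 2 + h ^ 2)) := by
    intro h hh
    have hh2 : (J / 2) ^ 2 < h ^ 2 := by rw [← sq_abs h]; gcongr
    have hpos : 0 < h ^ 2 := lt_of_le_of_lt (sq_nonneg _) hh2
    have s1 : ∀ y, v y ^ 2 * θ ^ 2 ≤ m ^ 2 := by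
      intro y
      have e : θ ^ 2 ≤ σ * √√(y ^ 2 + θ ^ 2) := by
        have : θ ≤ √(y ^ 2 + θ ^ 2) := le_sqrt_of_sq_le (by nlinarith [sq_nonneg y])
        have h3 : √θ ≤ √√(y ^ 2 + θ ^ 2) := sqrt_le_sqrt this
        have h4 : θ ^ 2 = σ * √θ := by
          rw [← sq_eq_sq₀ (by positivity) (by positivity), mul_pow, hσθ, sq_sqrt hθ.le]; ring
        exact h4.le.trans (mul_le_mul_of_nonneg_left h3 hσ.le)
      exact (mul_le_mul_of_nonneg_left e (sq_nonneg _)).trans (h1 y)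
    have s2 : (v (x + h) - v x) ^ 2 * θ ^ 2 ≤ 4 * m ^ 2 := by
      have t1 := s1 (x + h)
      have t2 := s1 x
      nlinarith [sq_nonneg (v (x + h) + v x), sq_nonneg θ, mul_nonneg (sq_nonneg (v (x + h) + v x)) (sq_nonneg θ)]
    rw [div_le_iff₀ hpos, hσθ]
    have e : 16 * m ^ 2 / θ ^ 3 * (J / 2 / ((J / 2) ^ 2 + h ^ 2)) * h ^ 2 =
        8 * m ^ 2 * J * h ^ 2 / (θ ^ 3 * ((J / 2) ^ 2 + h ^ 2)) := by
      field_simp; ring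
    rw [e, le_div_iff₀ (by positivity)]
    calc (v (x + h) - v x) ^ 2 * (θ ^ 3 * ((J / 2) ^ 2 + h ^ 2)) =
          ((v (x + h) - v x) ^ 2 * θ ^ 2) * (θ * ((J / 2) ^ 2 + h ^ 2)) := by ring
      _ ≤ (4 * m ^ 2) * (J * (h ^ 2 + h ^ 2)) := by gcongr
      _ = _ := by ring
  have maj : ∀ h : ℝ, ENNReal.ofReal ((v (x + h) - v x) ^ 2 / h ^ 2) ≤
      ENNReal.ofReal (16 * m ^ 2 / σ ^ 2) * ENNReal.ofReal (r / (r ^ 2 + h ^ 2)) +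
      ENNReal.ofReal (16 * m ^ 2 / σ ^ 2) * ENNReal.ofReal (J / 2 / ((J / 2) ^ 2 + h ^ 2)) := by
    intro h
    rw [← ENNReal.ofReal_mul (by positivity), ← ENNReal.ofReal_mul (by positivity),
      ← ENNReal.ofReal_add (by positivity) (by positivity)]
    apply ENNReal.ofReal_le_ofReal
    by_cases hh : |h| ≤ J / 2
    · exact (near h hh).trans (le_add_of_nonneg_right (by positivity))
    · exact (far h (not_le.1 hh)).trans (le_add_of_nonneg_left (by positivity))
  refine (lintegral_mono maj).trans ?_
  rw [lintegral_add_left (by fun_prop), lintegral_const_mul _ (by fun_prop),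
    lintegral_const_mul _ (by fun_prop), lintegral_poisson hr0, lintegral_poisson (by positivity),
    ← ENNReal.ofReal_mul (by positivity), ← ENNReal.ofReal_add (by positivity) (by positivity)]
  apply le_of_eq
  congr 1; ring

/-- The multiplier bounds furnished by the bootstrap hypothesis on a dyadic window. -/
lemma exists_bootstrap_const : ∃ κ : ℝ, 1 ≤ κ ∧ ∀ (M ε s t : ℝ) (v : ℝ → ℝ) (u : Sch),
    0 ≤ M * ε → 0 < s → s ≤ t → t ≤ 2 * s → Bootstrap M ε t v → (∀ x, u x = (v x : ℂ)) →
    (∀ x, ‖u x‖ ≤ M * ε * s ^ (-(1 / 3) : ℝ)) ∧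
    ∀ f, nm (s ^ (-(1 / 3) : ℝ)) (1 / 4) (mulS u f) ≤
      κ * (M * ε) * s ^ (-(1 / 3) : ℝ) * nm (s ^ (-(1 / 3) : ℝ)) (1 / 4) f := by
  obtain ⟨κ₀, hκ₀, H⟩ := exists_multiplier_const
  refine ⟨3 + κ₀ * (32 * π), by have := pi_pos; nlinarith [mul_pos hκ₀ pi_pos], ?_⟩
  intro M ε s t v u hm hs hst hts hB huv
  set m := M * ε with hmdef
  have ht : 0 < t := hs.trans_le hst
  set a : ℝ := s ^ (-(1 / 3) : ℝ) with ha
  have ha0 : 0 < a := rpow_pos_of_pos hs _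
  set θ : ℝ := t ^ (1 / 3 : ℝ) with hθ
  have hθ0 : 0 < θ := rpow_pos_of_pos ht _
  have hθ2 : t ^ ((2 : ℝ) / 3) = θ ^ 2 := by
    rw [hθ, ← rpow_natCast, ← rpow_mul ht.le]; norm_num
  have hjb : ∀ x, jb t x = √(x ^ 2 + θ ^ 2) := fun x => by rw [jb, hθ2, sqrt_eq_rpow]
  have hjpos : ∀ x : ℝ, 0 < √(x ^ 2 + θ ^ 2) := fun x => by positivity
  have hsq : ∀ (y : ℝ), 0 < y → ∀ p : ℝ, (y ^ p) ^ 2 = y ^ (2 * p) := fun y hy p => by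
    rw [← rpow_natCast, ← rpow_mul hy.le]; ring_nf
  set σ := √t with hσ
  have hσ0 : 0 < σ := sqrt_pos.2 ht
  have hσ2 : σ ^ 2 = t := sq_sqrt ht.le
  have hθ3 : θ ^ 3 = t := by rw [hθ, ← rpow_natCast, ← rpow_mul ht.le]; norm_num
  have d1 : ∀ y, v y ^ 2 * (σ * √√(y ^ 2 + θ ^ 2)) ≤ m ^ 2 := by
    intro y
    have h := (hB y).1
    rw [hjb] at h
    have h3 := pow_le_pow_left₀ (abs_nonneg _) h 2
    rw [sq_abs, mul_pow, mul_pow, hsq t ht, hsq _ (hjpos y)] at h3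
    rw [show (2 : ℝ) * (-1 / 4) = -(1 / 2) by norm_num, rpow_neg ht.le, rpow_neg (hjpos y).le,
      ← sqrt_eq_rpow, ← sqrt_eq_rpow] at h3
    have hj := sqrt_pos.2 (hjpos y)
    calc _ ≤ m ^ 2 * (√t)⁻¹ * (√√(y ^ 2 + θ ^ 2))⁻¹ * (σ * √√(y ^ 2 + θ ^ 2)) := by gcongr
      _ = _ := by rw [← hσ]; field_simp
  have d2 : ∀ y, deriv v y ^ 2 * σ ^ 3 ≤ m ^ 2 * √√(y ^ 2 + θ ^ 2) := by
    intro y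
    have h := (hB y).2
    rw [hjb] at h
    have h3 := pow_le_pow_left₀ (abs_nonneg _) h 2
    rw [sq_abs, mul_pow, mul_pow, hsq t ht, hsq _ (hjpos y)] at h3
    rw [show (2 : ℝ) * (-3 / 4) = -((1 / 2) * (3 : ℕ)) by norm_num, rpow_neg ht.le,
      rpow_mul ht.le, rpow_natCast, show (2 : ℝ) * (1 / 4) = 1 / 2 by norm_num,
      ← sqrt_eq_rpow, ← sqrt_eq_rpow] at h3
    calc _ ≤ m ^ 2 * ((√t) ^ 3)⁻¹ * (√√(y ^ 2 + θ ^ 2)) * σ ^ 3 := by gcongr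
      _ = _ := by rw [← hσ]; field_simp
  have hv : Differentiable ℝ v := by
    have : v = fun x => (u x).re := by ext x; rw [huv]; simp
    rw [this]
    intro x
    exact (Complex.reCLM.differentiableAt).comp x u.differentiableAt
  have hS := lintegral_diff_le_of_decay hv hσ0 hθ0 (hσ2.trans hθ3.symm) d1 d2
  have hsa : θ⁻¹ ≤ a := by
    rw [hθ, ← rpow_neg ht.le, ha]
    exact rpow_le_rpow_of_nonpos hs hst (by norm_num)
  have hU : ∀ x, ‖u x‖ ≤ m * a := by
    intro x
    rw [huv, Complex.norm_real, Real.norm_eq_abs]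
    refine le_trans ?_ (mul_le_mul_of_nonneg_left hsa hm)
    refine abs_le_of_sq_le_sq ?_ (by positivity)
    rw [mul_pow, inv_pow, ← div_eq_mul_inv, le_div_iff₀ (by positivity)]
    have e : θ ^ 2 ≤ σ * √√(x ^ 2 + θ ^ 2) := by
      have : θ ≤ √(x ^ 2 + θ ^ 2) := le_sqrt_of_sq_le (by nlinarith [sq_nonneg x])
      have h3 : √θ ≤ √√(x ^ 2 + θ ^ 2) := sqrt_le_sqrt this
      have h4 : θ ^ 2 = σ * √θ := by
        rw [← sq_eq_sq₀ (by positivity) (by positivity), mul_pow, hσ2, ← hθ3, sq_sqrt hθ0.le]; ring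
      exact h4.le.trans (mul_le_mul_of_nonneg_left h3 hσ0.le)
    exact (mul_le_mul_of_nonneg_left e (sq_nonneg _)).trans (d1 x)
  refine ⟨hU, fun f => ?_⟩
  have hsq' := H u f a (m * a) (32 * π * m ^ 2 / σ ^ 2) ha0 (by positivity) hU (fun x => by
    refine le_trans (le_of_eq ?_) (hS x)
    congr 1; ext h
    rw [huv, huv, ← Complex.ofReal_sub, Complex.norm_real, Real.norm_eq_abs, sq_abs])
  have ha3 : a ^ 3 * s = 1 := by
    rw [ha, ← rpow_natCast, ← rpow_mul hs.le, ← rpow_add_one hs.ne']; norm_num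
  have hbd : 3 * (m * a) ^ 2 + κ₀ * (32 * π * m ^ 2 / σ ^ 2) / a ≤
      ((3 + κ₀ * (32 * π)) * m * a) ^ 2 := by
    have e : 1 / (σ ^ 2 * a) ≤ a ^ 2 := by
      rw [div_le_iff₀ (by positivity), hσ2]
      nlinarith [pow_pos ha0 3]
    have e2 : κ₀ * (32 * π * m ^ 2 / σ ^ 2) / a ≤ κ₀ * (32 * π) * (m ^ 2 * a ^ 2) := by
      calc _ = κ₀ * (32 * π) * m ^ 2 * (1 / (σ ^ 2 * a)) := by field_simp
        _ ≤ κ₀ * (32 * π) * m ^ 2 * a ^ 2 := by gcongr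
        _ = _ := by ring
    have hk : 0 < κ₀ * (32 * π) := by positivity
    have e3 : 3 + κ₀ * (32 * π) ≤ (3 + κ₀ * (32 * π)) ^ 2 := by nlinarith
    calc _ ≤ (3 + κ₀ * (32 * π)) * (m ^ 2 * a ^ 2) := by linarith [e2]
      _ ≤ (3 + κ₀ * (32 * π)) ^ 2 * (m ^ 2 * a ^ 2) := by gcongr
      _ = _ := by ring
  have hfin := hsq'.trans (mul_le_mul_of_nonneg_right hbd (sq_nonneg _))
  rw [← mul_pow] at hfin
  exact le_of_sq_le_sq hfin (mul_nonneg (by positivity) (nm_nonneg _ _ _))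

end LinKdV

namespace LinKdV

open Filter Topology
open scoped ContDiff

/-- A fixed smooth cutoff equal to one near the origin. -/
def cutoff : ContDiffBump (0 : ℝ) := ⟨1, 2, one_pos, one_lt_two⟩

lemma cutoff_smooth : ContDiff ℝ ∞ (cutoff : ℝ → ℝ) := cutoff.contDiff

lemma exists_iteratedDeriv_cutoff_le (i : ℕ) :
    ∃ C : ℝ, 0 ≤ C ∧ ∀ y, ‖iteratedDeriv i (fun y => cutoff y - 1) y‖ ≤ C * |y| := by
  have hb : ∃ C : ℝ, 0 ≤ C ∧ ∀ y, ‖iteratedDeriv i (fun y => cutoff y - 1) y‖ ≤ C := by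
    cases i with
    | zero =>
      refine ⟨1, zero_le_one, fun y => ?_⟩
      have h1 := cutoff.nonneg (x := y)
      have h2 := cutoff.le_one (x := y)
      rw [iteratedDeriv_zero, Real.norm_eq_abs, abs_le]
      constructor <;> linarith
    | succ j =>
      have e : iteratedDeriv (j + 1) (fun y => cutoff y - 1) =
          iteratedDeriv (j + 1) (cutoff : ℝ → ℝ) := by
        rw [iteratedDeriv_succ', iteratedDeriv_succ']
        congr 1
        ext y
        exact deriv_sub_const _
      refine ⟨SchwartzMap.seminorm ℝ 0 (j + 1) (cutoff.hasCompactSupport.toSchwartzMap cutoff_smooth),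
        apply_nonneg _ _, fun y => ?_⟩
      rw [e, ← norm_iteratedFDeriv_eq_norm_iteratedDeriv]
      exact norm_iteratedFDeriv_le_seminorm ℝ
        (cutoff.hasCompactSupport.toSchwartzMap cutoff_smooth) (j + 1) y
  obtain ⟨C, hC, h⟩ := hb
  refine ⟨C, hC, fun y => ?_⟩
  by_cases hy : |y| < 1
  · have e : (fun y => cutoff y - 1) =ᶠ[𝓝 y] fun _ => (0 : ℝ) := by
      have : Metric.ball (0 : ℝ) 1 ∈ 𝓝 y := Metric.isOpen_ball.mem_nhds (by simpa using hy)
      filter_upwards [this] with x hx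
      rw [cutoff.one_of_mem_closedBall (Metric.ball_subset_closedBall hx), sub_self]
    rw [e.iteratedDeriv_eq, iteratedDeriv_const]
    simp only [ite_self, norm_zero]
    positivity
  · push Not at hy
    exact (h y).trans (le_mul_of_one_le_right hC hy)

lemma hasCompactSupport_cutoff_comp (n : ℕ) :
    HasCompactSupport (fun x : ℝ => cutoff (((n : ℝ) + 1)⁻¹ * x)) := by
  have h := cutoff.hasCompactSupport
  exact h.comp_homeomorph (Homeomorph.mulLeft₀ (((n : ℝ) + 1)⁻¹) (by positivity))

lemma hasCompactSupport_cutoff_smul (ψ : ℝ → ℂ) (n : ℕ) :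
    HasCompactSupport (fun x : ℝ => cutoff (((n : ℝ) + 1)⁻¹ * x) • ψ x) :=
  (hasCompactSupport_cutoff_comp n).mono' <| subset_closure.trans' fun x hx hx0 =>
    hx (by simp only [hx0, zero_smul])

lemma contDiff_cutoff_smul {ψ : ℝ → ℂ} (hψ : ContDiff ℝ ∞ ψ) (n : ℕ) :
    ContDiff ℝ ∞ (fun x : ℝ => cutoff (((n : ℝ) + 1)⁻¹ * x) • ψ x) := by
  have h : ContDiff ℝ ∞ (fun x : ℝ => ((n : ℝ) + 1)⁻¹ * x) := by fun_prop
  exact (cutoff_smooth.comp h).smul hψ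

/-- Truncation of a Schwartz function at scale `n + 1`. -/
def trunc (ψ : Sch) (n : ℕ) : Sch :=
  (hasCompactSupport_cutoff_smul ψ n).toSchwartzMap (contDiff_cutoff_smul (ψ.smooth ⊤) n)

lemma trunc_apply (ψ : Sch) (n : ℕ) (x : ℝ) :
    trunc ψ n x = cutoff (((n : ℝ) + 1)⁻¹ * x) • ψ x := rfl

lemma trunc_hasCompactSupport (ψ : Sch) (n : ℕ) : HasCompactSupport (trunc ψ n) :=
  hasCompactSupport_cutoff_smul ψ n

lemma exists_seminorm_trunc_le (ψ : Sch) (k m : ℕ) :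
    ∃ C : ℝ, 0 ≤ C ∧ ∀ n : ℕ, SchwartzMap.seminorm ℝ k m (trunc ψ n - ψ) ≤ C * ((n : ℝ) + 1)⁻¹ := by
  choose c hc0 hc using exists_iteratedDeriv_cutoff_le
  refine ⟨∑ i ∈ Finset.range (m + 1), (m.choose i : ℝ) * c i * SchwartzMap.seminorm ℝ (k + 1) (m - i) ψ,
    Finset.sum_nonneg fun i _ => mul_nonneg (mul_nonneg (Nat.cast_nonneg _) (hc0 i)) (apply_nonneg _ _), fun n => ?_⟩
  set q : ℝ := ((n : ℝ) + 1)⁻¹ with hq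
  have hq0 : 0 ≤ q := by positivity
  have hq1 : q ≤ 1 := inv_le_one_of_one_le₀ (by linarith [n.cast_nonneg (α := ℝ)])
  refine SchwartzMap.seminorm_le_bound ℝ k m _ (mul_nonneg (Finset.sum_nonneg fun i _ => mul_nonneg (mul_nonneg (Nat.cast_nonneg _) (hc0 i)) (apply_nonneg _ _)) hq0) fun x => ?_
  have e : ⇑(trunc ψ n - ψ) = fun x => (cutoff (q * x) - 1) • ψ x := by
    ext x; rw [sub_apply, trunc_apply, sub_smul, one_smul]
  have hs : ContDiff ℝ ∞ (fun y => cutoff y - 1) := cutoff_smooth.sub contDiff_const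
  have hs' : ContDiff ℝ ∞ (fun y => cutoff (q * y) - 1) := hs.comp (contDiff_const.mul contDiff_id)
  rw [e]
  refine (mul_le_mul_of_nonneg_left (norm_iteratedFDeriv_smul_le hs' (ψ.smooth ⊤) x (n := m)
    (mod_cast le_top)) (by positivity)).trans ?_
  rw [Finset.mul_sum, Finset.sum_mul]
  refine Finset.sum_le_sum fun i _ => ?_
  have h1 : ‖iteratedFDeriv ℝ i (fun y => cutoff (q * y) - 1) x‖ ≤ c i * (q * ‖x‖) := by
    rw [norm_iteratedFDeriv_eq_norm_iteratedDeriv,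
      iteratedDeriv_comp_const_mul (f := fun y => cutoff y - 1) (hs.of_le (mod_cast le_top)) q,
      norm_mul, norm_pow, Real.norm_eq_abs, abs_of_nonneg hq0]
    calc q ^ i * _ ≤ 1 * (c i * |q * x|) := by
          gcongr
          · exact pow_le_one₀ hq0 hq1
          · exact hc i _
      _ = _ := by rw [abs_mul, abs_of_nonneg hq0, one_mul, Real.norm_eq_abs]
  have h2 := SchwartzMap.le_seminorm ℝ (k + 1) (m - i) ψ x
  calc _ ≤ ‖x‖ ^ k * ((m.choose i : ℝ) * (c i * (q * ‖x‖)) * ‖iteratedFDeriv ℝ (m - i) ψ x‖) := by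
        gcongr
    _ = (m.choose i : ℝ) * c i * (‖x‖ ^ (k + 1) * ‖iteratedFDeriv ℝ (m - i) ψ x‖) * q := by ring
    _ ≤ _ := by
        have := hc0 i
        gcongr

lemma tendsto_trunc (ψ : Sch) : Tendsto (trunc ψ) atTop (𝓝 ψ) := by
  rw [(schwartz_withSeminorms ℝ ℝ ℂ).tendsto_nhds]
  rintro ⟨k, m⟩ ε hε
  obtain ⟨C, hC, h⟩ := exists_seminorm_trunc_le ψ k m
  have ht : Tendsto (fun n : ℕ => C * ((n : ℝ) + 1)⁻¹) atTop (𝓝 0) := by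
    have := (tendsto_one_div_add_atTop_nhds_zero_nat (𝕜 := ℝ)).const_mul C
    simpa [one_div] using this
  filter_upwards [ht.eventually (gt_mem_nhds hε)] with n hn
  exact (h n).trans_lt hn

lemma hasDerivAt_ip_of_hasCompactSupport {F F' : ℝ → Sch} {α β : ℝ}
    (hd : ∀ τ ∈ Ioo α β, ∀ x, HasDerivAt (fun s => F s x) (F' τ x) τ)
    (hc : ContinuousOn (fun q : ℝ × ℝ => F' q.1 q.2) (Ioo α β ×ˢ univ))
    {ψ : Sch} (hψ : HasCompactSupport ψ) {τ : ℝ} (hτ : τ ∈ Ioo α β) :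
    HasDerivAt (fun s => ip ψ (F s)) (ip ψ (F' τ)) τ := by
  obtain ⟨δ, hδ, hball⟩ := Metric.nhds_basis_closedBall.mem_iff.1 (Ioo_mem_nhds hτ.1 hτ.2)
  have hK : IsCompact (Metric.closedBall τ δ ×ˢ tsupport ψ) :=
    (isCompact_closedBall τ δ).prod hψ
  obtain ⟨C, hC⟩ := hK.exists_bound_of_continuousOn
    (hc.mono (prod_mono hball (subset_univ _)))
  have key := hasDerivAt_integral_of_dominated_loc_of_deriv_le (μ := volume) (x₀ := τ)
    (F := fun s x => (starRingEnd ℂ) (ψ x) * F s x)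
    (F' := fun s x => (starRingEnd ℂ) (ψ x) * F' s x) (bound := fun x => ‖ψ x‖ * C)
    (Metric.closedBall_mem_nhds τ hδ) ?_ ?_ ?_ ?_ ?_ ?_
  · have h2 := Complex.reCLM.hasFDerivAt.comp_hasDerivAt τ key.2
    simp only [ip_eq_integral]
    exact h2
  · exact Eventually.of_forall fun s =>
      ((Complex.continuous_conj.comp ψ.continuous).mul (F s).continuous).aestronglyMeasurable
  · have : Integrable (fun x => (starRingEnd ℂ) (ψ x) * F τ x) volume := by
      refine ((Complex.continuous_conj.comp ψ.continuous).mul (F τ).continuous).integrable_of_hasCompactSupport ?_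
      exact HasCompactSupport.mul_right (hψ.comp_left (map_zero _))
    exact this
  · exact ((Complex.continuous_conj.comp ψ.continuous).mul (F' τ).continuous).aestronglyMeasurable
  · refine Eventually.of_forall fun x s hs => ?_
    rw [norm_mul, RCLike.norm_conj]
    by_cases hx : x ∈ tsupport ψ
    · exact mul_le_mul_of_nonneg_left (hC (s, x) ⟨hs, hx⟩) (norm_nonneg _)
    · rw [image_eq_zero_of_notMem_tsupport hx]; simp
  · exact ψ.integrable.norm.mul_const C
  · exact Eventually.of_forall fun x s hs => (hd s (hball hs) x).const_mul _

lemma continuousOn_ip_of_hasCompactSupport {F : ℝ → Sch} {α β : ℝ}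
    (hc : ContinuousOn (fun q : ℝ × ℝ => F q.1 q.2) (Icc α β ×ˢ univ))
    {ψ : Sch} (hψ : HasCompactSupport ψ) :
    ContinuousOn (fun s => ip ψ (F s)) (Icc α β) := by
  have hK : IsCompact (Icc α β ×ˢ tsupport ψ) := isCompact_Icc.prod hψ
  obtain ⟨C, hC⟩ := hK.exists_bound_of_continuousOn (hc.mono (prod_mono le_rfl (subset_univ _)))
  simp only [ip_eq_integral]
  refine Complex.continuous_re.comp_continuousOn ?_
  refine continuousOn_of_dominated (bound := fun x => ‖ψ x‖ * C) ?_ ?_ ?_ ?_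
  · exact fun s _ =>
      ((Complex.continuous_conj.comp ψ.continuous).mul (F s).continuous).aestronglyMeasurable
  · refine fun s hs => Eventually.of_forall fun x => ?_
    rw [norm_mul, RCLike.norm_conj]
    by_cases hx : x ∈ tsupport ψ
    · exact mul_le_mul_of_nonneg_left (hC (s, x) ⟨hs, hx⟩) (norm_nonneg _)
    · rw [image_eq_zero_of_notMem_tsupport hx]; simp
  · exact ψ.integrable.norm.mul_const C
  · refine Eventually.of_forall fun x => continuousOn_const.mul ?_
    exact hc.comp (f := fun s => (s, x)) (by fun_prop) fun s hs => ⟨hs, mem_univ _⟩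

lemma tendsto_bound_trunc {p : Sch → ℝ} (hp : Tendsto p (𝓝 0) (𝓝 0)) (ψ : Sch) :
    Tendsto (fun n => p (ψ - trunc ψ n)) atTop (𝓝 0) := by
  have h : Tendsto (fun n => ψ - trunc ψ n) atTop (𝓝 (ψ - ψ)) := tendsto_const_nhds.sub (tendsto_trunc ψ)
  rw [sub_self] at h
  exact hp.comp h

lemma tendstoUniformlyOn_ip_trunc {F : ℝ → Sch} {s : Set ℝ} {p : Sch → ℝ}
    (hp : Tendsto p (𝓝 0) (𝓝 0)) (hF : ∀ τ ∈ s, ∀ ψ, |ip ψ (F τ)| ≤ p ψ) (ψ : Sch) :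
    TendstoUniformlyOn (fun n τ => ip (trunc ψ n) (F τ)) (fun τ => ip ψ (F τ)) atTop s := by
  rw [Metric.tendstoUniformlyOn_iff]
  intro ε hε
  filter_upwards [(tendsto_bound_trunc hp ψ).eventually (gt_mem_nhds hε)] with n hn τ hτ
  rw [Real.dist_eq, ← ip_sub_left]
  exact (hF τ hτ _).trans_lt hn

/-- Pairings with Schwartz functions may be differentiated in time as soon as they satisfy bounds
which are uniform in time and continuous in the test function. -/
lemma hasDerivAt_ip {F F' : ℝ → Sch} {α β : ℝ} {p : Sch → ℝ} (hp : Tendsto p (𝓝 0) (𝓝 0))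
    (hd : ∀ τ ∈ Ioo α β, ∀ x, HasDerivAt (fun s => F s x) (F' τ x) τ)
    (hc : ContinuousOn (fun q : ℝ × ℝ => F' q.1 q.2) (Ioo α β ×ˢ univ))
    (hF : ∀ τ ∈ Ioo α β, ∀ ψ, |ip ψ (F τ)| ≤ p ψ)
    (hF' : ∀ τ ∈ Ioo α β, ∀ ψ, |ip ψ (F' τ)| ≤ p ψ) (ψ : Sch) {τ : ℝ} (hτ : τ ∈ Ioo α β) :
    HasDerivAt (fun s => ip ψ (F s)) (ip ψ (F' τ)) τ :=
  hasDerivAt_of_tendstoUniformlyOn isOpen_Ioo (tendstoUniformlyOn_ip_trunc hp hF' ψ)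
    (Eventually.of_forall fun n _ hs =>
      hasDerivAt_ip_of_hasCompactSupport hd hc (trunc_hasCompactSupport ψ n) hs)
    (fun _ hs => (tendstoUniformlyOn_ip_trunc hp hF ψ).tendsto_at hs) hτ

lemma continuousOn_ip {F : ℝ → Sch} {α β : ℝ} {p : Sch → ℝ} (hp : Tendsto p (𝓝 0) (𝓝 0))
    (hc : ContinuousOn (fun q : ℝ × ℝ => F q.1 q.2) (Icc α β ×ˢ univ))
    (hF : ∀ τ ∈ Icc α β, ∀ ψ, |ip ψ (F τ)| ≤ p ψ) (ψ : Sch) :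
    ContinuousOn (fun s => ip ψ (F s)) (Icc α β) :=
  (tendstoUniformlyOn_ip_trunc hp hF ψ).continuousOn
    (Eventually.of_forall fun n =>
      continuousOn_ip_of_hasCompactSupport hc (trunc_hasCompactSupport ψ n)).frequently

end LinKdV

namespace LinKdV

open Filter Topology
open scoped ContDiff

lemma nm_D_le {b : ℝ} (hb : 0 < b) (r : ℝ) (f : Sch) : nm b r (D f) ≤ nm b (r + 1 / 2) f := by
  have := nm_mult_le (r := r) (s := r + 1 / 2) hb hb dsym_temperate zero_le_one (fun ξ => ?_) f
  · simpa [D] using this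
  rw [norm_dsym, one_mul, add_comm, ← jsym_mul hb]
  exact mul_le_mul_of_nonneg_right (abs_le_jsym_half b ξ) (jsym_pos hb _ _).le

lemma nm_mono {b r s : ℝ} (hb : 0 < b) (hrs : r ≤ s) (f : Sch) :
    nm b r f ≤ b ^ (2 * (r - s)) * nm b s f := by
  refine nm_le hb hb (by positivity) (fun ξ => ?_) f
  rw [show r = (r - s) + s by ring, ← jsym_mul hb, show r - s + s - s = r - s by ring]
  exact mul_le_mul_of_nonneg_right (jsym_le_rpow hb (by linarith) ξ) (jsym_pos hb _ _).le

lemma nm_change {a b r : ℝ} (hb : 0 < b) (hab : b ≤ a) (hr : 0 ≤ r) (f : Sch) :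
    nm a r f ≤ (a / b) ^ (2 * r) * nm b r f := by
  have ha := hb.trans_le hab
  refine nm_le ha hb (by positivity) (fun ξ => ?_) f
  rw [rpow_mul (by positivity), rpow_two, jsym, jsym, ← mul_rpow (by positivity) (by positivity)]
  apply rpow_le_rpow (by positivity) _ hr
  have h1 : 1 ≤ (a / b) ^ 2 := one_le_pow₀ ((one_le_div hb).2 hab)
  have h2 : (a / b) ^ 2 * b ^ 2 = a ^ 2 := by field_simp
  nlinarith [mul_nonneg (sub_nonneg.2 h1) (sq_nonneg (2 * π * ξ))]

lemma continuous_nm (b r : ℝ) : Continuous (nm b r) :=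
  (continuous_toLp (p := 2) (μ := (volume : Measure ℝ)) (E := ℝ) (F := ℂ)).norm.comp
    (mult (js b r)).continuous

lemma nm_map_zero (b r : ℝ) : nm b r 0 = 0 := by
  have : toLp (0 : Sch) 2 (volume : Measure ℝ) = 0 := map_zero (toLpCLM ℂ ℂ 2 (volume : Measure ℝ))
  rw [nm, map_zero, L2, this, norm_zero]

lemma tendsto_nm_zero (b r : ℝ) : Tendsto (nm b r) (𝓝 0) (𝓝 0) := by
  simpa [nm_map_zero] using (continuous_nm b r).tendsto 0

/-- A weighted sup norm which controls pairings with functions of linear growth. -/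
def wt (ψ : Sch) : ℝ := SchwartzMap.seminorm ℝ 0 0 ψ + SchwartzMap.seminorm ℝ 3 0 ψ

lemma tendsto_wt_zero : Tendsto wt (𝓝 0) (𝓝 0) := by
  have h (k : ℕ) : Continuous (fun ψ : Sch => SchwartzMap.seminorm ℝ k 0 ψ) :=
    (schwartz_withSeminorms ℝ ℝ ℂ).continuous_seminorm (k, 0)
  have := ((h 0).add (h 3)).tendsto 0
  simp only [Pi.add_apply, map_zero, add_zero] at this
  exact this

lemma wt_nonneg (ψ : Sch) : 0 ≤ wt ψ := add_nonneg (apply_nonneg _ _) (apply_nonneg _ _)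

lemma abs_ip_le_wt {f : Sch} {C : ℝ} (hC : 0 ≤ C) (hf : ∀ x, ‖f x‖ ≤ C * (1 + |x|)) (ψ : Sch) :
    |ip ψ f| ≤ 2 * C * π * wt ψ := by
  rw [ip_eq_integral]
  refine (Complex.abs_re_le_norm _).trans ?_
  have hb : ∀ x, ‖(starRingEnd ℂ) (ψ x) * f x‖ ≤ (2 * C * wt ψ) * (1 + x ^ 2)⁻¹ := by
    intro x
    rw [norm_mul, RCLike.norm_conj, ← div_eq_mul_inv, le_div_iff₀ (by positivity)]
    have h0 := norm_le_seminorm ℝ ψ x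
    have h3 := norm_pow_mul_le_seminorm ℝ ψ 3 x
    rw [Real.norm_eq_abs] at h3
    have hy := abs_nonneg x
    have e : (1 + |x|) * (1 + |x| ^ 2) ≤ 2 * (1 + |x| ^ 3) := by
      nlinarith [mul_nonneg (sq_nonneg (1 - |x|)) (add_nonneg zero_le_one hy)]
    have hw : (1 + |x| ^ 3) * ‖ψ x‖ ≤ wt ψ := by rw [wt]; linarith
    calc ‖ψ x‖ * ‖f x‖ * (1 + x ^ 2) ≤ ‖ψ x‖ * (C * (1 + |x|)) * (1 + x ^ 2) := by
          have := hf x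
          gcongr
      _ = C * ‖ψ x‖ * ((1 + |x|) * (1 + |x| ^ 2)) := by rw [sq_abs]; ring
      _ ≤ C * ‖ψ x‖ * (2 * (1 + |x| ^ 3)) := by gcongr
      _ = 2 * C * ((1 + |x| ^ 3) * ‖ψ x‖) := by ring
      _ ≤ 2 * C * wt ψ := by gcongr
  refine (norm_integral_le_of_norm_le (integrable_inv_one_add_sq.const_mul _)
    (Eventually.of_forall hb)).trans ?_
  rw [integral_const_mul, integral_univ_inv_one_add_sq]
  exact le_of_eq (by ring)

lemma tendsto_wt_D (k : ℕ) : Tendsto (fun ψ => wt (D^[k] ψ)) (𝓝 0) (𝓝 0) := by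
  have h : Tendsto (fun ψ : Sch => D^[k] ψ) (𝓝 0) (𝓝 (D^[k] 0)) :=
    (D.continuous.iterate k).tendsto 0
  rw [iterate_map_zero] at h
  exact tendsto_wt_zero.comp h

/-- The right-hand side of the linearized equation. -/
def zrhs (u z : Sch) : Sch := -D (D (D z)) + (6 : ℝ) • D (mulS u z)

/-- The right-hand side of the Korteweg-de Vries equation. -/
def urhs (u : Sch) : Sch := -D (D (D u)) + (6 : ℝ) • mulS u (D u)

lemma ip_rsmul_right (c : ℝ) (f g : Sch) : ip f (c • g) = c * ip f g := by
  rw [← ip_smul_right]; congr 1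

lemma ip_D_right (f g : Sch) : ip f (D g) = -ip (D f) g := by rw [ip_D_left, neg_neg]

lemma ip_zrhs (ψ u z : Sch) :
    ip ψ (zrhs u z) = ip (D (D (D ψ))) z - 6 * ip (D ψ) (mulS u z) := by
  rw [zrhs, ip_add_right, ip_neg_right, ip_rsmul_right, ip_D_right, ip_D_right, ip_D_right,
    ip_D_right]
  ring

lemma D_mulS_self (u : Sch) : D (mulS u u) = (2 : ℝ) • mulS u (D u) := by
  rw [D_mulS, mulS_comm, two_smul]

lemma ip_urhs (ψ u : Sch) :
    ip ψ (urhs u) = ip (D (D (D ψ))) u - 3 * ip (D ψ) (mulS u u) := by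
  have h : ip ψ (D (mulS u u)) = 2 * ip ψ (mulS u (D u)) := by rw [D_mulS_self, ip_rsmul_right]
  rw [ip_D_right] at h
  rw [urhs, ip_add_right, ip_neg_right, ip_rsmul_right, ip_D_right, ip_D_right, ip_D_right]
  linarith

lemma ip_sq_rhs (ψ u : Sch) :
    ip ψ ((2 : ℝ) • mulS u (urhs u)) = ip (D (D (D ψ))) (mulS u u)
      - 3 * ip (D ψ) (mulS (D u) (D u)) - 4 * ip (D ψ) (mulS (mulS u u) u) := by
  have e : (2 : ℝ) • mulS u (urhs u) = -D (D (D (mulS u u))) + (3 : ℝ) • D (mulS (D u) (D u))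
      + (4 : ℝ) • D (mulS (mulS u u) u) := by
    have h1 : D (mulS u u) = (2 : ℝ) • mulS u (D u) := D_mulS_self u
    ext x
    simp only [urhs, D_mulS, map_add, add_apply, neg_apply, smul_apply, mulS_apply,
      Complex.real_smul]
    push_cast
    ring
  rw [e, ip_add_right, ip_add_right, ip_neg_right, ip_rsmul_right, ip_rsmul_right, ip_D_right,
    ip_D_right, ip_D_right, ip_D_right ψ (mulS (D u) (D u)), ip_D_right ψ (mulS (mulS u u) u)]
  ring

lemma exists_abs_ip_zrhs_le {b T m κ : ℝ} (hb : 0 < b) (hm : 0 ≤ m) (hκ : 0 ≤ κ)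
    (hT : 0 < T) (hbT : b ≤ T ^ (-(1 / 3) : ℝ)) :
    ∃ C : ℝ, 0 ≤ C ∧ ∀ τ, 0 < τ → τ ≤ T → ∀ u z ψ : Sch, IsRealV u →
      (∀ f, nm (τ ^ (-(1 / 3) : ℝ)) (1 / 4) (mulS u f) ≤
        κ * m * τ ^ (-(1 / 3) : ℝ) * nm (τ ^ (-(1 / 3) : ℝ)) (1 / 4) f) →
      |ip ψ (zrhs u z)| ≤ C * (√τ)⁻¹ * nm b 2 ψ * nm b (-(1 / 4)) z := by
  set c₁ : ℝ := b ^ (2 * (7 / 4 - 2) : ℝ) with hc₁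
  set c₂ : ℝ := b ^ (2 * (3 / 4 - 2) : ℝ) with hc₂
  refine ⟨c₁ * √T + 6 * (κ * m) * (√b)⁻¹ * c₂, by positivity, ?_⟩
  intro τ hτ hτT u z ψ hu hK
  set a : ℝ := τ ^ (-(1 / 3) : ℝ) with ha
  have ha0 : 0 < a := rpow_pos_of_pos hτ _
  have hba : b ≤ a := hbT.trans (rpow_le_rpow_of_nonpos hτ hτT (by norm_num))
  have hK' := nm_mulS_neg_le ha0 (by positivity) hu hK z
  have ht : √a * a = (√τ)⁻¹ := by
    rw [ha, sqrt_eq_rpow, sqrt_eq_rpow, ← rpow_neg hτ.le, ← rpow_mul hτ.le, ← rpow_add hτ]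
    norm_num
  have hN := nm_nonneg b (-(1 / 4)) z
  have hP := nm_nonneg b 2 ψ
  have h1 : |ip (D (D (D ψ))) z| ≤ c₁ * nm b 2 ψ * nm b (-(1 / 4)) z := by
    refine (abs_ip_le_nm hb (1 / 4) _ _).trans (mul_le_mul_of_nonneg_right ?_ hN)
    refine (nm_D_le hb _ _).trans <| (nm_D_le hb _ _).trans <| (nm_D_le hb _ _).trans ?_
    rw [show (1 / 4 + 1 / 2 + 1 / 2 + 1 / 2 : ℝ) = 7 / 4 by norm_num]
    exact nm_mono hb (by norm_num) ψ
  have h2 : |ip (D ψ) (mulS u z)| ≤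
      (κ * m) * (√b)⁻¹ * c₂ * (√τ)⁻¹ * nm b 2 ψ * nm b (-(1 / 4)) z := by
    have e1 : nm a (1 / 4) (D ψ) ≤ √a * (√b)⁻¹ * (c₂ * nm b 2 ψ) := by
      refine (nm_change hb hba (by norm_num) _).trans ?_
      rw [show (2 * (1 / 4) : ℝ) = 1 / 2 by norm_num, ← sqrt_eq_rpow, sqrt_div ha0.le,
        div_eq_mul_inv]
      refine mul_le_mul_of_nonneg_left ((nm_D_le hb _ _).trans ?_) (by positivity)
      rw [show (1 / 4 + 1 / 2 : ℝ) = 3 / 4 by norm_num]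
      exact nm_mono hb (by norm_num) ψ
    calc _ ≤ nm a (1 / 4) (D ψ) * nm a (-(1 / 4)) (mulS u z) := abs_ip_le_nm ha0 _ _ _
      _ ≤ (√a * (√b)⁻¹ * (c₂ * nm b 2 ψ)) * (κ * m * a * nm b (-(1 / 4)) z) := by
          refine mul_le_mul e1 (hK'.trans ?_) (nm_nonneg _ _ _) (by positivity)
          exact mul_le_mul_of_nonneg_left (nm_anti hb hba (by norm_num) z) (by positivity)
      _ = (κ * m) * (√b)⁻¹ * c₂ * (√a * a) * nm b 2 ψ * nm b (-(1 / 4)) z := by ring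
      _ = _ := by rw [ht]
  have h3 : 1 ≤ √T * (√τ)⁻¹ := by
    rw [← div_eq_mul_inv, one_le_div (sqrt_pos.2 hτ)]
    exact sqrt_le_sqrt hτT
  rw [ip_zrhs]
  calc _ ≤ |ip (D (D (D ψ))) z| + 6 * |ip (D ψ) (mulS u z)| := by
        refine (abs_sub _ _).trans ?_
        rw [abs_mul, abs_of_pos (by norm_num : (0 : ℝ) < 6)]
    _ ≤ c₁ * nm b 2 ψ * nm b (-(1 / 4)) z * (√T * (√τ)⁻¹) +
        6 * ((κ * m) * (√b)⁻¹ * c₂ * (√τ)⁻¹ * nm b 2 ψ * nm b (-(1 / 4)) z) := by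
        refine add_le_add (h1.trans (le_mul_of_one_le_right (by positivity) h3)) (by linarith)
    _ = _ := by ring

end LinKdV

namespace LinKdV

open Filter Topology
open scoped ContDiff

/-- The properties of a potential `U` and of a solution `Z` of the linearized equation on `[0, T]`
which are used in the energy argument. -/
structure Evo (T m κ : ℝ) (Z U : ℝ → Sch) : Prop where
  T_pos : 0 < T
  m_nonneg : 0 ≤ m
  one_le : 1 ≤ κ
  real : ∀ τ ∈ Icc 0 T, IsRealV (U τ)
  cont_z : ContinuousOn (fun q : ℝ × ℝ => Z q.1 q.2) (Icc 0 T ×ˢ univ)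
  deriv_z : ∀ τ ∈ Ioo 0 T, ∀ x, HasDerivAt (fun s => Z s x) (zrhs (U τ) (Z τ) x) τ
  cont_dz : ContinuousOn (fun q : ℝ × ℝ => zrhs (U q.1) (Z q.1) q.2) (Ioo 0 T ×ˢ univ)
  cont_u : ContinuousOn (fun q : ℝ × ℝ => U q.1 q.2) (Ioo 0 T ×ˢ univ)
  deriv_u : ∀ τ ∈ Ioo 0 T, ∀ x, HasDerivAt (fun s => U s x) (urhs (U τ) x) τ
  cont_du : ContinuousOn (fun q : ℝ × ℝ => urhs (U q.1) q.2) (Ioo 0 T ×ˢ univ)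
  bound : ∀ s t, 0 < s → s ≤ t → t ≤ 2 * s → t ≤ T →
    (∀ x, ‖U t x‖ ≤ m * s ^ (-(1 / 3) : ℝ)) ∧
    ∀ f, nm (s ^ (-(1 / 3) : ℝ)) (1 / 4) (mulS (U t) f) ≤
      κ * m * s ^ (-(1 / 3) : ℝ) * nm (s ^ (-(1 / 3) : ℝ)) (1 / 4) f
  grow : ∀ α, 0 < α → ∃ C : ℝ, 0 ≤ C ∧ ∀ τ ∈ Icc α T, ∀ x, ‖D (U τ) x‖ ^ 2 ≤ C * (1 + |x|)

variable {T m κ b s t N : ℝ} {Z U : ℝ → Sch}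

lemma Evo.norm_u_le (h : Evo T m κ Z U) {α τ : ℝ} (hα : 0 < α) (hτ : τ ∈ Icc α T) (x : ℝ) :
    ‖U τ x‖ ≤ m * α ^ (-(1 / 3) : ℝ) := by
  have hτ0 := hα.trans_le hτ.1
  refine ((h.bound τ τ hτ0 le_rfl (by linarith) hτ.2).1 x).trans ?_
  exact mul_le_mul_of_nonneg_left (rpow_le_rpow_of_nonpos hα hτ.1 (by norm_num)) h.m_nonneg

lemma Evo.exists_abs_ip_zrhs_le (h : Evo T m κ Z U) (hb : 0 < b) (hbT : b ≤ T ^ (-(1 / 3) : ℝ)) :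
    ∃ C : ℝ, 0 ≤ C ∧ ∀ τ, 0 < τ → τ ≤ T → ∀ ψ,
      |ip ψ (zrhs (U τ) (Z τ))| ≤ C * (√τ)⁻¹ * nm b 2 ψ * nm b (-(1 / 4)) (Z τ) := by
  obtain ⟨C, hC, H⟩ := LinKdV.exists_abs_ip_zrhs_le hb h.m_nonneg (zero_le_one.trans h.one_le)
    h.T_pos hbT
  exact ⟨C, hC, fun τ h0 h1 ψ => H τ h0 h1 _ _ ψ (h.real τ ⟨h0.le, h1⟩)
    (h.bound τ τ h0 le_rfl (by linarith) h1).2⟩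

lemma abs_ip_le_nm_two (hb : 0 < b) {z : Sch} (hz : nm b (-(1 / 4)) z ≤ N) (ψ : Sch) :
    |ip ψ z| ≤ b ^ (2 * (1 / 4 - 2) : ℝ) * nm b 2 ψ * N :=
  (abs_ip_le_nm hb (1 / 4) ψ z).trans (mul_le_mul (nm_mono hb (by norm_num) ψ) hz (nm_nonneg _ _ _)
    (mul_nonneg (by positivity) (nm_nonneg _ _ _)))

lemma Evo.continuousOn_ip_z (h : Evo T m κ Z U) (hb : 0 < b) (hs : 0 ≤ s) (ht : t ≤ T)
    (hN : ∀ τ ∈ Icc s t, nm b (-(1 / 4)) (Z τ) ≤ N) (ψ : Sch) :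
    ContinuousOn (fun τ => ip ψ (Z τ)) (Icc s t) := by
  refine continuousOn_ip (p := fun ψ => b ^ (2 * (1 / 4 - 2) : ℝ) * nm b 2 ψ * N) ?_
    (h.cont_z.mono (prod_mono (Icc_subset_Icc hs ht) le_rfl))
    (fun τ hτ ψ => abs_ip_le_nm_two hb (hN τ hτ) ψ) ψ
  simpa using ((tendsto_nm_zero b 2).const_mul (b ^ (2 * (1 / 4 - 2) : ℝ))).mul_const N

lemma Evo.hasDerivAt_ip_z (h : Evo T m κ Z U) (hb : 0 < b) (hbT : b ≤ T ^ (-(1 / 3) : ℝ))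
    (hs : 0 ≤ s) (ht : t ≤ T) (hN : ∀ τ ∈ Icc s t, nm b (-(1 / 4)) (Z τ) ≤ N) (ψ : Sch)
    {τ : ℝ} (hτ : τ ∈ Ioo s t) :
    HasDerivAt (fun σ => ip ψ (Z σ)) (ip ψ (zrhs (U τ) (Z τ))) τ := by
  obtain ⟨C, hC, H⟩ := h.exists_abs_ip_zrhs_le hb hbT
  set α := (s + τ) / 2 with hα
  have hsα : s < α := by linarith [hτ.1]
  have hα0 : 0 < α := hs.trans_lt hsα
  have hN0 : 0 ≤ N := (nm_nonneg _ _ _).trans (hN τ (Ioo_subset_Icc_self hτ))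
  have hsub : ∀ σ ∈ Ioo α t, σ ∈ Icc s t := fun σ hσ => ⟨hsα.le.trans hσ.1.le, hσ.2.le⟩
  have hsubT : Ioo α t ⊆ Ioo 0 T := Ioo_subset_Ioo hα0.le ht
  refine hasDerivAt_ip (α := α) (β := t)
    (p := fun ψ => b ^ (2 * (1 / 4 - 2) : ℝ) * nm b 2 ψ * N + C * (√α)⁻¹ * nm b 2 ψ * N) ?_
    (fun σ hσ => h.deriv_z σ (hsubT hσ)) (h.cont_dz.mono (prod_mono hsubT le_rfl)) ?_ ?_ ψ
    ⟨by linarith [hτ.1], hτ.2⟩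
  · simpa using (((tendsto_nm_zero b 2).const_mul (b ^ (2 * (1 / 4 - 2) : ℝ))).mul_const N).add
      (((tendsto_nm_zero b 2).const_mul (C * (√α)⁻¹)).mul_const N)
  · intro σ hσ ψ
    refine (abs_ip_le_nm_two hb (hN σ (hsub σ hσ)) ψ).trans (le_add_of_nonneg_right ?_)
    exact mul_nonneg (mul_nonneg (by positivity) (nm_nonneg _ _ _)) hN0
  · intro σ hσ ψ
    refine (H σ (hα0.trans hσ.1) (hσ.2.le.trans ht) ψ).trans (le_add_of_nonneg_of_le
      (mul_nonneg (mul_nonneg (by positivity) (nm_nonneg _ _ _)) hN0) ?_)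
    have hP := nm_nonneg b 2 ψ
    have e : (√σ)⁻¹ ≤ (√α)⁻¹ := inv_anti₀ (sqrt_pos.2 hα0) (sqrt_le_sqrt hσ.1.le)
    exact mul_le_mul (by gcongr) (hN σ (hsub σ hσ)) (nm_nonneg _ _ _) (by positivity)

lemma mult_js_js (hb : 0 < b) (r q : ℝ) (f : Sch) :
    mult (js b r) (mult (js b q) f) = mult (js b (r + q)) f := by
  rw [mult_mult (js_temperate hb r) (js_temperate hb q)]
  simp_rw [js_mul hb]

lemma nm_sq_eq_ip (hb : 0 < b) (r : ℝ) (f : Sch) :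
    nm b r f ^ 2 = ip f (mult (js b (2 * r)) f) := by
  rw [nm, ← ip_self, two_mul, ← mult_js_js hb]
  exact ip_mult_left_real (js_temperate hb r) _ _

lemma nm_interp (hb : 0 < b) (r q : ℝ) (f : Sch) :
    nm b r f ^ 2 ≤ nm b q f * nm b (2 * r - q) f := by
  rw [nm_sq_eq_ip hb]
  refine (le_abs_self _).trans ((abs_ip_le_nm hb q _ _).trans (le_of_eq ?_))
  rw [nm, nm, nm, mult_js_js hb]
  ring_nf

lemma Evo.exists_holder (h : Evo T m κ Z U) (hb : 0 < b) (hbT : b ≤ T ^ (-(1 / 3) : ℝ)) :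
    ∃ C : ℝ, 0 ≤ C ∧ ∀ s t N, 0 ≤ s → t ≤ T → (∀ τ ∈ Icc s t, nm b (-(1 / 4)) (Z τ) ≤ N) →
      ∀ τ ∈ Icc s t, ∀ σ ∈ Icc τ t, nm b (-2) (Z σ - Z τ) ≤ C * N * (√σ - √τ) := by
  obtain ⟨C, hC, H⟩ := h.exists_abs_ip_zrhs_le hb hbT
  refine ⟨2 * C, by positivity, ?_⟩
  intro s t N hs ht hN τ hτ σ hσ
  have hN0 : 0 ≤ N := (nm_nonneg _ _ _).trans (hN τ hτ)
  have hst : s ≤ t := hτ.1.trans hτ.2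
  set δ := Z σ - Z τ with hδ
  set ψ := mult (js b (2 * (-2))) δ with hψ
  have hψ2 : nm b 2 ψ = nm b (-2) δ := by
    rw [nm, hψ, mult_js_js hb, nm]; norm_num
  set P := nm b (-2) δ with hP
  have hP0 : 0 ≤ P := nm_nonneg _ _ _
  have hanti : AntitoneOn (fun x => ip ψ (Z x) - 2 * C * N * P * √x) (Icc s t) := by
    have hd : ∀ x ∈ Ioo s t, HasDerivAt (fun x => ip ψ (Z x) - 2 * C * N * P * √x)
        (ip ψ (zrhs (U x) (Z x)) - 2 * C * N * P * (1 / (2 * √x))) x := fun x hx =>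
      (h.hasDerivAt_ip_z hb hbT hs ht hN ψ hx).sub
        ((hasDerivAt_sqrt (hs.trans_lt hx.1).ne').const_mul _)
    refine antitoneOn_of_deriv_nonpos (convex_Icc s t)
      ((h.continuousOn_ip_z hb hs ht hN ψ).sub (by fun_prop)) ?_ ?_
    · rw [interior_Icc]
      exact fun x hx => (hd x hx).differentiableAt.differentiableWithinAt
    · rw [interior_Icc]
      intro x hx
      rw [(hd x hx).deriv]
      have h0 : 0 < √x := sqrt_pos.2 (hs.trans_lt hx.1)
      have h1 := (le_abs_self _).trans (H x (hs.trans_lt hx.1) (hx.2.le.trans ht) ψ)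
      rw [hψ2] at h1
      have h2 : C * (√x)⁻¹ * P * nm b (-(1 / 4)) (Z x) ≤ C * (√x)⁻¹ * P * N :=
        mul_le_mul_of_nonneg_left (hN x (Ioo_subset_Icc_self hx)) (by positivity)
      have h3 : 2 * C * N * P * (1 / (2 * √x)) = C * (√x)⁻¹ * P * N := by field_simp
      linarith
  have h1 := hanti hτ ⟨hτ.1.trans hσ.1, hσ.2⟩ hσ.1
  have h2 : P ^ 2 = ip ψ (Z σ) - ip ψ (Z τ) := by
    rw [hP, nm_sq_eq_ip hb, ← ip_sub_right, ip_comm]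
  have h3 : P ^ 2 ≤ 2 * C * N * (√σ - √τ) * P := by
    simp only at h1
    rw [h2]; linarith
  rcases hP0.eq_or_lt with h0 | h0
  · rw [← h0]
    exact mul_nonneg (by positivity) (sub_nonneg.2 (sqrt_le_sqrt hσ.1))
  · exact le_of_mul_le_mul_right (by rw [← sq]; exact h3) h0

lemma tendsto_zero_of_sq_le {ι : Type*} {l : Filter ι} {f g : ι → ℝ} {C : ℝ}
    (hf : ∀ i, 0 ≤ f i) (hfg : ∀ᶠ i in l, f i ^ 2 ≤ C * g i) (hg : Tendsto g l (𝓝 0)) :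
    Tendsto f l (𝓝 0) := by
  have h : Tendsto (fun i => √(C * g i)) l (𝓝 0) := by
    have := (continuous_sqrt.tendsto _).comp (hg.const_mul C)
    rw [mul_zero, sqrt_zero] at this
    exact this
  refine tendsto_of_tendsto_of_tendsto_of_le_of_le' tendsto_const_nhds h
    (Eventually.of_forall hf) ?_
  filter_upwards [hfg] with i hi
  exact le_sqrt_of_sq_le hi

lemma nm_neg (c r : ℝ) (f : Sch) : nm c r (-f) = nm c r f := by
  rw [nm, nm, map_neg, L2_neg]

/-- Solutions which are bounded in a negative Sobolev space are continuous in time with values in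
a slightly weaker space. -/
lemma Evo.tendsto_z (h : Evo T m κ Z U) (hb : 0 < b) (hbT : b ≤ T ^ (-(1 / 3) : ℝ))
    (hs : 0 ≤ s) (ht : t ≤ T) (hN : ∀ τ ∈ Icc s t, nm b (-(1 / 4)) (Z τ) ≤ N)
    {τ : ℝ} (hτ : τ ∈ Icc s t) :
    Tendsto (fun σ => nm b (-(1 / 2)) (Z σ - Z τ)) (𝓝[Icc s t] τ) (𝓝 0) := by
  obtain ⟨C, hC, H⟩ := h.exists_holder hb hbT
  have hN0 : 0 ≤ N := (nm_nonneg _ _ _).trans (hN τ hτ)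
  have h0 : ∀ σ ∈ Icc s t, nm b (-2) (Z σ - Z τ) ≤ C * N * |√σ - √τ| := by
    intro σ hσ
    rcases le_total τ σ with hle | hle
    · exact (H s t N hs ht hN τ hτ σ ⟨hle, hσ.2⟩).trans
        (mul_le_mul_of_nonneg_left (le_abs_self _) (by positivity))
    · rw [← nm_neg, neg_sub, abs_sub_comm]
      exact (H s t N hs ht hN σ hσ τ ⟨hle, hτ.2⟩).trans
        (mul_le_mul_of_nonneg_left (le_abs_self _) (by positivity))
  have ht0 : Tendsto (fun σ => |√σ - √τ|) (𝓝[Icc s t] τ) (𝓝 0) := by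
    have : Continuous fun σ => |√σ - √τ| := by fun_prop
    have h2 := (this.tendsto τ).mono_left (nhdsWithin_le_nhds (s := Icc s t))
    simpa using h2
  have hN2 : ∀ σ ∈ Icc s t, nm b (-(1 / 4)) (Z σ - Z τ) ≤ 2 * N := fun σ hσ =>
    (nm_sub_le _ _ _ _).trans (by linarith [hN σ hσ, hN τ hτ])
  have hstep : ∀ r : ℝ,
      Tendsto (fun σ => nm b (2 * r - -(1 / 4)) (Z σ - Z τ)) (𝓝[Icc s t] τ) (𝓝 0) →
      Tendsto (fun σ => nm b r (Z σ - Z τ)) (𝓝[Icc s t] τ) (𝓝 0) := by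
    intro r hr
    refine tendsto_zero_of_sq_le (C := 2 * N) (fun σ => nm_nonneg _ _ _) ?_ hr
    filter_upwards [self_mem_nhdsWithin] with σ hσ
    exact (nm_interp hb r (-(1 / 4)) _).trans
      (mul_le_mul_of_nonneg_right (hN2 σ hσ) (nm_nonneg _ _ _))
  apply hstep
  apply hstep
  apply hstep
  have e : (2 * (2 * (2 * -(1 / 2) - -(1 / 4)) - -(1 / 4)) - -(1 / 4) : ℝ) = -(9 / 4) := by norm_num
  rw [e]
  have h1 := (ht0.const_mul (C * N)).const_mul (b ^ (2 * (-(9 / 4) - -2) : ℝ))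
  rw [mul_zero, mul_zero] at h1
  refine tendsto_of_tendsto_of_tendsto_of_le_of_le' tendsto_const_nhds h1
    (Eventually.of_forall fun σ => nm_nonneg _ _ _) ?_
  filter_upwards [self_mem_nhdsWithin] with σ hσ
  refine (nm_mono (s := -2) hb (by norm_num) _).trans ?_
  exact mul_le_mul_of_nonneg_left (h0 σ hσ) (by positivity)

lemma norm_le_mul_one_add {x y V : ℝ} (hV : 0 ≤ V) (hy : y ≤ V) : y ≤ V * (1 + |x|) :=
  hy.trans (le_mul_of_one_le_right hV (by linarith [abs_nonneg x]))

lemma Evo.hasDerivAt_ip_u (h : Evo T m κ Z U) (ψ : Sch) {τ : ℝ} (hτ : τ ∈ Ioo 0 T) :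
    HasDerivAt (fun σ => ip ψ (U σ)) (ip ψ (urhs (U τ))) τ ∧
    HasDerivAt (fun σ => ip ψ (mulS (U σ) (U σ))) (ip ψ ((2 : ℝ) • mulS (U τ) (urhs (U τ)))) τ := by
  set α := τ / 2 with hα
  have hα0 : 0 < α := half_pos hτ.1
  have hατ : α < τ := half_lt_self hτ.1
  set V := m * α ^ (-(1 / 3) : ℝ) with hV
  have hV0 : 0 ≤ V := mul_nonneg h.m_nonneg (by positivity)
  obtain ⟨C, hC, hg⟩ := h.grow α hα0
  have hsub : ∀ σ ∈ Ioo α T, σ ∈ Icc α T := fun σ hσ => Ioo_subset_Icc_self hσ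
  have hsubT : Ioo α T ⊆ Ioo 0 T := Ioo_subset_Ioo hα0.le le_rfl
  have b1 : ∀ σ ∈ Ioo α T, ∀ ψ, |ip ψ (U σ)| ≤ 2 * V * π * wt ψ := fun σ hσ ψ =>
    abs_ip_le_wt hV0 (fun x => norm_le_mul_one_add hV0 (h.norm_u_le hα0 (hsub σ hσ) x)) ψ
  have b2 : ∀ σ ∈ Ioo α T, ∀ ψ, |ip ψ (mulS (U σ) (U σ))| ≤ 2 * (V * V) * π * wt ψ :=
    fun σ hσ ψ => abs_ip_le_wt (by positivity) (fun x => norm_le_mul_one_add (by positivity) (by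
      have := h.norm_u_le hα0 (hsub σ hσ) x
      rw [mulS_apply, norm_mul]; gcongr)) ψ
  have b3 : ∀ σ ∈ Ioo α T, ∀ ψ, |ip ψ (mulS (mulS (U σ) (U σ)) (U σ))| ≤
      2 * (V * V * V) * π * wt ψ :=
    fun σ hσ ψ => abs_ip_le_wt (by positivity) (fun x => norm_le_mul_one_add (by positivity) (by
      have := h.norm_u_le hα0 (hsub σ hσ) x
      rw [mulS_apply, mulS_apply, norm_mul, norm_mul]; gcongr)) ψ
  have b4 : ∀ σ ∈ Ioo α T, ∀ ψ, |ip ψ (mulS (D (U σ)) (D (U σ)))| ≤ 2 * C * π * wt ψ :=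
    fun σ hσ ψ => abs_ip_le_wt hC (fun x => by
      rw [mulS_apply, norm_mul, ← sq]; exact hg σ (hsub σ hσ) x) ψ
  have w1 := tendsto_wt_zero
  have w2 := tendsto_wt_D 1
  have w3 := tendsto_wt_D 3
  have n1 := wt_nonneg
  have hπ := pi_pos
  have b0 (A B B' : ℝ) (x y w : ℝ) (hx : |x| ≤ A) (hy : |y| ≤ B) (hw : |w| ≤ B') :
      |x - 3 * y - 4 * w| ≤ A + 3 * B + 4 * B' := by
    rw [abs_le] at *
    constructor <;> linarith
  constructor
  · refine hasDerivAt_ip (α := α) (β := T) (p := fun ψ => 2 * V * π * wt ψ +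
      (2 * V * π * wt (D^[3] ψ) + 3 * (2 * (V * V) * π * wt (D^[1] ψ)) + 4 * 0)) ?_
      (fun σ hσ => h.deriv_u σ (hsubT hσ)) (h.cont_du.mono (prod_mono hsubT le_rfl)) ?_ ?_ ψ
      ⟨hατ, hτ.2⟩
    · simpa using (w1.const_mul (2 * V * π)).add
        ((w3.const_mul (2 * V * π)).add ((w2.const_mul (2 * (V * V) * π)).const_mul 3))
    · intro σ hσ ψ
      have h1 := n1 (D^[3] ψ)
      have h2 := n1 (D^[1] ψ)
      exact (b1 σ hσ ψ).trans (le_add_of_nonneg_right (by positivity))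
    · intro σ hσ ψ
      have h1 := n1 ψ
      refine le_add_of_nonneg_of_le (by positivity) ?_
      have := b0 _ _ _ _ _ _ (b1 σ hσ (D (D (D ψ)))) (b2 σ hσ (D ψ)) (abs_zero.le)
      rw [ip_urhs]
      rw [mul_zero (4 : ℝ), sub_zero] at this
      refine this.trans_eq ?_
      rw [mul_zero (4 : ℝ)]; rfl
  · refine hasDerivAt_ip (F := fun σ => mulS (U σ) (U σ))
      (F' := fun σ => (2 : ℝ) • mulS (U σ) (urhs (U σ))) (α := α) (β := T)
      (p := fun ψ => 2 * (V * V) * π * wt ψ +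
      (2 * (V * V) * π * wt (D^[3] ψ) + 3 * (2 * C * π * wt (D^[1] ψ)) +
        4 * (2 * (V * V * V) * π * wt (D^[1] ψ)))) ?_ ?_ ?_ ?_ ?_ ψ ⟨hατ, hτ.2⟩
    · simpa using (w1.const_mul (2 * (V * V) * π)).add
        (((w3.const_mul (2 * (V * V) * π)).add ((w2.const_mul (2 * C * π)).const_mul 3)).add
          ((w2.const_mul (2 * (V * V * V) * π)).const_mul 4))
    · intro σ hσ x
      have hd := h.deriv_u σ (hsubT hσ) x
      have := hd.mul hd
      simp only [mulS_apply, smul_apply, Complex.real_smul]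
      refine this.congr_deriv ?_
      push_cast; ring
    · have h1 := (h.cont_u.mul h.cont_du).const_smul (2 : ℝ)
      refine (h1.mono (prod_mono hsubT le_rfl)).congr fun q _ => ?_
      simp [mulS_apply]
    · intro σ hσ ψ
      have h1 := n1 (D^[3] ψ)
      have h2 := n1 (D^[1] ψ)
      exact (b2 σ hσ ψ).trans (le_add_of_nonneg_right (by positivity))
    · intro σ hσ ψ
      have h1 := n1 ψ
      refine le_add_of_nonneg_of_le (by positivity) ?_
      rw [ip_sq_rhs]
      exact b0 _ _ _ _ _ _ (b2 σ hσ (D (D (D ψ)))) (b4 σ hσ (D ψ)) (b3 σ hσ (D ψ))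

/-- The squared modulus of a Schwartz function. -/
def sqS (ρ : Sch) : Sch := smulLeftCLM ℂ (fun x => (starRingEnd ℂ) (ρ x)) ρ

lemma sqS_apply (ρ : Sch) (x : ℝ) : sqS ρ x = (starRingEnd ℂ) (ρ x) * ρ x := by
  rw [sqS, smulLeftCLM_apply_apply (HasTemperateGrowth_conj ρ.hasTemperateGrowth), smul_eq_mul]

lemma L2_mulS_sq {v : Sch} (hv : IsRealV v) (ρ : Sch) :
    L2 (mulS v ρ) ^ 2 = ip (sqS ρ) (mulS v v) := by
  rw [← ip_self, ip_eq_integral, ip_eq_integral]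
  congr 2; ext x
  rw [mulS_apply, mulS_apply, sqS_apply, map_mul, map_mul, hv x, Complex.conj_conj]; ring

lemma IsRealV.sub {v w : Sch} (hv : IsRealV v) (hw : IsRealV w) : IsRealV (v - w) := fun x => by
  rw [sub_apply, map_sub, hv x, hw x]

lemma Evo.eventually_L2_mulS_sub_le (h : Evo T m κ Z U) (ρ : Sch) {τ η : ℝ} (hτ : τ ∈ Ioo 0 T)
    (hη : 0 < η) :
    ∀ᶠ σ in 𝓝 τ, L2 (mulS (U σ - U τ) ρ) ^ 2 ≤ η * |σ - τ| := by
  have hr := h.real τ (Ioo_subset_Icc_self hτ)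
  have h1 := (h.hasDerivAt_ip_u (sqS ρ) hτ).2
  have h2 := (h.hasDerivAt_ip_u (mulS (U τ) (sqS ρ)) hτ).1
  have h3 := h1.sub (h2.const_mul 2)
  have e : ip (sqS ρ) ((2 : ℝ) • mulS (U τ) (urhs (U τ))) -
      2 * ip (mulS (U τ) (sqS ρ)) (urhs (U τ)) = 0 := by
    rw [ip_rsmul_right, ip_mulS hr, sub_self]
  rw [e, hasDerivAt_iff_isLittleO] at h3
  filter_upwards [h3.def hη, Ioo_mem_nhds hτ.1 hτ.2] with σ hσ hσT
  rw [L2_mulS_sq ((h.real σ (Ioo_subset_Icc_self hσT)).sub hr)]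
  simp only [smul_zero, sub_zero, Real.norm_eq_abs, Pi.sub_apply] at hσ
  refine le_trans (le_of_eq ?_) ((le_abs_self _).trans hσ)
  rw [map_sub, mulS_sub_left, mulS_sub_left, mulS_comm (U σ) (U τ), ip_mulS hr, ip_mulS hr]
  simp only [ip_sub_right]
  ring

end LinKdV

namespace LinKdV

open Filter Topology

variable {T m κ a b r s t N W : ℝ} {n : ℕ} {Z U : ℝ → Sch}

/-- A one-sided version of the mean value inequality for functions whose increments are bounded
below to first order. -/
lemma sub_le_of_eventually_slope {g : ℝ → ℝ} {c d Q : ℝ} (hcd : c ≤ d)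
    (hg : ContinuousOn g (Icc c d))
    (h : ∀ τ ∈ Ico c d, ∀ η > 0, ∀ᶠ σ in 𝓝[>] τ, g σ - g τ ≤ (Q + η) * (σ - τ)) :
    g d - g c ≤ Q * (d - c) := by
  have key : ∀ η > 0, g d - g c ≤ (Q + η) * (d - c) := by
    intro η hη
    have hB : ∀ x, HasDerivAt (fun x => g c + (Q + η) * (x - c)) (Q + η) x := fun x => by
      simpa using (((hasDerivAt_id x).sub_const c).const_mul (Q + η)).const_add (g c)
    have := image_le_of_liminf_slope_right_lt_deriv_boundary' (f := g) (f' := fun _ => Q + η / 2)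
      (a := c) (b := d) hg ?_ (B := fun x => g c + (Q + η) * (x - c)) (B' := fun _ => Q + η)
      (by simp) (by fun_prop) (fun x _ => (hB x).hasDerivWithinAt) (fun x _ _ => by linarith)
      (right_mem_Icc.2 hcd)
    · linarith
    · intro x hx q hq
      have h1 := h x hx ((q - Q) / 2 - η / 4) (by linarith)
      refine Eventually.frequently ?_
      filter_upwards [h1, self_mem_nhdsWithin] with σ hσ hσx
      have h2 : 0 < σ - x := sub_pos.2 hσx
      rw [slope_def_field, div_lt_iff₀ h2]
      nlinarith
  refine le_of_forall_pos_le_add fun e he => ?_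
  have hdc : 0 ≤ d - c := sub_nonneg.2 hcd
  have := key (e / (d - c + 1)) (by positivity)
  have h3 : e / (d - c + 1) * (d - c) ≤ e := by
    rw [div_mul_eq_mul_div, div_le_iff₀ (by positivity)]
    nlinarith
  nlinarith

lemma abs_sub_le_of_eventually_ge {f : ℝ → ℝ} {c d Q : ℝ} (hcd : c ≤ d)
    (hf : ContinuousOn f (Icc c d))
    (h : ∀ τ ∈ Icc c d, ∀ η > 0, ∀ᶠ σ in 𝓝 τ, f τ - f σ ≤ (Q + η) * |σ - τ|) :
    |f d - f c| ≤ Q * (d - c) := by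
  have h1 : f c - f d ≤ Q * (d - c) := by
    have := sub_le_of_eventually_slope (g := fun x => -f x) (Q := Q) hcd hf.neg ?_
    · linarith
    · intro τ hτ η hη
      filter_upwards [(h τ (Ico_subset_Icc_self hτ) η hη).filter_mono nhdsWithin_le_nhds,
        self_mem_nhdsWithin] with σ hσ hτσ
      rw [abs_of_pos (sub_pos.2 hτσ)] at hσ
      linarith
  have h2 : f d - f c ≤ Q * (d - c) := by
    have hmaps : MapsTo (fun x => c + d - x) (Icc c d) (Icc c d) := fun x hx =>
      ⟨by linarith [hx.2], by linarith [hx.1]⟩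
    have := sub_le_of_eventually_slope (g := fun x => -f (c + d - x)) (Q := Q) hcd
      (hf.comp (by fun_prop) hmaps).neg ?_
    · simp only [add_sub_cancel_right, add_sub_cancel_left] at this
      linarith
    · intro τ hτ η hη
      have hcont : Tendsto (fun x => c + d - x) (𝓝 τ) (𝓝 (c + d - τ)) :=
        (by fun_prop : Continuous fun x => c + d - x).tendsto τ
      filter_upwards [(hcont.eventually
        (h (c + d - τ) (hmaps (Ico_subset_Icc_self hτ)) η hη)).filter_mono nhdsWithin_le_nhds,
        self_mem_nhdsWithin] with σ hσ hτσ
      rw [sub_sub_sub_cancel_left, abs_sub_comm, abs_of_pos (sub_pos.2 hτσ)] at hσ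
      linarith
  rw [abs_le]
  constructor <;> linarith

/-- The contribution of one scale to the modified energy. -/
def Fk (r a : ℝ) (u z : Sch) : ℝ := ip z (Rs r z) + 4 * Bk r u (Om a z) (Om a z)

/-- The contribution of one scale to the time derivative of the modified energy. -/
def dFk (r a : ℝ) (u z : Sch) : ℝ :=
  2 * ip (zrhs u z) (Rs r z)
    + 4 * (Bk r (urhs u) (Om a z) (Om a z) + 2 * Bk r u (Om a z) (Om a (zrhs u z)))

lemma exists_dual_Bk (hr : 0 < r) (ha : 0 < a) (u f : Sch) :
    ∃ ψ, ∀ g, Bk r u f (Om a g) = ip ψ g := by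
  have hO : ∀ h g, ip h (Om a g) = ip (mult (fun ξ => (starRingEnd ℂ) (om a ξ)) h) g :=
    fun h g => by rw [ip_comm, Om, ip_mult_left (om_temperate ha), ip_comm]
  refine ⟨mult (fun ξ => (starRingEnd ℂ) (om a ξ))
    (((1 / 2 * r ^ 2 : ℝ) : ℂ) • Rs r (mulS u (Rs r f)) +
      ((1 / 2 : ℝ) : ℂ) • Rs r (D (mulS u (D (Rs r f))))), fun g => ?_⟩
  rw [← hO, ip_add_left, ip_smul_left, ip_smul_left, ip_Rs hr, ip_Rs hr, ip_D_left, Bk]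
  ring

lemma ip_mulS_self (v h : Sch) : ip (mulS v h) h = ip (sqS h) v := by
  rw [ip_comm (sqS h), ip_eq_integral, ip_eq_integral]
  congr 2; ext x
  rw [mulS_apply, sqS_apply, map_mul]; ring

lemma exists_dual_Bk_pot (r : ℝ) (f : Sch) : ∃ ψ, ∀ v, Bk r v f f = ip ψ v := by
  refine ⟨((1 / 2 * r ^ 2 : ℝ) : ℂ) • sqS (Rs r f) + ((-(1 / 2) : ℝ) : ℂ) • sqS (D (Rs r f)),
    fun v => ?_⟩
  rw [ip_add_left, ip_smul_left, ip_smul_left, Bk, ip_mulS_self, ip_mulS_self]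
  ring

lemma Bk_sub_pot (r : ℝ) (u v f g : Sch) : Bk r (u - v) f g = Bk r u f g - Bk r v f g := by
  have := Bk_add_pot r (u - v) v f g
  rw [sub_add_cancel] at this
  linarith

/-- Exact second order expansion of the modified energy at one scale. -/
lemma Fk_sub (hr : 0 < r) (u : Sch) {v : Sch} (hv : IsRealV v) (z y : Sch) :
    Fk r a v y - Fk r a u z =
      2 * (ip (Rs r z) y - ip (Rs r z) z) +
      8 * (Bk r u (Om a z) (Om a y) - Bk r u (Om a z) (Om a z)) +
      4 * (Bk r v (Om a z) (Om a z) - Bk r u (Om a z) (Om a z)) +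
      (nm r (-(1 / 2)) (y - z) ^ 2 + 8 * Bk r (v - u) (Om a z) (Om a (y - z)) +
        4 * Bk r v (Om a (y - z)) (Om a (y - z))) := by
  obtain ⟨δ, rfl⟩ : ∃ δ, y = z + δ := ⟨y - z, by abel⟩
  rw [add_sub_cancel_left, ← ip_Rs_self hr, Bk_sub_pot, Fk, Fk]
  simp only [map_add, ip_add_left, ip_add_right, Bk_add_left, Bk_add_right]
  rw [Bk_comm hv r (Om a δ) (Om a z), ip_Rs hr z z, ip_Rs hr z δ, ← ip_Rs hr δ z, ip_comm (Rs r δ) z]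
  ring

lemma abs_Bk_weight_le (hr : 0 < r) (ha : 0 < a) (w f δ : Sch) :
    |8 * Bk r w f (Om a δ)| ≤ 1 / 2 * nm r (-(1 / 2)) δ ^ 2 +
      8 * (a ^ 2)⁻¹ * (r ^ 2 * L2 (mulS w (Rs r f)) ^ 2 + L2 (mulS w (D (Rs r f))) ^ 2) := by
  have h1 := abs_ip_le (mulS w (Rs r f)) (Rs r (Om a δ))
  have h2 := abs_ip_le (mulS w (D (Rs r f))) (D (Rs r (Om a δ)))
  have h3 := energy_eq hr (Om a δ)
  have h4 := nm_Om_le (r := -(1 / 2)) ha hr δ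
  have n0 := nm_nonneg r (-(1 / 2)) (Om a δ)
  have h5 : nm r (-(1 / 2)) (Om a δ) ^ 2 ≤ (a ^ 2)⁻¹ * nm r (-(1 / 2)) δ ^ 2 := by
    calc _ ≤ (a⁻¹ * nm r (-(1 / 2)) δ) ^ 2 := by gcongr
      _ = _ := by rw [mul_pow, inv_pow]
  have h6 : a ^ 2 * nm r (-(1 / 2)) (Om a δ) ^ 2 ≤ nm r (-(1 / 2)) δ ^ 2 := by
    have := mul_le_mul_of_nonneg_left h5 (sq_nonneg a)
    rwa [← mul_assoc, mul_inv_cancel₀ (by positivity), one_mul] at this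
  have young : ∀ x y : ℝ, 4 * (x * y) ≤ 1 / 2 * (a ^ 2 * y ^ 2) + 8 * (a ^ 2)⁻¹ * x ^ 2 := by
    intro x y
    have h7 := sq_nonneg (a * y - 4 * a⁻¹ * x)
    have e : (a * y - 4 * a⁻¹ * x) ^ 2 = a ^ 2 * y ^ 2 + 16 * (a ^ 2)⁻¹ * x ^ 2 - 8 * (x * y) := by
      field_simp; ring
    linarith
  set x1 := L2 (mulS w (Rs r f))
  set x2 := L2 (mulS w (D (Rs r f)))
  set y1 := L2 (Rs r (Om a δ))
  set y2 := L2 (D (Rs r (Om a δ)))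
  have h8 : |8 * Bk r w f (Om a δ)| ≤ r ^ 2 * (4 * (x1 * y1)) + 4 * (x2 * y2) := by
    rw [Bk, abs_le]
    rw [abs_le] at h1 h2
    have := mul_le_mul_of_nonneg_left h1.1 (sq_nonneg r)
    have := mul_le_mul_of_nonneg_left h1.2 (sq_nonneg r)
    constructor <;> nlinarith [h2.1, h2.2]
  have h9 := mul_le_mul_of_nonneg_left (young x1 y1) (sq_nonneg r)
  have h10 := young x2 y2
  have h11 : a ^ 2 * (r ^ 2 * y1 ^ 2 + y2 ^ 2) ≤ nm r (-(1 / 2)) δ ^ 2 := by rw [h3]; exact h6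
  nlinarith

lemma abs_Bk_Om_le (hr : 0 < r) (ha : 0 < a) {v : Sch} (hv : ∀ x, ‖v x‖ ≤ W) (hW : 4 * W ≤ a ^ 2)
    (δ : Sch) :
    |4 * Bk r v (Om a δ) (Om a δ)| ≤ 1 / 2 * nm r (-(1 / 2)) δ ^ 2 := by
  have h1 := abs_Bk_le hr hv (Om a δ) (Om a δ)
  have h4 := nm_Om_le (r := -(1 / 2)) ha hr δ
  have n0 := nm_nonneg r (-(1 / 2)) (Om a δ)
  have hW0 : 0 ≤ W := (norm_nonneg _).trans (hv 0)
  rw [abs_mul, abs_of_pos (by norm_num : (0 : ℝ) < 4)]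
  calc 4 * |Bk r v (Om a δ) (Om a δ)| ≤ 4 * (1 / 2 * W * ((a⁻¹ * nm r (-(1 / 2)) δ) *
        (a⁻¹ * nm r (-(1 / 2)) δ))) := by
        refine mul_le_mul_of_nonneg_left (h1.trans ?_) (by norm_num)
        have := n0.trans h4
        gcongr
    _ = 1 / 2 * (4 * W) * (a ^ 2)⁻¹ * nm r (-(1 / 2)) δ ^ 2 := by field_simp
    _ ≤ 1 / 2 * a ^ 2 * (a ^ 2)⁻¹ * nm r (-(1 / 2)) δ ^ 2 := by gcongr
    _ = _ := by field_simp

/-- Bounds for the first two orders of the expansion of the modified energy at one scale. -/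
lemma Evo.exists_Fk_expansion (h : Evo T m κ Z U) (hb : 0 < b) (hbT : b ≤ T ^ (-(1 / 3) : ℝ))
    (hs : 0 ≤ s) (ht : t ≤ T) (hN : ∀ τ ∈ Icc s t, nm b (-(1 / 4)) (Z τ) ≤ N)
    {τ : ℝ} (hτ : τ ∈ Ioo s t) (hr : 0 < r) (ha : 0 < a)
    (hW : ∀ᶠ σ in 𝓝 τ, ∀ x, ‖U σ x‖ ≤ W) (hWa : 4 * W ≤ a ^ 2) :
    ∃ L : ℝ → ℝ, HasDerivAt L (dFk r a (U τ) (Z τ)) τ ∧ ∀ η > 0, ∀ᶠ σ in 𝓝 τ,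
      L σ - L τ - η * |σ - τ| ≤ Fk r a (U σ) (Z σ) - Fk r a (U τ) (Z τ) ∧
      Fk r a (U σ) (Z σ) - Fk r a (U τ) (Z τ) ≤
        L σ - L τ + η * |σ - τ| + 2 * nm r (-(1 / 2)) (Z σ - Z τ) ^ 2 := by
  have hτT : τ ∈ Ioo 0 T := ⟨hs.trans_lt hτ.1, hτ.2.trans_le ht⟩
  obtain ⟨ψ, hψ⟩ := exists_dual_Bk hr ha (U τ) (Om a (Z τ))
  obtain ⟨φ, hφ⟩ := exists_dual_Bk_pot r (Om a (Z τ))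
  have d1 := h.hasDerivAt_ip_z hb hbT hs ht hN (Rs r (Z τ)) hτ
  have d2 := h.hasDerivAt_ip_z hb hbT hs ht hN ψ hτ
  have d3 := (h.hasDerivAt_ip_u φ hτT).1
  refine ⟨fun σ => 2 * ip (Rs r (Z τ)) (Z σ) + 8 * ip ψ (Z σ) + 4 * ip φ (U σ), ?_, ?_⟩
  · refine (((d1.const_mul 2).add (d2.const_mul 8)).add (d3.const_mul 4)).congr_deriv ?_
    rw [dFk, hψ, hφ, ip_comm (zrhs _ _)]; ring
  · intro η hη
    set f := Om a (Z τ) with hf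
    set e := η / (8 * (a ^ 2)⁻¹ * (r ^ 2 + 1)) with he
    have he0 : 0 < e := by positivity
    filter_upwards [h.eventually_L2_mulS_sub_le (Rs r f) hτT he0,
      h.eventually_L2_mulS_sub_le (D (Rs r f)) hτT he0, hW, Ioo_mem_nhds hτT.1 hτT.2]
      with σ h1 h2 h3 h4
    have hre := Fk_sub (a := a) hr (U τ) (h.real σ (Ioo_subset_Icc_self h4)) (Z τ) (Z σ)
    have e1 : Bk r (U τ) f f = ip ψ (Z τ) := hψ (Z τ)
    rw [← hf, hψ (Z σ), hφ (U σ)] at hre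
    have e2 := hφ (U τ)
    have h5 := abs_le.1 (abs_Bk_weight_le hr ha (U σ - U τ) f (Z σ - Z τ))
    have h6 := abs_le.1 (abs_Bk_Om_le hr ha h3 hWa (Z σ - Z τ))
    have h7 : 8 * (a ^ 2)⁻¹ * (r ^ 2 * L2 (mulS (U σ - U τ) (Rs r f)) ^ 2 +
        L2 (mulS (U σ - U τ) (D (Rs r f))) ^ 2) ≤ η * |σ - τ| := by
      calc _ ≤ 8 * (a ^ 2)⁻¹ * (r ^ 2 * (e * |σ - τ|) + e * |σ - τ|) := by gcongr
        _ = (e * (8 * (a ^ 2)⁻¹ * (r ^ 2 + 1))) * |σ - τ| := by ring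
        _ = _ := by rw [he, div_mul_cancel₀ _ (by positivity)]
    constructor <;> linarith [h5.1, h5.2, h6.1, h6.2]

end LinKdV

namespace LinKdV

open Filter Topology

variable {T m κ a b r s t N W : ℝ} {n : ℕ} {Z U : ℝ → Sch}

lemma Evo.tendsto_nm_sc (h : Evo T m κ Z U) (hb : 0 < b) (hbT : b ≤ T ^ (-(1 / 3) : ℝ))
    (hs : 0 ≤ s) (ht : t ≤ T) (hN : ∀ τ ∈ Icc s t, nm b (-(1 / 4)) (Z τ) ≤ N)
    {τ : ℝ} (hτ : τ ∈ Icc s t) (k : ℕ) :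
    Tendsto (fun σ => nm (sc b k) (-(1 / 2)) (Z σ - Z τ)) (𝓝[Icc s t] τ) (𝓝 0) :=
  squeeze_zero (fun _ => nm_nonneg _ _ _)
    (fun _ => nm_anti hb (le_sc hb k) (by norm_num) _) (h.tendsto_z hb hbT hs ht hN hτ)

lemma abs_nm_sub_le (c r : ℝ) (f g : Sch) : |nm c r f - nm c r g| ≤ nm c r (f - g) := by
  have h1 := nm_add_le c r (f - g) g
  have h2 := nm_add_le c r (g - f) f
  rw [sub_add_cancel] at h1 h2
  rw [← neg_sub, nm_neg] at h2
  rw [abs_le]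
  constructor <;> linarith

lemma Eb_self (hb : 0 < b) (n : ℕ) (f : Sch) :
    Eb b n f f = ∑ k ∈ Finset.range n, sc b k * nm (sc b k) (-(1 / 2)) f ^ 2 :=
  Finset.sum_congr rfl fun k _ => by rw [ip_Rs_self (sc_pos hb k)]

lemma Evo.continuousOn_Eb (h : Evo T m κ Z U) (hb : 0 < b) (hbT : b ≤ T ^ (-(1 / 3) : ℝ))
    (hs : 0 ≤ s) (ht : t ≤ T) (hN : ∀ τ ∈ Icc s t, nm b (-(1 / 4)) (Z τ) ≤ N) (n : ℕ) :
    ContinuousOn (fun σ => Eb b n (Z σ) (Z σ)) (Icc s t) := by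
  simp_rw [Eb_self hb]
  refine continuousOn_finsetSum _ fun k _ => continuousOn_const.mul (ContinuousOn.pow ?_ 2)
  intro τ hτ
  rw [ContinuousWithinAt, tendsto_iff_norm_sub_tendsto_zero]
  exact squeeze_zero (fun _ => norm_nonneg _) (fun σ => abs_nm_sub_le _ _ _ _)
    (h.tendsto_nm_sc hb hbT hs ht hN hτ k)

/-- The modified energy. -/
def Fb (a b : ℝ) (n : ℕ) (u z : Sch) : ℝ := ∑ k ∈ Finset.range n, sc b k * Fk (sc b k) a u z

lemma Fb_eq (a b : ℝ) (n : ℕ) (u z : Sch) :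
    Fb a b n u z = Eb b n z z + 4 * Bb b n u (Om a z) (Om a z) := by
  rw [Fb, Eb, Bb, Finset.mul_sum, ← Finset.sum_add_distrib]
  exact Finset.sum_congr rfl fun k _ => by rw [Fk]; ring

lemma sum_dFk_eq (a b : ℝ) (n : ℕ) (u z : Sch) :
    ∑ k ∈ Finset.range n, sc b k * dFk (sc b k) a u z =
      2 * Eb b n (zrhs u z) z + 4 * Bb b n (urhs u) (Om a z) (Om a z)
        + 8 * Bb b n u (Om a z) (Om a (zrhs u z)) := by
  rw [Eb, Bb, Bb, Finset.mul_sum, Finset.mul_sum, Finset.mul_sum, ← Finset.sum_add_distrib,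
    ← Finset.sum_add_distrib]
  exact Finset.sum_congr rfl fun k _ => by rw [dFk]; ring

lemma Evo.eventually_Fk_ge (h : Evo T m κ Z U) (hb : 0 < b) (hbT : b ≤ T ^ (-(1 / 3) : ℝ))
    (hs : 0 ≤ s) (ht : t ≤ T) (hN : ∀ τ ∈ Icc s t, nm b (-(1 / 4)) (Z τ) ≤ N)
    {τ : ℝ} (hτ : τ ∈ Ioo s t) (ha : 0 < a)
    (hW : ∀ᶠ σ in 𝓝 τ, ∀ x, ‖U σ x‖ ≤ W) (hWa : 4 * W ≤ a ^ 2)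
    (hr : 0 < r) {η : ℝ} (hη : 0 < η) :
    ∀ᶠ σ in 𝓝 τ, dFk r a (U τ) (Z τ) * (σ - τ) - η * |σ - τ| ≤
      Fk r a (U σ) (Z σ) - Fk r a (U τ) (Z τ) := by
  obtain ⟨L, hL, H⟩ := h.exists_Fk_expansion hb hbT hs ht hN hτ hr ha hW hWa
  rw [hasDerivAt_iff_isLittleO] at hL
  filter_upwards [hL.def (half_pos hη), H _ (half_pos hη)] with σ h1 h2
  rw [smul_eq_mul, Real.norm_eq_abs, Real.norm_eq_abs] at h1
  have := (abs_le.1 h1).1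
  linarith [h2.1]

lemma Evo.continuousAt_Fk (h : Evo T m κ Z U) (hb : 0 < b) (hbT : b ≤ T ^ (-(1 / 3) : ℝ))
    (hs : 0 ≤ s) (ht : t ≤ T) (hN : ∀ τ ∈ Icc s t, nm b (-(1 / 4)) (Z τ) ≤ N)
    {τ : ℝ} (hτ : τ ∈ Ioo s t) (ha : 0 < a)
    (hW : ∀ᶠ σ in 𝓝 τ, ∀ x, ‖U σ x‖ ≤ W) (hWa : 4 * W ≤ a ^ 2)
    (k : ℕ) :
    ContinuousAt (fun σ => Fk (sc b k) a (U σ) (Z σ)) τ := by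
  obtain ⟨L, hL, H⟩ := h.exists_Fk_expansion hb hbT hs ht hN hτ (sc_pos hb k) ha hW hWa
  have hz := h.tendsto_nm_sc hb hbT hs ht hN (Ioo_subset_Icc_self hτ) k
  rw [nhdsWithin_eq_nhds.2 (Icc_mem_nhds hτ.1 hτ.2)] at hz
  have hL' : Tendsto L (𝓝 τ) (𝓝 (L τ)) := hL.continuousAt
  have hd : Tendsto (fun σ : ℝ => |σ - τ|) (𝓝 τ) (𝓝 0) := by
    have : Continuous fun σ : ℝ => |σ - τ| := by fun_prop
    simpa using this.tendsto τ
  have l1 : Tendsto (fun σ => L σ - L τ - 1 * |σ - τ|) (𝓝 τ) (𝓝 0) := by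
    simpa using (hL'.sub_const (L τ)).sub (hd.const_mul 1)
  have l2 : Tendsto (fun σ => L σ - L τ + 1 * |σ - τ| +
      2 * nm (sc b k) (-(1 / 2)) (Z σ - Z τ) ^ 2) (𝓝 τ) (𝓝 0) := by
    simpa using ((hL'.sub_const (L τ)).add (hd.const_mul 1)).add ((hz.pow 2).const_mul 2)
  have := tendsto_of_tendsto_of_tendsto_of_le_of_le' l1 l2
    ((H 1 one_pos).mono fun _ h => h.1) ((H 1 one_pos).mono fun _ h => h.2)
  rw [ContinuousAt, ← tendsto_sub_nhds_zero_iff]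
  exact this

lemma Evo.eventually_Fb_ge (h : Evo T m κ Z U) (hb : 0 < b) (hbT : b ≤ T ^ (-(1 / 3) : ℝ))
    (hs : 0 ≤ s) (ht : t ≤ T) (hN : ∀ τ ∈ Icc s t, nm b (-(1 / 4)) (Z τ) ≤ N)
    {τ : ℝ} (hτ : τ ∈ Ioo s t) (ha : 0 < a)
    (hW : ∀ᶠ σ in 𝓝 τ, ∀ x, ‖U σ x‖ ≤ W) (hWa : 4 * W ≤ a ^ 2)
    {Q : ℝ} (n : ℕ)
    (hQ : |∑ k ∈ Finset.range n, sc b k * dFk (sc b k) a (U τ) (Z τ)| ≤ Q)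
    {η : ℝ} (hη : 0 < η) :
    ∀ᶠ σ in 𝓝 τ, Fb a b n (U τ) (Z τ) - Fb a b n (U σ) (Z σ) ≤ (Q + η) * |σ - τ| := by
  set S := ∑ k ∈ Finset.range n, sc b k with hS
  have hS0 : 0 ≤ S := Finset.sum_nonneg fun k _ => (sc_pos hb k).le
  have hη' : 0 < η / (S + 1) := by positivity
  have H : ∀ᶠ σ in 𝓝 τ, ∀ k ∈ Finset.range n,
      dFk (sc b k) a (U τ) (Z τ) * (σ - τ) - η / (S + 1) * |σ - τ| ≤
        Fk (sc b k) a (U σ) (Z σ) - Fk (sc b k) a (U τ) (Z τ) :=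
    (Filter.eventually_all_finset _).2 fun k _ =>
      h.eventually_Fk_ge hb hbT hs ht hN hτ ha hW hWa (sc_pos hb k) hη'
  filter_upwards [H] with σ hσ
  have h1 : (∑ k ∈ Finset.range n, sc b k * dFk (sc b k) a (U τ) (Z τ)) * (σ - τ) -
      S * (η / (S + 1)) * |σ - τ| ≤ Fb a b n (U σ) (Z σ) - Fb a b n (U τ) (Z τ) := by
    rw [Fb, Fb, hS, Finset.sum_mul, Finset.sum_mul, Finset.sum_mul, ← Finset.sum_sub_distrib,
      ← Finset.sum_sub_distrib]
    refine Finset.sum_le_sum fun k hk => ?_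
    have := mul_le_mul_of_nonneg_left (hσ k hk) (sc_pos hb k).le
    linarith
  have h2 : S * (η / (S + 1)) ≤ η := by
    rw [mul_div_assoc', div_le_iff₀ (by positivity)]; nlinarith
  have h3 : -(Q * |σ - τ|) ≤
      (∑ k ∈ Finset.range n, sc b k * dFk (sc b k) a (U τ) (Z τ)) * (σ - τ) := by
    refine neg_le_of_abs_le ?_
    rw [abs_mul]
    exact mul_le_mul_of_nonneg_right hQ (abs_nonneg _)
  have h4 := mul_le_mul_of_nonneg_right h2 (abs_nonneg (σ - τ))
  linarith

section Window

variable {c d : ℝ}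

lemma rpow_third_inv (hc : 0 < c) : c ^ (-(1 / 3) : ℝ) = (c ^ (1 / 3 : ℝ))⁻¹ := rpow_neg hc.le _

lemma rpow_third_cube (hc : 0 < c) : (c ^ (1 / 3 : ℝ)) ^ 3 = c := by
  rw [← rpow_natCast, ← rpow_mul hc.le]; norm_num

/-- Almost conservation of the energy on dyadic time intervals. -/
lemma Evo.abs_Eb_sub_le_of_le_two_mul (h : Evo T m κ Z U) (hb : 0 < b)
    (hbT : b ≤ T ^ (-(1 / 3) : ℝ)) (hs : 0 ≤ s) (ht : t ≤ T)
    (hN : ∀ τ ∈ Icc s t, nm b (-(1 / 4)) (Z τ) ≤ N) (hm : m * T ^ (1 / 3 : ℝ) ≤ 1 / 8)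
    (hsc : s < c) (hcd : c ≤ d) (hdt : d < t) (hdc : d ≤ 2 * c) (n : ℕ) :
    |Eb b n (Z d) (Z d) - Eb b n (Z c) (Z c)| ≤ 156 * κ * m * c ^ (1 / 3 : ℝ) * N ^ 2 := by
  have hc : 0 < c := hs.trans_lt hsc
  have hcT : c ≤ T := (hcd.trans hdt.le).trans ht
  set q := c ^ (1 / 3 : ℝ) with hq
  have hq0 : 0 < q := rpow_pos_of_pos hc _
  have hm0 := h.m_nonneg
  have hκ0 : 0 ≤ κ := zero_le_one.trans h.one_le
  have hmq : m * q ≤ 1 / 8 := (mul_le_mul_of_nonneg_left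
    (rpow_le_rpow hc.le hcT (by norm_num)) hm0).trans hm
  set a := c ^ (-(1 / 3) : ℝ) with ha
  have haq : a = q⁻¹ := rpow_third_inv hc
  have ha0 : 0 < a := rpow_pos_of_pos hc _
  have hba : b ≤ a := hbT.trans (rpow_le_rpow_of_nonpos hc hcT (by norm_num))
  have hc8 : (c / 8) ^ (-(1 / 3) : ℝ) = 2 * a := by
    rw [div_rpow hc.le (by norm_num), ← ha,
      show (8 : ℝ) = 2 ^ (3 : ℝ) by norm_num, ← rpow_mul (by norm_num)]
    norm_num
    ring
  have hma : 8 * m ≤ a := by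
    rw [haq, ← one_div, le_div_iff₀ hq0]; linarith
  have hW : ∀ τ ∈ Icc c d, ∀ᶠ σ in 𝓝 τ, ∀ x, ‖U σ x‖ ≤ m * (2 * a) := by
    intro τ hτ
    filter_upwards [Icc_mem_nhds (show c / 8 < τ by linarith [hτ.1])
      (show τ < T by linarith [hτ.2])] with σ hσ x
    rw [← hc8]
    exact h.norm_u_le (by positivity) hσ x
  have hWa : 4 * (m * (2 * a)) ≤ a ^ 2 := by nlinarith
  have hmem : ∀ τ ∈ Icc c d, τ ∈ Ioo s t := fun τ hτ =>
    ⟨hsc.trans_le hτ.1, hτ.2.trans_lt hdt⟩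
  have hb2 : ∀ τ ∈ Icc c d, (∀ x, ‖U τ x‖ ≤ m * a) ∧
      ∀ f, nm a (1 / 4) (mulS (U τ) f) ≤ κ * m * a * nm a (1 / 4) f := fun τ hτ =>
    h.bound c τ hc hτ.1 (hτ.2.trans hdc) ((hτ.2.trans hdt.le).trans ht)
  have hreal : ∀ τ ∈ Icc c d, IsRealV (U τ) := fun τ hτ =>
    h.real τ ⟨hc.le.trans hτ.1, (hτ.2.trans hdt.le).trans ht⟩
  have hN2 : ∀ τ ∈ Icc c d, nm b (-(1 / 4)) (Z τ) ^ 2 ≤ N ^ 2 := fun τ hτ =>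
    pow_le_pow_left₀ (nm_nonneg _ _ _) (hN τ (Ioo_subset_Icc_self (hmem τ hτ))) 2
  set Q := 142 * κ * m * a ^ 2 * N ^ 2 with hQdef
  have hQ : ∀ τ ∈ Icc c d,
      |∑ k ∈ Finset.range n, sc b k * dFk (sc b k) a (U τ) (Z τ)| ≤ Q := by
    intro τ hτ
    rw [sum_dFk_eq]
    have hK0 : 0 ≤ κ * m * a := by positivity
    refine (abs_modified_energy_deriv_le hb hba n (hreal τ hτ) (hb2 τ hτ).1 hK0 (hb2 τ hτ).2
      (nm_mulS_neg_le ha0 hK0 (hreal τ hτ) (hb2 τ hτ).2) (Z τ)).trans ?_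
    have e : 84 * a * (κ * m * a) + 42 * a * (m * a) + 42 * (m * a) ^ 2 / a +
        84 * (m * a) * (κ * m * a) / a = a * m * (84 * κ * a + 42 * a + 42 * m + 84 * κ * m) := by
      field_simp
    have e2 : 84 * κ * a + 42 * a + 42 * m + 84 * κ * m ≤ 142 * κ * a := by
      have h1 : a ≤ κ * a := le_mul_of_one_le_left ha0.le h.one_le
      have h2 : κ * (8 * m) ≤ κ * a := mul_le_mul_of_nonneg_left hma hκ0
      nlinarith
    rw [e, hQdef]
    calc _ ≤ a * m * (142 * κ * a) * N ^ 2 :=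
          mul_le_mul (mul_le_mul_of_nonneg_left e2 (by positivity)) (hN2 τ hτ) (sq_nonneg _)
            (by positivity)
      _ = _ := by ring
  have hF : |Fb a b n (U d) (Z d) - Fb a b n (U c) (Z c)| ≤ Q * (d - c) := by
    refine abs_sub_le_of_eventually_ge (f := fun σ => Fb a b n (U σ) (Z σ)) hcd ?_ ?_
    · intro τ hτ
      refine ContinuousAt.continuousWithinAt ?_
      exact tendsto_finsetSum _ fun k _ => (h.continuousAt_Fk hb hbT hs ht hN (hmem τ hτ) ha0
        (hW τ hτ) hWa k).const_mul _
    · intro τ hτ η hη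
      exact h.eventually_Fb_ge hb hbT hs ht hN (hmem τ hτ) ha0 (hW τ hτ) hWa n (hQ τ hτ) hη
  have hB : ∀ τ ∈ Icc c d, |4 * Bb b n (U τ) (Om a (Z τ)) (Om a (Z τ))| ≤ 7 * m * q * N ^ 2 := by
    intro τ hτ
    have h1 := abs_Bb_le hb n (hb2 τ hτ).1 (Om a (Z τ)) (Om a (Z τ))
    have h2 := nm_Om_le (r := -(1 / 4)) ha0 hb (Z τ)
    have h0 := nm_nonneg b (-(1 / 4)) (Om a (Z τ))
    have h3 : nm b (-(1 / 4)) (Om a (Z τ)) * nm b (-(1 / 4)) (Om a (Z τ)) ≤ q ^ 2 * N ^ 2 := by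
      rw [haq, inv_inv] at h2
      calc _ = nm b (-(1 / 4)) (Om a (Z τ)) ^ 2 := (sq _).symm
        _ ≤ (q * nm b (-(1 / 4)) (Z τ)) ^ 2 := pow_le_pow_left₀ h0 (by rwa [haq]) 2
        _ = q ^ 2 * nm b (-(1 / 4)) (Z τ) ^ 2 := by ring
        _ ≤ _ := mul_le_mul_of_nonneg_left (hN2 τ hτ) (sq_nonneg _)
    rw [abs_mul, abs_of_pos (by norm_num : (0 : ℝ) < 4)]
    calc _ ≤ 4 * (7 / 4 * (m * a) * (q ^ 2 * N ^ 2)) := by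
          refine mul_le_mul_of_nonneg_left (h1.trans ?_) (by norm_num)
          gcongr
      _ = _ := by rw [haq]; field_simp
  have hdcq : Q * (d - c) ≤ 142 * κ * m * q * N ^ 2 := by
    have h1 : Q * (d - c) ≤ Q * c := mul_le_mul_of_nonneg_left (by linarith) (by positivity)
    refine h1.trans (le_of_eq ?_)
    have h3 : c = q ^ 3 := (rpow_third_cube hc).symm
    rw [hQdef, h3, haq]; field_simp
  have hBc := abs_le.1 (hB c ⟨le_rfl, hcd⟩)
  have hBd := abs_le.1 (hB d ⟨hcd, le_rfl⟩)
  rw [Fb_eq, Fb_eq] at hF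
  have hF' := abs_le.1 (hF.trans hdcq)
  have hκm : 7 * m * q * N ^ 2 ≤ κ * (7 * m * q * N ^ 2) :=
    le_mul_of_one_le_left (by positivity) h.one_le
  rw [abs_le]
  constructor <;> linarith [hF'.1, hF'.2, hBc.1, hBc.2, hBd.1, hBd.2]

/-- Almost conservation of the energy on the interior of an arbitrary time interval. -/
lemma Evo.abs_Eb_sub_le (h : Evo T m κ Z U) (hb : 0 < b)
    (hbT : b ≤ T ^ (-(1 / 3) : ℝ)) (hs : 0 ≤ s) (ht : t ≤ T)
    (hN : ∀ τ ∈ Icc s t, nm b (-(1 / 4)) (Z τ) ≤ N) (hm : m * T ^ (1 / 3 : ℝ) ≤ 1 / 8)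
    (hsc : s < c) (n : ℕ) (j : ℕ) : ∀ d, c ≤ d → d < t → d ≤ 2 ^ j * c →
    |Eb b n (Z d) (Z d) - Eb b n (Z c) (Z c)| ≤ 624 * κ * m * d ^ (1 / 3 : ℝ) * N ^ 2 := by
  have hc : 0 < c := hs.trans_lt hsc
  have hm0 := h.m_nonneg
  have hκ0 : 0 ≤ κ := zero_le_one.trans h.one_le
  have base : ∀ d, c ≤ d → d < t → d ≤ 2 * c →
      |Eb b n (Z d) (Z d) - Eb b n (Z c) (Z c)| ≤ 624 * κ * m * d ^ (1 / 3 : ℝ) * N ^ 2 := by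
    intro d hcd hdt hdc
    refine (h.abs_Eb_sub_le_of_le_two_mul hb hbT hs ht hN hm hsc hcd hdt hdc n).trans ?_
    have : c ^ (1 / 3 : ℝ) ≤ d ^ (1 / 3 : ℝ) := rpow_le_rpow hc.le hcd (by norm_num)
    gcongr
    norm_num
  induction j with
  | zero => intro d hcd hdt hdc; exact base d hcd hdt (by linarith)
  | succ j ih =>
    intro d hcd hdt hdc
    rcases le_or_gt d (2 * c) with hle | hgt
    · exact base d hcd hdt hle
    have h1 := ih (d / 2) (by linarith) (by linarith) (by rw [pow_succ] at hdc; linarith)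
    have h2 := h.abs_Eb_sub_le_of_le_two_mul (c := d / 2) (d := d) hb hbT hs ht hN hm
      (by linarith) (by linarith) hdt (by linarith) n
    have h3 : 5 / 4 * (d / 2) ^ (1 / 3 : ℝ) ≤ d ^ (1 / 3 : ℝ) := by
      have hd : 0 < d := by linarith
      have e1 := rpow_third_cube (half_pos hd)
      have e2 := rpow_third_cube hd
      have p1 : 0 < (d / 2) ^ (1 / 3 : ℝ) := rpow_pos_of_pos (half_pos hd) _
      have p2 : 0 < d ^ (1 / 3 : ℝ) := rpow_pos_of_pos hd _
      refine le_of_pow_le_pow_left₀ (n := 3) (by norm_num) p2.le ?_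
      rw [mul_pow, e1, e2]; linarith
    have h4 := mul_le_mul_of_nonneg_left h3
      (by positivity : 0 ≤ 624 * κ * m * N ^ 2)
    refine (abs_sub_le _ (Eb b n (Z (d / 2)) (Z (d / 2))) _).trans ?_
    linarith

lemma Evo.Eb_le_add (h : Evo T m κ Z U) (hb : 0 < b)
    (hbT : b ≤ T ^ (-(1 / 3) : ℝ)) (hs : 0 ≤ s) (ht : t ≤ T)
    (hN : ∀ τ ∈ Icc s t, nm b (-(1 / 4)) (Z τ) ≤ N)
    (hm : 624 * κ * m * T ^ (1 / 3 : ℝ) ≤ 1 / 10) (n : ℕ)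
    {τ σ : ℝ} (hτ : τ ∈ Icc s t) (hσ : σ ∈ Icc s t) :
    Eb b n (Z σ) (Z σ) ≤ Eb b n (Z τ) (Z τ) + 1 / 10 * N ^ 2 := by
  rcases (hτ.1.trans hτ.2).eq_or_lt with hst | hst
  · have : σ = τ := by
      subst hst; rw [Icc_self] at hσ hτ; rw [hσ, hτ]
    rw [this]; linarith [sq_nonneg N]
  have hm0 := h.m_nonneg
  have hT0 : 0 ≤ T ^ (1 / 3 : ℝ) := rpow_nonneg h.T_pos.le _
  have hm8 : m * T ^ (1 / 3 : ℝ) ≤ 1 / 8 := by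
    have h1 := h.one_le
    have h2 : 0 ≤ m * T ^ (1 / 3 : ℝ) := by positivity
    nlinarith
  have key : ∀ c ∈ Ioo s t, ∀ d ∈ Ioo s t, c ≤ d →
      |Eb b n (Z d) (Z d) - Eb b n (Z c) (Z c)| ≤ 1 / 10 * N ^ 2 := by
    intro c hc d hd hcd
    have hc0 : 0 < c := hs.trans_lt hc.1
    obtain ⟨j, hj⟩ := pow_unbounded_of_one_lt (d / c) one_lt_two
    have h1 := h.abs_Eb_sub_le hb hbT hs ht hN hm8 hc.1 n j d hcd hd.2
      ((div_le_iff₀ hc0).1 hj.le)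
    refine h1.trans ?_
    have h2 : d ^ (1 / 3 : ℝ) ≤ T ^ (1 / 3 : ℝ) :=
      rpow_le_rpow (hc0.le.trans hcd) (hd.2.le.trans ht) (by norm_num)
    have h3 : 624 * κ * m * d ^ (1 / 3 : ℝ) ≤ 1 / 10 := le_trans
      (mul_le_mul_of_nonneg_left h2 (by have := h.one_le; positivity)) hm
    exact mul_le_mul_of_nonneg_right h3 (sq_nonneg N)
  have key2 : ∀ c ∈ Ioo s t, ∀ d ∈ Ioo s t,
      Eb b n (Z d) (Z d) ≤ Eb b n (Z c) (Z c) + 1 / 10 * N ^ 2 := by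
    intro c hc d hd
    rcases le_total c d with hcd | hcd
    · have := (abs_le.1 (key c hc d hd hcd)).2
      linarith
    · have := (abs_le.1 (key d hd c hc hcd)).1
      linarith
  have hcont := h.continuousOn_Eb hb hbT hs ht hN n
  have hcl : closure (Ioo s t) = Icc s t := closure_Ioo hst.ne
  have key3 : ∀ c ∈ Ioo s t, Eb b n (Z σ) (Z σ) ≤ Eb b n (Z c) (Z c) + 1 / 10 * N ^ 2 :=
    fun c hc => ContinuousWithinAt.closure_le (hcl ▸ hσ)
      ((hcont σ hσ).mono Ioo_subset_Icc_self) continuousWithinAt_const (key2 c hc)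
  exact ContinuousWithinAt.closure_le (f := fun _ => Eb b n (Z σ) (Z σ))
    (g := fun c => Eb b n (Z c) (Z c) + 1 / 10 * N ^ 2) (hcl ▸ hτ) continuousWithinAt_const
    (((hcont τ hτ).mono Ioo_subset_Icc_self).add_const _) key3

lemma tendsto_inv_sc (hb : 0 < b) : Tendsto (fun n => (sc b n)⁻¹) atTop (𝓝 0) :=
  ((tendsto_pow_atTop_atTop_of_one_lt one_lt_two).const_mul_atTop hb).inv_tendsto_atTop

/-- If the weak norm of the solution stays bounded, it is almost conserved. -/
lemma Evo.nm_sq_le_of_bounded (h : Evo T m κ Z U) (hb : 0 < b)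
    (hbT : b ≤ T ^ (-(1 / 3) : ℝ)) (hs : 0 ≤ s) (ht : t ≤ T)
    (hN : ∀ τ ∈ Icc s t, nm b (-(1 / 4)) (Z τ) ≤ N)
    (hm : 624 * κ * m * T ^ (1 / 3 : ℝ) ≤ 1 / 10)
    {τ σ : ℝ} (hτ : τ ∈ Icc s t) (hσ : σ ∈ Icc s t) :
    nm b (-(1 / 4)) (Z σ) ^ 2 ≤ 35 * nm b (-(1 / 4)) (Z τ) ^ 2 := by
  set X := fun τ => nm b (-(1 / 4)) (Z τ) ^ 2 with hX
  have hX0 : ∀ τ, 0 ≤ X τ := fun τ => sq_nonneg _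
  have hbdd : BddAbove (X '' Icc s t) := by
    refine ⟨N ^ 2, ?_⟩
    rintro _ ⟨τ, hτ, rfl⟩
    exact pow_le_pow_left₀ (nm_nonneg _ _ _) (hN τ hτ) 2
  set S := sSup (X '' Icc s t) with hS
  have hXS : ∀ τ ∈ Icc s t, X τ ≤ S := fun τ hτ => le_csSup hbdd ⟨τ, hτ, rfl⟩
  have hS0 : 0 ≤ S := (hX0 τ).trans (hXS τ hτ)
  have hN' : ∀ τ ∈ Icc s t, nm b (-(1 / 4)) (Z τ) ≤ √S := fun τ hτ => le_sqrt_of_sq_le (hXS τ hτ)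
  have key : ∀ ρ ∈ Icc s t, X ρ ≤ 35 / 2 * X τ + S / 2 := by
    intro ρ hρ
    have hn : ∀ n : ℕ, X ρ ≤ 35 / 2 * X τ + S / 2 + (sc b n)⁻¹ * L2 (Z ρ) ^ 2 := by
      intro n
      have h1 := le_sum_energy hb n (Z ρ)
      have h2 := sum_energy_le hb n (Z τ)
      have h3 := h.Eb_le_add hb hbT hs ht hN' hm n hτ hρ
      rw [Eb_self hb, Eb_self hb, sq_sqrt hS0] at h3
      simp only [hX]
      linarith
    have hlim : Tendsto (fun n => 35 / 2 * X τ + S / 2 + (sc b n)⁻¹ * L2 (Z ρ) ^ 2) atTop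
        (𝓝 (35 / 2 * X τ + S / 2)) := by
      simpa using ((tendsto_inv_sc hb).mul_const (L2 (Z ρ) ^ 2)).const_add (35 / 2 * X τ + S / 2)
    exact ge_of_tendsto' hlim hn
  have hSle : S ≤ 35 / 2 * X τ + S / 2 := by
    refine csSup_le ⟨_, τ, hτ, rfl⟩ ?_
    rintro _ ⟨ρ, hρ, rfl⟩
    exact key ρ hρ
  exact (hXS σ hσ).trans (by linarith)

end Window

end LinKdV

namespace LinKdV

open Filter Topology

/-- A Baire category argument: a function on a compact interval which is bounded on each set of a
countable closed cover and almost constant on intervals where it is bounded, is bounded. -/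
lemma exists_bound_of_propagation {X : ℝ → ℝ} {T : ℝ} {A : ℕ → Set ℝ}
    (hX : ∀ τ, 0 ≤ X τ) (hA : ∀ n, IsClosed (A n)) (hcover : Icc 0 T ⊆ ⋃ n, A n)
    (hbdd : ∀ n, ∃ C, ∀ τ ∈ A n, X τ ≤ C)
    (hprop : ∀ s t C, 0 ≤ s → t ≤ T → (∀ τ ∈ Icc s t, X τ ≤ C) →
      ∀ τ ∈ Icc s t, ∀ σ ∈ Icc s t, X σ ≤ 35 * X τ) :
    ∃ C, ∀ τ ∈ Icc 0 T, X τ ≤ C := by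
  set LB : ℝ → Prop := fun τ => ∃ C, ∀ᶠ σ in 𝓝[Icc 0 T] τ, X σ ≤ C with hLB
  have hcomp : ∀ s t, 0 ≤ s → t ≤ T → (∀ τ ∈ Icc s t, LB τ) → ∃ C, ∀ τ ∈ Icc s t, X τ ≤ C := by
    intro s t hs ht hl
    refine isCompact_Icc.induction_on (p := fun S => ∃ C, ∀ τ ∈ S, X τ ≤ C) ⟨0, by simp⟩ ?_ ?_ ?_
    · rintro S S' hSS ⟨C, hC⟩
      exact ⟨C, fun τ hτ => hC τ (hSS hτ)⟩
    · rintro S S' ⟨C, hC⟩ ⟨C', hC'⟩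
      refine ⟨max C C', fun τ hτ => ?_⟩
      rcases hτ with h | h
      · exact (hC τ h).trans (le_max_left _ _)
      · exact (hC' τ h).trans (le_max_right _ _)
    · intro τ hτ
      obtain ⟨C, hC⟩ := hl τ hτ
      exact ⟨{σ | X σ ≤ C}, nhdsWithin_mono τ (Icc_subset_Icc hs ht) hC, C, fun σ hσ => hσ⟩
  have hcompu : ∀ α ∈ Icc 0 T, ∀ β ∈ Icc 0 T, (∀ τ ∈ uIcc α β, LB τ) → X α ≤ 35 * X β := by
    intro α hα β hβ hl
    obtain ⟨C, hC⟩ := hcomp (min α β) (max α β) (le_min hα.1 hβ.1) (max_le hα.2 hβ.2) hl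
    exact hprop _ _ C (le_min hα.1 hβ.1) (max_le hα.2 hβ.2) hC β right_mem_uIcc α left_mem_uIcc
  have hgap : ∀ α ∈ Icc 0 T, ∀ β ∈ Icc 0 T, (∀ τ ∈ uIcc α β, τ ≠ α → LB τ) → X β ≤ 35 * X α := by
    intro α hα β hβ hl
    refine hprop (min α β) (max α β) (max (X α) (35 * X β)) (le_min hα.1 hβ.1) (max_le hα.2 hβ.2) ?_
      α left_mem_uIcc β right_mem_uIcc
    intro τ hτ
    rcases eq_or_ne τ α with rfl | hne
    · exact le_max_left _ _
    have hτI : τ ∈ Icc 0 T := ⟨(le_min hα.1 hβ.1).trans hτ.1, hτ.2.trans (max_le hα.2 hβ.2)⟩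
    refine (hcompu τ hτI β hβ fun ρ hρ => hl ρ (uIcc_subset_uIcc_right hτ hρ) ?_).trans
      (le_max_right _ _)
    rintro rfl
    refine hne ?_
    rcases mem_uIcc.1 hτ with h | h <;> rcases mem_uIcc.1 hρ with h' | h' <;> linarith [h.1, h.2, h'.1, h'.2]
  set F := {τ ∈ Icc 0 T | ¬ LB τ} with hF
  have hFc : IsClosed F := by
    rw [← isOpen_compl_iff, isOpen_iff_mem_nhds]
    intro τ hτ
    by_cases hτI : τ ∈ Icc 0 T
    · have hl : LB τ := by
        by_contra hl
        exact hτ ⟨hτI, hl⟩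
      obtain ⟨C, hC⟩ := hl
      have h2 := eventually_eventually_nhdsWithin.2 hC
      rw [eventually_nhdsWithin_iff] at h2
      filter_upwards [h2] with σ hσ hσF
      exact hσF.2 ⟨C, hσ hσF.1⟩
    · filter_upwards [isClosed_Icc.isOpen_compl.mem_nhds hτI] with σ hσ hσF
      exact hσ hσF.1
  rcases F.eq_empty_or_nonempty with hE | hne
  · refine hcomp 0 T le_rfl le_rfl fun τ hτ => ?_
    by_contra hl
    have : τ ∈ F := ⟨hτ, hl⟩
    rw [hE] at this
    exact this
  exfalso
  have hFcomp : IsCompact F := isCompact_Icc.of_isClosed_subset hFc fun τ hτ => hτ.1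
  have : CompleteSpace F := hFc.completeSpace_coe
  have : Nonempty F := hne.to_subtype
  obtain ⟨n, p, hp⟩ := nonempty_interior_of_iUnion_of_closed (X := F)
    (f := fun n => Subtype.val ⁻¹' A n) (fun n => (hA n).preimage continuous_subtype_val) (by
      rw [← preimage_iUnion, eq_univ_iff_forall]
      exact fun x => hcover x.2.1)
  obtain ⟨δ, hδ, hball⟩ := Metric.mem_nhds_iff.1 (mem_interior_iff_mem_nhds.1 hp)
  obtain ⟨C, hC⟩ := hbdd n
  have hFX : ∀ x ∈ F, |x - p| < δ → X x ≤ C := fun x hx hxp =>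
    hC x (hball (show (⟨x, hx⟩ : F) ∈ Metric.ball p δ from hxp))
  refine p.2.2 ⟨35 * C, ?_⟩
  have hC0 : 0 ≤ C := (hX _).trans (hFX p p.2 (by simpa using hδ))
  rw [eventually_nhdsWithin_iff]
  filter_upwards [Metric.ball_mem_nhds (p : ℝ) hδ] with t ht htI
  have hK : IsCompact (F ∩ uIcc (p : ℝ) t) := hFcomp.inter_right isClosed_Icc
  obtain ⟨α, hα, hmin⟩ := hK.exists_isMinOn ⟨p, p.2, left_mem_uIcc⟩
    (f := fun x => |x - t|) (by fun_prop)
  have hαp : |α - p| < δ := by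
    have h1 : |t - p| < δ := ht
    have h2 := mem_uIcc.1 hα.2
    rw [abs_lt] at h1 ⊢
    rcases h2 with h2 | h2 <;> constructor <;> linarith [h2.1, h2.2, h1.1, h1.2]
  refine (hgap α hα.1.1 t htI ?_).trans
    (mul_le_mul_of_nonneg_left (hFX α hα.1 hαp) (by norm_num))
  intro τ hτ hτα
  by_contra hl
  have hτI : τ ∈ Icc 0 T :=
    ⟨(le_min hα.1.1.1 htI.1).trans hτ.1, hτ.2.trans (max_le hα.1.1.2 htI.2)⟩
  have h1 : |α - t| ≤ |τ - t| := hmin ⟨⟨hτI, hl⟩, uIcc_subset_uIcc_right hα.2 hτ⟩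
  refine hτα ?_
  rcases mem_uIcc.1 hτ with h2 | h2
  · rw [abs_of_nonpos (by linarith [h2.1, h2.2]), abs_of_nonpos (by linarith [h2.1, h2.2])] at h1
    linarith [h2.1]
  · rw [abs_of_nonneg (by linarith [h2.1, h2.2]), abs_of_nonneg (by linarith [h2.1, h2.2])] at h1
    linarith [h2.2]

lemma exists_one_add_sq_mul_le (f : Sch) : ∃ n : ℕ, ∀ x, (1 + x ^ 2) * ‖f x‖ ≤ n := by
  obtain ⟨n, hn⟩ := exists_nat_ge (SchwartzMap.seminorm ℝ 0 0 f + SchwartzMap.seminorm ℝ 2 0 f)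
  refine ⟨n, fun x => le_trans ?_ hn⟩
  have h0 := SchwartzMap.norm_le_seminorm ℝ f x
  have h1 := SchwartzMap.norm_pow_mul_le_seminorm ℝ f 2 x
  rw [Real.norm_eq_abs, sq_abs] at h1
  linarith

lemma L2_sq_le_of_decay {f : Sch} {C : ℝ} (hf : ∀ x, (1 + x ^ 2) * ‖f x‖ ≤ C) :
    L2 f ^ 2 ≤ C ^ 2 * π := by
  rw [L2_sq_eq, ← integral_univ_inv_one_add_sq, ← integral_const_mul]
  refine integral_mono (integrable_norm_sq f) (integrable_inv_one_add_sq.const_mul _) fun x => ?_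
  have h1 : ‖f x‖ ≤ C * (1 + x ^ 2)⁻¹ := by
    rw [← div_eq_mul_inv, le_div_iff₀ (by positivity), mul_comm]; exact hf x
  have h2 : (1 + x ^ 2)⁻¹ ≤ 1 := inv_le_one_of_one_le₀ (by linarith [sq_nonneg x])
  have h3 : 0 ≤ (1 + x ^ 2)⁻¹ := by positivity
  calc ‖f x‖ ^ 2 ≤ (C * (1 + x ^ 2)⁻¹) ^ 2 := by gcongr
    _ = C ^ 2 * ((1 + x ^ 2)⁻¹ * (1 + x ^ 2)⁻¹) := by ring
    _ ≤ C ^ 2 * ((1 + x ^ 2)⁻¹ * 1) := by gcongr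
    _ = _ := by ring

variable {T m κ b : ℝ} {Z U : ℝ → Sch}

/-- Uniform in `b` bounds for the inhomogeneous norms of solutions of the linearized equation. -/
theorem Evo.nm_sq_le (h : Evo T m κ Z U) (hb : 0 < b)
    (hbT : b ≤ T ^ (-(1 / 3) : ℝ)) (hm : 624 * κ * m * T ^ (1 / 3 : ℝ) ≤ 1 / 10)
    {τ σ : ℝ} (hτ : τ ∈ Icc 0 T) (hσ : σ ∈ Icc 0 T) :
    nm b (-(1 / 4)) (Z σ) ^ 2 ≤ 35 * nm b (-(1 / 4)) (Z τ) ^ 2 := by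
  have hprop : ∀ s t C, 0 ≤ s → t ≤ T → (∀ τ ∈ Icc s t, nm b (-(1 / 4)) (Z τ) ^ 2 ≤ C) →
      ∀ τ ∈ Icc s t, ∀ σ ∈ Icc s t,
        nm b (-(1 / 4)) (Z σ) ^ 2 ≤ 35 * nm b (-(1 / 4)) (Z τ) ^ 2 :=
    fun s t C hs ht hC τ hτ σ hσ =>
      h.nm_sq_le_of_bounded hb hbT hs ht (fun ρ hρ => le_sqrt_of_sq_le (hC ρ hρ)) hm hτ hσ
  suffices ∃ C, ∀ τ ∈ Icc 0 T, nm b (-(1 / 4)) (Z τ) ^ 2 ≤ C by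
    obtain ⟨C, hC⟩ := this
    exact hprop 0 T C le_rfl le_rfl hC τ hτ σ hσ
  refine exists_bound_of_propagation (X := fun τ => nm b (-(1 / 4)) (Z τ) ^ 2) (T := T)
    (A := fun n : ℕ => {τ ∈ Icc 0 T | ∀ x, (1 + x ^ 2) * ‖Z τ x‖ ≤ n}) (fun _ => sq_nonneg _) ?_ ?_
    ?_ hprop
  · intro n
    have : {τ ∈ Icc 0 T | ∀ x, (1 + x ^ 2) * ‖Z τ x‖ ≤ n} =
        ⋂ x : ℝ, (Icc 0 T ∩ (fun τ => (1 + x ^ 2) * ‖Z τ x‖) ⁻¹' Iic (n : ℝ)) := by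
      ext τ
      simp only [mem_ofPred_eq, mem_iInter, mem_inter_iff, mem_preimage, mem_Iic]
      exact ⟨fun h x => ⟨h.1, h.2 x⟩, fun h => ⟨(h 0).1, fun x => (h x).2⟩⟩
    rw [this]
    refine isClosed_iInter fun x => ContinuousOn.preimage_isClosed_of_isClosed ?_ isClosed_Icc
      isClosed_Iic
    refine continuousOn_const.mul (ContinuousOn.norm ?_)
    exact h.cont_z.comp (f := fun τ : ℝ => (τ, x)) (by fun_prop) fun τ hτ => ⟨hτ, mem_univ _⟩
  · intro τ hτ
    obtain ⟨n, hn⟩ := exists_one_add_sq_mul_le (Z τ)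
    exact mem_iUnion.2 ⟨n, hτ, hn⟩
  · intro n
    refine ⟨(b ^ (2 * (-(1 / 4) - 0) : ℝ)) ^ 2 * (n ^ 2 * π), fun τ hτ => ?_⟩
    have h1 := nm_mono (s := 0) hb (r := -(1 / 4)) (by norm_num) (Z τ)
    rw [nm_zero] at h1
    calc _ ≤ (b ^ (2 * (-(1 / 4) - 0) : ℝ) * L2 (Z τ)) ^ 2 :=
          pow_le_pow_left₀ (nm_nonneg _ _ _) h1 2
      _ = (b ^ (2 * (-(1 / 4) - 0) : ℝ)) ^ 2 * L2 (Z τ) ^ 2 := mul_pow _ _ _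
      _ ≤ _ := mul_le_mul_of_nonneg_left (L2_sq_le_of_decay hτ.2) (sq_nonneg _)

end LinKdV

namespace LinKdV
open Filter Topology
open scoped ContDiff

lemma lintegral_le_of_nm_le {f g : Sch} {b₀ : ℝ} (hb₀ : 0 < b₀)
    (h : ∀ b, 0 < b → b ≤ b₀ → nm b (-(1 / 4)) f ^ 2 ≤ 35 * nm b (-(1 / 4)) g ^ 2) :
    ∫⁻ ξ, ENNReal.ofReal (|2 * π * ξ|⁻¹ * ‖𝓕 f ξ‖ ^ 2) ≤
      35 * ∫⁻ ξ, ENNReal.ofReal (|2 * π * ξ|⁻¹ * ‖𝓕 g ξ‖ ^ 2) := by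
  set b : ℕ → ℝ := fun n => b₀ * (1 / ((n : ℝ) + 1)) with hbdef
  have hb0 : ∀ n, 0 < b n := fun n => by positivity
  have hbb : ∀ n, b n ≤ b₀ := fun n => by
    refine mul_le_of_le_one_right hb₀.le ?_
    rw [div_le_one (by positivity)]; linarith [n.cast_nonneg (α := ℝ)]
  have hblim : Tendsto b atTop (𝓝 0) := by
    simpa [hbdef] using (tendsto_one_div_add_atTop_nhds_zero_nat (𝕜 := ℝ)).const_mul b₀
  have hlint : ∀ (k : Sch) (n : ℕ),
      ∫⁻ ξ, ENNReal.ofReal (jsym (b n) (2 * -(1 / 4)) ξ * ‖𝓕 k ξ‖ ^ 2) =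
        ENNReal.ofReal (nm (b n) (-(1 / 4)) k ^ 2) := fun k n => by
    rw [nm_sq (hb0 n), ofReal_integral_eq_lintegral_ofReal]
    · have := integrable_mult (js_temperate (hb0 n) (-(1 / 4))) k
      refine this.congr (Eventually.of_forall fun ξ => ?_)
      simp only [norm_js (hb0 n), jsym_sq (hb0 n)]
    · exact Eventually.of_forall fun ξ => mul_nonneg (jsym_pos (hb0 n) _ _).le (sq_nonneg _)
  have hsym : ∀ n ξ, jsym (b n) (2 * -(1 / 4)) ξ = (√(b n ^ 2 + (2 * π * ξ) ^ 2))⁻¹ := fun n ξ => by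
    rw [← jsym_neg_half (hb0 n)]; norm_num
  have hlim : ∀ ξ ≠ 0, ENNReal.ofReal (|2 * π * ξ|⁻¹ * ‖𝓕 f ξ‖ ^ 2) =
      liminf (fun n => ENNReal.ofReal (jsym (b n) (2 * -(1 / 4)) ξ * ‖𝓕 f ξ‖ ^ 2)) atTop := by
    intro ξ hξ
    refine (Tendsto.liminf_eq ?_).symm
    refine ENNReal.tendsto_ofReal (Tendsto.mul_const _ ?_)
    simp only [hsym]
    have hne : |2 * π * ξ| ≠ 0 := by positivity
    refine Tendsto.inv₀ ?_ hne
    have : Tendsto (fun n => √(b n ^ 2 + (2 * π * ξ) ^ 2)) atTop (𝓝 √(0 ^ 2 + (2 * π * ξ) ^ 2)) :=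
      ((hblim.pow 2).add_const _).sqrt
    simpa [sqrt_sq_eq_abs] using this
  have hae : ∀ᵐ ξ : ℝ, ξ ≠ 0 := by simp [ae_iff]
  calc ∫⁻ ξ, ENNReal.ofReal (|2 * π * ξ|⁻¹ * ‖𝓕 f ξ‖ ^ 2)
      = ∫⁻ ξ, liminf (fun n => ENNReal.ofReal (jsym (b n) (2 * -(1 / 4)) ξ * ‖𝓕 f ξ‖ ^ 2))
          atTop := lintegral_congr_ae (hae.mono fun ξ hξ => hlim ξ hξ)
    _ ≤ liminf (fun n => ∫⁻ ξ, ENNReal.ofReal (jsym (b n) (2 * -(1 / 4)) ξ * ‖𝓕 f ξ‖ ^ 2))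
          atTop := lintegral_liminf_le fun n => by
            have h1 := (jsym_temperate (hb0 n) (2 * -(1 / 4))).1.continuous
            have h2 := (𝓕 f).continuous
            fun_prop
    _ ≤ 35 * ∫⁻ ξ, ENNReal.ofReal (|2 * π * ξ|⁻¹ * ‖𝓕 g ξ‖ ^ 2) := by
      refine liminf_le_of_le (by isBoundedDefault) fun c hc => ?_
      obtain ⟨n, hn⟩ := hc.exists
      refine hn.trans ?_
      rw [hlint]
      refine (ENNReal.ofReal_le_ofReal (h _ (hb0 n) (hbb n))).trans ?_
      rw [ENNReal.ofReal_mul (by norm_num), ← hlint]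
      simp only [ENNReal.ofReal_ofNat]
      refine mul_le_mul' le_rfl ?_
      refine lintegral_mono_ae (hae.mono fun ξ hξ => ENNReal.ofReal_le_ofReal ?_)
      rw [hsym]
      have : 0 < |2 * π * ξ| := by positivity
      gcongr
      rw [← sqrt_sq_eq_abs]
      exact sqrt_le_sqrt (by linarith [sq_nonneg (b n)])

lemma HsNorm_neg_half_eq {f : Sch} {v : ℝ → ℝ} (hf : ∀ x, f x = (v x : ℂ)) :
    HsNorm (-(1 : ℝ) / 2) v = √(2 * π *
      (∫⁻ ξ, ENNReal.ofReal (|2 * π * ξ|⁻¹ * ‖𝓕 f ξ‖ ^ 2)).toReal) := by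
  have hFT : FT v = 𝓕 f := by
    rw [SchwartzMap.fourier_coe]
    unfold FT
    congr 1
    exact funext fun x => (hf x).symm
  have hm : AEStronglyMeasurable (fun ξ => |2 * π * ξ|⁻¹ * ‖𝓕 f ξ‖ ^ 2) := by
    have h2 := (𝓕 f).continuous
    exact Measurable.aestronglyMeasurable (by fun_prop)
  rw [← integral_eq_lintegral_of_nonneg_ae (Eventually.of_forall fun ξ => by positivity) hm,
    ← integral_const_mul, HsNorm, sqrt_eq_rpow, hFT]
  congr 2
  ext ξ
  rw [← mul_assoc]
  congr 1
  rw [show (2 * (-(1 : ℝ) / 2)) = -1 by norm_num, rpow_neg_one, abs_mul, abs_of_pos two_pi_pos,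
    mul_inv, ← mul_assoc, mul_inv_cancel₀ two_pi_pos.ne', one_mul]

lemma HsNorm_le_of_nm_le {f g : Sch} {v w : ℝ → ℝ} (hf : ∀ x, f x = (v x : ℂ))
    (hg : ∀ x, g x = (w x : ℂ)) {b₀ : ℝ} (hb₀ : 0 < b₀)
    (h : ∀ b, 0 < b → b ≤ b₀ → nm b (-(1 / 4)) f ^ 2 ≤ 35 * nm b (-(1 / 4)) g ^ 2)
    (h' : ∀ b, 0 < b → b ≤ b₀ → nm b (-(1 / 4)) g ^ 2 ≤ 35 * nm b (-(1 / 4)) f ^ 2) :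
    HsNorm (-(1 : ℝ) / 2) v ≤ 6 * HsNorm (-(1 : ℝ) / 2) w := by
  rw [HsNorm_neg_half_eq hf, HsNorm_neg_half_eq hg]
  have H := lintegral_le_of_nm_le hb₀ h
  have H' := lintegral_le_of_nm_le hb₀ h'
  set A := ∫⁻ ξ, ENNReal.ofReal (|2 * π * ξ|⁻¹ * ‖𝓕 f ξ‖ ^ 2)
  set B := ∫⁻ ξ, ENNReal.ofReal (|2 * π * ξ|⁻¹ * ‖𝓕 g ξ‖ ^ 2)
  have key : A.toReal ≤ 35 * B.toReal := by
    rcases eq_or_ne B ⊤ with hB | hB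
    · have hA : A = ⊤ := by
        by_contra hA
        rw [hB] at H'
        exact ENNReal.mul_ne_top (by norm_num) hA (top_le_iff.1 H')
      simp [hA, hB]
    · have := ENNReal.toReal_mono (ENNReal.mul_ne_top (by norm_num) hB) H
      simpa using this
  rw [show (6 : ℝ) = √(6 ^ 2) by rw [sqrt_sq (by norm_num)], ← sqrt_mul (by norm_num)]
  refine sqrt_le_sqrt ?_
  have := mul_le_mul_of_nonneg_left key two_pi_pos.le
  have : 0 ≤ 2 * π * B.toReal := by positivity
  linarith

end LinKdV

namespace LinKdV
open Filter Topology
open scoped ContDiff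

lemma exists_complexification {v : ℝ → ℝ} (h : ∃ f : 𝓢(ℝ, ℝ), ∀ x, v x = f x) :
    ∃ F : Sch, ∀ x, F x = (v x : ℂ) := by
  obtain ⟨f, hf⟩ := h
  exact ⟨f.postcompCLM Complex.ofRealCLM, fun x => by simp [SchwartzMap.postcompCLM_apply, hf x]⟩

lemma D_apply_eq_deriv {F : Sch} {v : ℝ → ℝ} (h : ∀ x, F x = (v x : ℂ)) (x : ℝ) :
    D F x = ((deriv v x : ℝ) : ℂ) := by
  have h1 := D_hasDerivAt F x
  have hre : HasDerivAt v (D F x).re x := by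
    have := Complex.reCLM.hasFDerivAt.comp_hasDerivAt x h1
    refine this.congr_of_eventuallyEq (Eventually.of_forall fun y => ?_)
    simp [h y]
  have him : (D F x).im = 0 := by
    have := Complex.imCLM.hasFDerivAt.comp_hasDerivAt x h1
    refine (this.congr_of_eventuallyEq (f₁ := fun _ => (0 : ℝ)) ?_).unique (hasDerivAt_const x 0)
    exact Eventually.of_forall fun y => by simp [h y]
  rw [hre.deriv]
  exact Complex.ext rfl him

lemma D_D_D_apply_eq {F : Sch} {v : ℝ → ℝ} (h : ∀ x, F x = (v x : ℂ)) (x : ℝ) :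
    D (D (D F)) x = ((iteratedDeriv 3 v x : ℝ) : ℂ) := by
  have h1 := D_apply_eq_deriv h
  have h2 := D_apply_eq_deriv h1
  have h3 := D_apply_eq_deriv h2 x
  rw [h3]
  simp [iteratedDeriv_succ]

lemma zrhs_apply_eq {F G : Sch} {u z : ℝ → ℝ} (hF : ∀ x, F x = (u x : ℂ))
    (hG : ∀ x, G x = (z x : ℂ)) (x : ℝ) :
    zrhs F G x = ((-iteratedDeriv 3 z x + 6 * deriv (fun y => u y * z y) x : ℝ) : ℂ) := by
  have h1 : ∀ y, mulS F G y = ((u y * z y : ℝ) : ℂ) := fun y => by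
    rw [mulS_apply, hF, hG]; push_cast; rfl
  rw [zrhs, add_apply, neg_apply, smul_apply,
    D_D_D_apply_eq hG, D_apply_eq_deriv h1]
  simp

lemma urhs_apply_eq {F : Sch} {u : ℝ → ℝ} (hF : ∀ x, F x = (u x : ℂ)) (x : ℝ) :
    urhs F x = ((-iteratedDeriv 3 u x + 6 * u x * deriv u x : ℝ) : ℂ) := by
  rw [urhs, add_apply, neg_apply, smul_apply,
    D_D_D_apply_eq hF, mulS_apply, hF, D_apply_eq_deriv hF]
  simp [mul_assoc]

section TimeDerivative

variable {T : ℝ} {w : ℝ → ℝ → ℝ}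

lemma hasDerivAt_time (hw : ContDiffOn ℝ (⊤ : ℕ∞) (fun p : ℝ × ℝ => w p.1 p.2) (Icc 0 T ×ˢ univ))
    {τ : ℝ} (hτ : τ ∈ Ioo 0 T) (x : ℝ) :
    HasDerivAt (fun s => w s x) (fderiv ℝ (fun p : ℝ × ℝ => w p.1 p.2) (τ, x) (1, 0)) τ := by
  have hn : Icc 0 T ×ˢ (univ : Set ℝ) ∈ 𝓝 (τ, x) :=
    prod_mem_nhds (Icc_mem_nhds hτ.1 hτ.2) univ_mem
  have h1 : DifferentiableAt ℝ (fun p : ℝ × ℝ => w p.1 p.2) (τ, x) :=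
    (hw.contDiffAt hn).differentiableAt (by simp)
  have h2 : HasDerivAt (fun s : ℝ => (s, x)) ((1 : ℝ), (0 : ℝ)) τ :=
    (hasDerivAt_id τ).prodMk (hasDerivAt_const τ x)
  exact h1.hasFDerivAt.comp_hasDerivAt τ h2

lemma continuousOn_deriv_time
    (hw : ContDiffOn ℝ (⊤ : ℕ∞) (fun p : ℝ × ℝ => w p.1 p.2) (Icc 0 T ×ˢ univ)) :
    ContinuousOn (fun q : ℝ × ℝ => deriv (fun s => w s q.2) q.1) (Ioo 0 T ×ˢ univ) := by
  have h1 := (hw.mono (prod_mono_left Ioo_subset_Icc_self)).continuousOn_fderiv_of_isOpen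
    (isOpen_Ioo.prod isOpen_univ) (by simp)
  refine (h1.clm_apply (continuousOn_const (c := ((1 : ℝ), (0 : ℝ))))).congr fun q hq => ?_
  exact (hasDerivAt_time hw hq.1 q.2).deriv

variable {W : ℝ → Sch} {R : ℝ → Sch}

lemma continuousOn_complexification
    (hw : ContDiffOn ℝ (⊤ : ℕ∞) (fun p : ℝ × ℝ => w p.1 p.2) (Icc 0 T ×ˢ univ))
    (hW : ∀ τ ∈ Icc 0 T, ∀ x, W τ x = (w τ x : ℂ)) :
    ContinuousOn (fun q : ℝ × ℝ => W q.1 q.2) (Icc 0 T ×ˢ univ) :=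
  (Complex.continuous_ofReal.comp_continuousOn hw.continuousOn).congr fun q hq => hW q.1 hq.1 q.2

lemma hasDerivAt_complexification
    (hw : ContDiffOn ℝ (⊤ : ℕ∞) (fun p : ℝ × ℝ => w p.1 p.2) (Icc 0 T ×ˢ univ))
    (hW : ∀ τ ∈ Icc 0 T, ∀ x, W τ x = (w τ x : ℂ))
    (hR : ∀ τ ∈ Icc 0 T, ∀ x, R τ x = ((deriv (fun s => w s x) τ : ℝ) : ℂ))
    {τ : ℝ} (hτ : τ ∈ Ioo 0 T) (x : ℝ) : HasDerivAt (fun s => W s x) (R τ x) τ := by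
  rw [hR τ (Ioo_subset_Icc_self hτ)]
  refine (hasDerivAt_time hw hτ x).differentiableAt.hasDerivAt.ofReal_comp.congr_of_eventuallyEq ?_
  filter_upwards [Icc_mem_nhds hτ.1 hτ.2] with s hs using hW s hs x

lemma continuousOn_rhs
    (hw : ContDiffOn ℝ (⊤ : ℕ∞) (fun p : ℝ × ℝ => w p.1 p.2) (Icc 0 T ×ˢ univ))
    (hR : ∀ τ ∈ Icc 0 T, ∀ x, R τ x = ((deriv (fun s => w s x) τ : ℝ) : ℂ)) :
    ContinuousOn (fun q : ℝ × ℝ => R q.1 q.2) (Ioo 0 T ×ˢ univ) :=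
  (Complex.continuous_ofReal.comp_continuousOn (continuousOn_deriv_time hw)).congr fun q hq =>
    hR q.1 (Ioo_subset_Icc_self hq.1) q.2

end TimeDerivative

lemma Bootstrap.exists_deriv_sq_le {M ε T : ℝ} {u : ℝ → ℝ → ℝ}
    (hT : 0 < T) (hm : 0 ≤ M * ε) (h : ∀ t, 0 < t → t ≤ T → Bootstrap M ε t (u t))
    {α : ℝ} (hα : 0 < α) :
    ∃ C : ℝ, 0 ≤ C ∧ ∀ τ ∈ Icc α T, ∀ x, deriv (u τ) x ^ 2 ≤ C * (1 + |x|) := by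
  refine ⟨(M * ε * α ^ (-(3 : ℝ) / 4)) ^ 2 * (1 + T ^ (1 / 3 : ℝ)), by positivity,
    fun τ hτ x => ?_⟩
  have hτ0 := hα.trans_le hτ.1
  have h1 := (h τ hτ0 hτ.2 x).2
  set y := x ^ 2 + τ ^ ((2 : ℝ) / 3) with hy
  set q := (1 + T ^ (1 / 3 : ℝ)) * (1 + |x|) with hq
  have hS : 0 ≤ T ^ (1 / 3 : ℝ) := by positivity
  have hq1 : 1 ≤ q := by rw [hq]; nlinarith [abs_nonneg x, mul_nonneg hS (abs_nonneg x)]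
  have hy0 : 0 ≤ y := by positivity
  have hyq : y ≤ q ^ 2 := by
    have h2 : τ ^ ((2 : ℝ) / 3) ≤ (T ^ (1 / 3 : ℝ)) ^ 2 := by
      rw [← rpow_natCast, ← rpow_mul hT.le]
      norm_num
      exact rpow_le_rpow hτ0.le hτ.2 (by norm_num)
    rw [hy, hq, ← sq_abs x]
    nlinarith [abs_nonneg x, mul_nonneg hS (abs_nonneg x)]
  have hjb : (jb τ x ^ ((1 : ℝ) / 4)) ^ 2 ≤ q := by
    rw [jb, ← hy, ← rpow_mul hy0, ← rpow_natCast, ← rpow_mul hy0]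
    calc y ^ ((1 : ℝ) / 2 * (1 / 4) * (2 : ℕ)) ≤ (q ^ 2) ^ ((1 : ℝ) / 2 * (1 / 4) * (2 : ℕ)) :=
          rpow_le_rpow hy0 hyq (by norm_num)
      _ = q ^ (1 / 2 : ℝ) := by
        rw [← rpow_natCast, ← rpow_mul (by linarith)]; norm_num
      _ ≤ q ^ (1 : ℝ) := rpow_le_rpow_of_exponent_le hq1 (by norm_num)
      _ = q := rpow_one q
  have hα' : τ ^ (-(3 : ℝ) / 4) ≤ α ^ (-(3 : ℝ) / 4) :=
    rpow_le_rpow_of_nonpos hα hτ.1 (by norm_num)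
  have hjb0 : 0 ≤ jb τ x ^ ((1 : ℝ) / 4) := by unfold jb; positivity
  calc deriv (u τ) x ^ 2 = |deriv (u τ) x| ^ 2 := (sq_abs _).symm
    _ ≤ (M * ε * τ ^ (-(3 : ℝ) / 4) * jb τ x ^ ((1 : ℝ) / 4)) ^ 2 := by gcongr
    _ = (M * ε * τ ^ (-(3 : ℝ) / 4)) ^ 2 * (jb τ x ^ ((1 : ℝ) / 4)) ^ 2 := mul_pow _ _ _
    _ ≤ (M * ε * α ^ (-(3 : ℝ) / 4)) ^ 2 * q := by gcongr
    _ = _ := by rw [hq]; ring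

end LinKdV

namespace LinKdV

lemma exists_evo {κ M ε T : ℝ} (hκ : 1 ≤ κ) (hm : 0 ≤ M * ε) (hT : 0 < T)
    (hb : ∀ (M ε s t : ℝ) (v : ℝ → ℝ) (u : Sch),
      0 ≤ M * ε → 0 < s → s ≤ t → t ≤ 2 * s → Bootstrap M ε t v → (∀ x, u x = (v x : ℂ)) →
      (∀ x, ‖u x‖ ≤ M * ε * s ^ (-(1 / 3) : ℝ)) ∧
      ∀ f, nm (s ^ (-(1 / 3) : ℝ)) (1 / 4) (mulS u f) ≤
        κ * (M * ε) * s ^ (-(1 / 3) : ℝ) * nm (s ^ (-(1 / 3) : ℝ)) (1 / 4) f)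
    {u : ℝ → ℝ → ℝ} (hu : IsKdVOn (Icc 0 T) u)
    (hboot : ∀ t : ℝ, 0 < t → t ≤ T → Bootstrap M ε t (u t)) {z : ℝ → ℝ → ℝ}
    (hz : ContDiffOn ℝ (⊤ : ℕ∞) (fun p : ℝ × ℝ => z p.1 p.2) (Icc 0 T ×ˢ univ))
    (hzS : ∀ t ∈ Icc (0 : ℝ) T, ∃ f : 𝓢(ℝ, ℝ), ∀ x, z t x = f x)
    (hzeq : ∀ t ∈ Icc (0 : ℝ) T, ∀ x : ℝ,
      deriv (fun s => z s x) t + iteratedDeriv 3 (z t) x = 6 * deriv (fun y => u t y * z t y) x) :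
    ∃ Z U : ℝ → Sch, Evo T (M * ε) κ Z U ∧ ∀ τ ∈ Icc 0 T, ∀ x, Z τ x = (z τ x : ℂ) := by
  obtain ⟨huc, huS, hueq⟩ := hu
  have hZ : ∀ t, ∃ F : Sch, t ∈ Icc 0 T → ∀ x, F x = (z t x : ℂ) := fun t => by
    by_cases ht : t ∈ Icc 0 T
    · obtain ⟨F, hF⟩ := exists_complexification (hzS t ht)
      exact ⟨F, fun _ => hF⟩
    · exact ⟨0, fun h => absurd h ht⟩
  have hU : ∀ t, ∃ F : Sch, t ∈ Icc 0 T → ∀ x, F x = (u t x : ℂ) := fun t => by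
    by_cases ht : t ∈ Icc 0 T
    · obtain ⟨F, hF⟩ := exists_complexification (huS t ht)
      exact ⟨F, fun _ => hF⟩
    · exact ⟨0, fun h => absurd h ht⟩
  choose Z hZ using hZ
  choose U hU using hU
  have hRz : ∀ τ ∈ Icc 0 T, ∀ x,
      zrhs (U τ) (Z τ) x = ((deriv (fun s => z s x) τ : ℝ) : ℂ) := fun τ hτ x => by
    rw [zrhs_apply_eq (hU τ hτ) (hZ τ hτ), ← hzeq τ hτ x]
    congr 1
    ring
  have hRu : ∀ τ ∈ Icc 0 T, ∀ x,
      urhs (U τ) x = ((deriv (fun s => u s x) τ : ℝ) : ℂ) := fun τ hτ x => by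
    rw [urhs_apply_eq (hU τ hτ)]
    congr 1
    linarith [hueq τ hτ x]
  refine ⟨Z, U, ?_, hZ⟩
  exact
    { T_pos := hT
      m_nonneg := hm
      one_le := hκ
      real := fun τ hτ x => by rw [hU τ hτ, Complex.conj_ofReal]
      cont_z := continuousOn_complexification hz hZ
      deriv_z := fun τ hτ x =>
        hasDerivAt_complexification (R := fun τ => zrhs (U τ) (Z τ)) hz hZ hRz hτ x
      cont_dz := continuousOn_rhs (R := fun τ => zrhs (U τ) (Z τ)) hz hRz
      cont_u := (continuousOn_complexification huc hU).mono (prod_mono_left Ioo_subset_Icc_self)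
      deriv_u := fun τ hτ x =>
        hasDerivAt_complexification (R := fun τ => urhs (U τ)) huc hU hRu hτ x
      cont_du := continuousOn_rhs (R := fun τ => urhs (U τ)) huc hRu
      bound := fun s t hs hst hts htT => by
        have ht := hs.trans_le hst
        exact hb M ε s t (u t) (U t) hm hs hst hts (hboot t ht htT) (hU t ⟨ht.le, htT⟩)
      grow := fun α hα => by
        obtain ⟨C, hC, H⟩ := Bootstrap.exists_deriv_sq_le hT hm hboot hα
        refine ⟨C, hC, fun τ hτ x => ?_⟩
        rw [D_apply_eq_deriv (hU τ ⟨hα.le.trans hτ.1, hτ.2⟩), Complex.norm_real,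
          Real.norm_eq_abs, sq_abs]
        exact H τ hτ x }

lemma small_of_le {κ M ε T : ℝ} (hκ : 1 ≤ κ) (hM : 1 ≤ M) (hε : 0 < ε) (hT : 0 < T)
    (h : T ≤ (6240 * κ * M)⁻¹ ^ 3 * ε ^ (-(3 : ℝ))) :
    624 * κ * (M * ε) * T ^ (1 / 3 : ℝ) ≤ 1 / 10 := by
  have hκ0 : 0 < κ := by linarith
  have hM0 : 0 < M := by linarith
  have h1 : T ^ (1 / 3 : ℝ) ≤ (6240 * κ * M * ε)⁻¹ := by
    have h2 : (6240 * κ * M)⁻¹ ^ 3 * ε ^ (-(3 : ℝ)) = ((6240 * κ * M * ε)⁻¹) ^ (3 : ℝ) := by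
      rw [rpow_neg hε.le, inv_rpow (by positivity), mul_rpow (by positivity) hε.le]
      norm_cast
      rw [mul_inv (_ ^ 3), inv_pow]
    calc T ^ (1 / 3 : ℝ) ≤ (((6240 * κ * M * ε)⁻¹) ^ (3 : ℝ)) ^ (1 / 3 : ℝ) :=
          rpow_le_rpow hT.le (h.trans_eq h2) (by norm_num)
      _ = (6240 * κ * M * ε)⁻¹ := by
        rw [← rpow_mul (by positivity)]; norm_num
  calc 624 * κ * (M * ε) * T ^ (1 / 3 : ℝ) ≤ 624 * κ * (M * ε) * (6240 * κ * M * ε)⁻¹ := by gcongr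
    _ = 1 / 10 := by field_simp; norm_num

end LinKdV

/-- `Ḣ^{-1/2}` well-posedness bounds for the linearized KdV equation
`∂ₜz + ∂ₓ³z = 6∂ₓ(uz)` on the quartic time scale. -/
theorem linearized_kdv_H_neg_half_bounds :
    ∃ C ε₀ : ℝ, 0 < C ∧ 0 < ε₀ ∧
      ∀ M : ℝ, 1 ≤ M → ∃ c : ℝ, 0 < c ∧
      ∀ ε : ℝ, 0 < ε → ε ≤ ε₀ → ∀ T : ℝ, 0 < T → T ≤ c * ε ^ (-(3:ℝ)) →
      ∀ u : ℝ → ℝ → ℝ, IsKdVOn (Set.Icc 0 T) u →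
        BesovNorm (u 0) + HsNorm ((1:ℝ)/2) (fun x => x * u 0 x) ≤ ε →
        (∀ t : ℝ, 0 < t → t ≤ T → Bootstrap M ε t (u t)) →
        ∀ z : ℝ → ℝ → ℝ,
          ContDiffOn ℝ (⊤ : ℕ∞) (fun p : ℝ × ℝ => z p.1 p.2)
            (Set.Icc 0 T ×ˢ (Set.univ : Set ℝ)) →
          (∀ t ∈ Set.Icc (0:ℝ) T, ∃ f : 𝓢(ℝ, ℝ), ∀ x, z t x = f x) →
          (∀ t ∈ Set.Icc (0:ℝ) T, ∀ x : ℝ,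
            deriv (fun s => z s x) t + iteratedDeriv 3 (z t) x
              = 6 * deriv (fun y => u t y * z t y) x) →
          ∀ t ∈ Set.Icc (0:ℝ) T,
            C⁻¹ * HsNorm (-(1:ℝ)/2) (z 0) ≤ HsNorm (-(1:ℝ)/2) (z t) ∧
            HsNorm (-(1:ℝ)/2) (z t) ≤ C * HsNorm (-(1:ℝ)/2) (z 0) := by
  obtain ⟨κ, hκ, hb⟩ := LinKdV.exists_bootstrap_const
  refine ⟨6, 1, by norm_num, one_pos, fun M hM => ⟨(6240 * κ * M)⁻¹ ^ 3, by positivity, ?_⟩⟩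
  intro ε hε _ T hT hTc u hu _ hboot z hz hzS hzeq t ht
  obtain ⟨Z, U, hE, hZ⟩ := LinKdV.exists_evo hκ (by positivity) hT hb hu hboot hz hzS hzeq
  have hsmall := LinKdV.small_of_le hκ hM hε hT hTc
  have h0 : (0 : ℝ) ∈ Icc 0 T := left_mem_Icc.2 hT.le
  have key : ∀ τ ∈ Icc 0 T, ∀ σ ∈ Icc 0 T,
      HsNorm (-(1 : ℝ) / 2) (z σ) ≤ 6 * HsNorm (-(1 : ℝ) / 2) (z τ) := fun τ hτ σ hσ =>
    LinKdV.HsNorm_le_of_nm_le (hZ σ hσ) (hZ τ hτ) (rpow_pos_of_pos hT (-(1 / 3)))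
      (fun _ hb0 hbT => hE.nm_sq_le hb0 hbT hsmall hτ hσ)
      (fun _ hb0 hbT => hE.nm_sq_le hb0 hbT hsmall hσ hτ)
  exact ⟨by linarith [key t ht 0 h0], key 0 h0 t ht⟩
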